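/- Let a be a squarefree positive integer with a ≥ 3. Then for each l ∈ {0,2}, #Q_a(x;4,l) = (1/3)·li x + O(x/(log x · log log x)) as x → ∞; that is, there exist constants K > 0 and x₀ such that |#Q_a(x;4,l) − (1/3)·li x| ≤ K·x/(log x · log log x) for all x ≥ x₀. -/

import Mathlib

open scoped Classical

/-- The logarithmic integral `li x = ∫_2^x dt / log t`. -/
noncomputable def li (x : ℝ) : ℝ := ∫ t in (2:ℝ)..x, 1 / Real.log t

/-- `Qcount a x l = #Q_a(x;4,l)`: the number of odd primes `p ≤ x` with `p ∤ a` and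
the multiplicative order of `a` modulo `p` congruent to `l` mod `4`. -/
noncomputable def Qcount (a : ℕ) (x : ℝ) (l : ℕ) : ℕ :=
  Set.ncard {p : ℕ | p.Prime ∧ p ≠ 2 ∧ ¬(p ∣ a) ∧ (p : ℝ) ≤ x ∧
    orderOf (a : ZMod p) % 4 = l}

open Metric in
lemma exists_log_ball {f : ℂ → ℂ} {c : ℂ} {R : ℝ} (hR : 0 < R)
    (hf : DifferentiableOn ℂ f (ball c R)) (hnz : ∀ s ∈ ball c R, f s ≠ 0) :
    ∃ φ : ℂ → ℂ, φ c = 0 ∧ (∀ s ∈ ball c R, HasDerivAt φ (deriv f s / f s) s) ∧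
      ∀ s ∈ ball c R, f s = f c * Complex.exp (φ s) := by
  have hd : DifferentiableOn ℂ (deriv f) (ball c R) := hf.deriv isOpen_ball
  obtain ⟨φ0, hφ0⟩ := (hd.div hf hnz).isExactOn_ball
  have hφ : ∀ s ∈ ball c R, HasDerivAt (fun s => φ0 s - φ0 c) (deriv f s / f s) s :=
    fun s hs => (hφ0 s hs).sub_const _
  refine ⟨fun s => φ0 s - φ0 c, by simp, hφ, ?_⟩
  have key : ∀ s ∈ ball c R, HasDerivAt (fun s => f s * Complex.exp (-(φ0 s - φ0 c))) 0 s := by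
    intro s hs
    have h1 := (hf.differentiableAt (isOpen_ball.mem_nhds hs)).hasDerivAt
    have h2 := (hφ s hs).fun_neg.cexp
    have h3 := h1.mul h2
    have := hnz s hs
    have e : deriv f s * Complex.exp (-(φ0 s - φ0 c)) +
        f s * (Complex.exp (-(φ0 s - φ0 c)) * -(deriv f s / f s)) = 0 := by
      field_simp; ring
    rw [e] at h3
    exact h3
  intro s hs
  have hc : c ∈ ball c R := mem_ball_self hR
  have := (convex_ball c R).is_const_of_fderivWithin_eq_zero (𝕜 := ℂ)
    (f := fun s => f s * Complex.exp (-(φ0 s - φ0 c)))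
    (fun s hs => (key s hs).differentiableAt.differentiableWithinAt) (fun s hs => by
      rw [fderivWithin_of_isOpen isOpen_ball hs]
      rw [(key s hs).hasFDerivAt.fderiv]; simp) hs hc
  simp only [sub_self, neg_zero, Complex.exp_zero, mul_one] at this
  rw [← this, mul_assoc, ← Complex.exp_add]; simp

open Metric in
lemma logDeriv_bound {f : ℂ → ℂ} {c : ℂ} {R r L : ℝ} (hR : 0 < R) (hr : r < R)
    (hf : DifferentiableOn ℂ f (ball c R)) (hnz : ∀ s ∈ ball c R, f s ≠ 0) (hL : 0 < L)
    (hM : ∀ s ∈ ball c R, ‖f s‖ ≤ Real.exp L * ‖f c‖) :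
    ∀ s ∈ closedBall c r, ‖deriv f s / f s‖ ≤ 8 * L * R / (R - r) ^ 2 := by
  obtain ⟨φ, h0, hφ, hexp⟩ := exists_log_ball hR hf hnz
  have hc : c ∈ ball c R := mem_ball_self hR
  have hre : ∀ s ∈ ball c R, (φ s).re ≤ L := by
    intro s hs
    have h1 := hM s hs
    rw [hexp s hs, norm_mul, Complex.norm_exp, mul_comm] at h1
    exact Real.exp_le_exp.1 (le_of_mul_le_mul_right h1 (norm_pos_iff.2 (hnz c hc)))
  have hbc : ∀ s ∈ ball c R, ‖φ s‖ ≤ 2 * L * ‖s - c‖ / (R - ‖s - c‖) := by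
    intro s hs
    have hm : ∀ z ∈ ball (0:ℂ) R, z + c ∈ ball c R := fun z hz => by
      simpa [dist_eq_norm] using hz
    have := Complex.borelCaratheodory_zero (f := fun z => φ (z + c)) (M := L) (R := R) (z := s - c) hL
      (fun z hz => ((hφ _ (hm z hz)).comp_add_const z c).differentiableAt.differentiableWithinAt)
      (fun z hz => hre _ (hm z hz)) hR (by simpa [dist_eq_norm] using hs) (by simpa using h0)
    simpa using this
  intro s hs
  rw [mem_closedBall, dist_eq_norm] at hs
  have hsR : s ∈ ball c R := by rw [mem_ball, dist_eq_norm]; linarith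
  rw [← (hφ s hsR).deriv]
  set q := (R - r) / 2 with hq
  have hq0 : 0 < q := by rw [hq]; linarith
  have hsub : ∀ z ∈ closedBall s q, ‖z - c‖ ≤ R - q := by
    intro z hz
    rw [mem_closedBall, dist_eq_norm] at hz
    have := norm_sub_le_norm_sub_add_norm_sub z s c
    linarith
  have hsubB : ∀ z ∈ closedBall s q, z ∈ ball c R := by
    intro z hz
    rw [mem_ball, dist_eq_norm]; linarith [hsub z hz]
  have := Complex.norm_deriv_le_of_forall_mem_sphere_norm_le (f := φ) (c := s) (R := q)
    (C := 2 * L * R / q) hq0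
    (DifferentiableOn.diffContOnCl fun z hz => (hφ z (hsubB z (by
      rwa [closure_ball _ hq0.ne'] at hz))).differentiableAt.differentiableWithinAt) (by
      intro z hz
      have hz' := sphere_subset_closedBall hz
      refine (hbc z (hsubB z hz')).trans ?_
      have h1 := hsub z hz'
      gcongr
      · linarith
      · linarith)
  refine this.trans (le_of_eq ?_)
  rw [hq]
  have : R - r ≠ 0 := by linarith
  field_simp
  ring

open Metric in
/-- dividing out one zero -/
lemma divide_zero {f : ℂ → ℂ} {c z : ℂ} {ρ M : ℝ} (hρ : 0 < ρ)
    (hf : AnalyticOnNhd ℂ f (closedBall c ρ)) (hM : ∀ s ∈ closedBall c ρ, ‖f s‖ ≤ M * ‖f c‖)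
    (hc : f c ≠ 0) (hz : z ∈ closedBall c (ρ / 3)) (hfz : f z = 0) :
    ∃ g : ℂ → ℂ, AnalyticOnNhd ℂ g (closedBall c ρ) ∧ (∀ s, f s = (s - z) * g s) ∧ g c ≠ 0 ∧
      (∀ s ∈ closedBall c ρ, ‖g s‖ ≤ M / 2 * ‖g c‖) ∧
      deriv f c / f c = 1 / (c - z) + deriv g c / g c := by
  have hzc : z ≠ c := by rintro rfl; exact hc hfz
  have hfac : ∀ s, f s = (s - z) * dslope f z s := by
    intro s
    have := sub_smul_dslope f z s
    rw [hfz, sub_zero, smul_eq_mul] at this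
    exact this.symm
  rw [mem_closedBall, dist_eq_norm] at hz
  have hzB : z ∈ closedBall c ρ := by rw [mem_closedBall, dist_eq_norm]; linarith
  have hg : AnalyticOnNhd ℂ (dslope f z) (closedBall c ρ) := by
    intro s hs
    by_cases h : s = z
    · subst h
      obtain ⟨p, hp⟩ := hf s hs
      exact ⟨_, hp.has_fpower_series_dslope_fslope⟩
    · have h1 : AnalyticAt ℂ (fun s => (s - z)⁻¹ * f s) s :=
        ((analyticAt_id.sub analyticAt_const).inv (sub_ne_zero.2 h)).mul (hf s hs)
      refine h1.congr ?_
      filter_upwards [isOpen_ne.mem_nhds h] with t ht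
      rw [hfac t]; field_simp [sub_ne_zero.2 ht]
  have hgc : dslope f z c ≠ 0 := by
    intro h; apply hc; rw [hfac c, h, mul_zero]
  have hcz : c - z ≠ 0 := sub_ne_zero.2 hzc.symm
  refine ⟨dslope f z, hg, hfac, hgc, ?_, ?_⟩
  · have hsph : ∀ s ∈ sphere c ρ, ‖dslope f z s‖ ≤ M / 2 * ‖dslope f z c‖ := by
      intro s hs
      have h1 := hM s (sphere_subset_closedBall hs)
      rw [hfac s, hfac c, norm_mul, norm_mul] at h1
      rw [mem_sphere, dist_eq_norm] at hs
      have h2 : ρ ≤ ‖s - z‖ + ‖z - c‖ := by rw [← hs]; exact norm_sub_le_norm_sub_add_norm_sub s z c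
      have h3 : ‖c - z‖ ≤ ρ / 3 := by rwa [norm_sub_rev]
      have hM0 : 0 ≤ M := by
        have := hM c (mem_closedBall_self hρ.le)
        have h4 := norm_pos_iff.2 hc
        nlinarith
      have h5 : (2 * ρ / 3) * ‖dslope f z s‖ ≤ M * (ρ / 3 * ‖dslope f z c‖) := by
        calc (2 * ρ / 3) * ‖dslope f z s‖ ≤ ‖s - z‖ * ‖dslope f z s‖ := by gcongr; linarith
          _ ≤ _ := h1
          _ ≤ _ := by gcongr
      have : (2 * ρ / 3) * ‖dslope f z s‖ ≤ (2 * ρ / 3) * (M / 2 * ‖dslope f z c‖) := by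
        linarith
      exact le_of_mul_le_mul_left this (by positivity)
    intro s hs
    refine Complex.norm_le_of_forall_mem_frontier_norm_le (U := ball c ρ) isBounded_ball ?_ ?_ (z := s) ?_
    · exact DifferentiableOn.diffContOnCl (by rw [closure_ball _ hρ.ne']; exact hg.differentiableOn)
    · intro w hw; rw [frontier_ball _ hρ.ne'] at hw; exact hsph w hw
    · rw [closure_ball _ hρ.ne']; exact hs
  · have h1 : HasDerivAt f (1 * dslope f z c + (c - z) * deriv (dslope f z) c) c := by
      have h2 := ((hasDerivAt_id c).sub_const z).mul
        (hg c (mem_closedBall_self hρ.le)).differentiableAt.hasDerivAt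
      exact h2.congr_of_eventuallyEq (Filter.Eventually.of_forall fun s => hfac s)
    rw [h1.deriv, hfac c]
    field_simp

open Metric in
lemma landau_zero {c : ℂ} {ρ : ℝ} (hρ : 0 < ρ) (n : ℕ) : ∀ {f : ℂ → ℂ} {M : ℝ}, M < 2 ^ n →
    AnalyticOnNhd ℂ f (closedBall c ρ) → (∀ s ∈ closedBall c ρ, ‖f s‖ ≤ M * ‖f c‖) →
    f c ≠ 0 → (∀ s ∈ closedBall c ρ, f s = 0 → s.re ≤ c.re) →
    -(24 * (Real.log M + 1) / ρ) ≤ (deriv f c / f c).re := by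
  induction n with
  | zero =>
    intro f M hM _ hb hc
    have := hb c (mem_closedBall_self hρ.le)
    have h4 := norm_pos_iff.2 hc
    simp at hM
    nlinarith
  | succ n ih =>
    intro f M hM hf hb hc hz
    have hM1 : 1 ≤ M := by
      have := hb c (mem_closedBall_self hρ.le)
      have h4 := norm_pos_iff.2 hc
      by_contra h; nlinarith
    by_cases hex : ∃ z ∈ closedBall c (ρ / 3), f z = 0
    · obtain ⟨z, hzm, hfz⟩ := hex
      obtain ⟨g, hg, hfac, hgc, hgb, hder⟩ := divide_zero hρ hf hb hc hzm hfz
      have hzB : z ∈ closedBall c ρ := closedBall_subset_closedBall (by linarith) hzm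
      have hi := ih (f := g) (M := M / 2) (by rw [pow_succ] at hM; linarith) hg hgb hgc
        (fun s hs h => hz s hs (by rw [hfac, h, mul_zero]))
      rw [hder, Complex.add_re]
      have h1 : 0 ≤ (1 / (c - z)).re := by
        rw [one_div, Complex.inv_re]
        have := hz z hzB hfz
        exact div_nonneg (by simpa using this) (Complex.normSq_nonneg _)
      have h2 : 24 * (Real.log (M / 2) + 1) / ρ ≤ 24 * (Real.log M + 1) / ρ := by
        have : Real.log (M / 2) ≤ Real.log M := Real.log_le_log (by linarith) (by linarith)
        gcongr
      linarith
    · push Not at hex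
      have hlog : 0 ≤ Real.log M := Real.log_nonneg hM1
      have hsub : ball c (ρ / 3) ⊆ closedBall c ρ :=
        ball_subset_closedBall.trans (closedBall_subset_closedBall (by linarith))
      have := logDeriv_bound (f := f) (c := c) (R := ρ / 3) (r := 0) (L := Real.log M + 1)
        (by positivity) (by positivity) (hf.differentiableOn.mono hsub)
        (fun s hs => hex s (ball_subset_closedBall hs)) (by linarith) (fun s hs => by
          refine (hb s (hsub hs)).trans ?_
          have : M ≤ Real.exp (Real.log M + 1) := by
            rw [Real.exp_add, Real.exp_log (by linarith)]
            nlinarith [Real.add_one_le_exp 1]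
          gcongr) c (by simp)
      have h2 := (abs_le.1 (Complex.abs_re_le_norm (deriv f c / f c))).1
      have h3 : 8 * (Real.log M + 1) * (ρ / 3) / (ρ / 3 - 0) ^ 2 = 24 * (Real.log M + 1) / ρ := by
        rw [sub_zero]; field_simp; norm_num
      linarith

open Metric in
/-- Landau lemma with no zero, one zero, two zeros. -/
lemma landau {f : ℂ → ℂ} {c : ℂ} {ρ M : ℝ} (hρ : 0 < ρ)
    (hf : AnalyticOnNhd ℂ f (closedBall c ρ)) (hb : ∀ s ∈ closedBall c ρ, ‖f s‖ ≤ M * ‖f c‖)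
    (hc : f c ≠ 0) (hz : ∀ s ∈ closedBall c ρ, f s = 0 → s.re ≤ c.re) :
    -(24 * (Real.log M + 1) / ρ) ≤ (deriv f c / f c).re ∧
    (∀ z ∈ closedBall c (ρ / 3), f z = 0 →
      -(24 * (Real.log M + 1) / ρ) + (1 / (c - z)).re ≤ (deriv f c / f c).re) ∧
    (∀ z ∈ closedBall c (ρ / 3), ∀ w ∈ closedBall c (ρ / 3), f z = 0 → f w = 0 →
      (w = z → deriv f z = 0) →
      -(24 * (Real.log M + 1) / ρ) + (1 / (c - z)).re + (1 / (c - w)).re ≤ (deriv f c / f c).re) := by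
  have L0 : ∀ {f : ℂ → ℂ} {M' : ℝ}, M' ≤ M →
      AnalyticOnNhd ℂ f (closedBall c ρ) → (∀ s ∈ closedBall c ρ, ‖f s‖ ≤ M' * ‖f c‖) →
      f c ≠ 0 → (∀ s ∈ closedBall c ρ, f s = 0 → s.re ≤ c.re) →
      -(24 * (Real.log M + 1) / ρ) ≤ (deriv f c / f c).re := by
    intro f M' hM' hf hb hc hz
    obtain ⟨n, hn⟩ := pow_unbounded_of_one_lt M (one_lt_two)
    refine landau_zero hρ n hn hf (fun s hs => (hb s hs).trans (by gcongr)) hc hz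
  have hM1 : 1 ≤ M := by
    have := hb c (mem_closedBall_self hρ.le)
    have h4 := norm_pos_iff.2 hc
    by_contra h; nlinarith
  refine ⟨L0 le_rfl hf hb hc hz, ?_, ?_⟩
  · intro z hzm hfz
    obtain ⟨g, hg, hfac, hgc, hgb, hder⟩ := divide_zero hρ hf hb hc hzm hfz
    have := L0 (by linarith) hg hgb hgc (fun s hs h => hz s hs (by rw [hfac, h, mul_zero]))
    rw [hder, Complex.add_re]; linarith
  · intro z hzm w hwm hfz hfw hzw
    obtain ⟨g, hg, hfac, hgc, hgb, hder⟩ := divide_zero hρ hf hb hc hzm hfz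
    have hgw : g w = 0 := by
      by_cases h : w = z
      · have hd := hzw h
        have h1 : HasDerivAt f (1 * g z + (z - z) * deriv g z) z := by
          have h2 := ((hasDerivAt_id z).sub_const z).mul
            (hg z (closedBall_subset_closedBall (by linarith) hzm)).differentiableAt.hasDerivAt
          exact h2.congr_of_eventuallyEq (Filter.Eventually.of_forall fun s => hfac s)
        rw [h1.deriv] at hd
        rw [h]; simpa using hd
      · have := hfac w
        rw [hfw] at this
        exact (mul_eq_zero.1 this.symm).resolve_left (sub_ne_zero.2 h)
    obtain ⟨k, hk, hkfac, hkc, hkb, hkder⟩ := divide_zero hρ hg hgb hgc hwm hgw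
    have := L0 (by linarith) hk hkb hkc
      (fun s hs h => hz s hs (by rw [hfac, hkfac, h, mul_zero, mul_zero]))
    rw [hder, hkder, Complex.add_re, Complex.add_re]; linarith

structure ZData (c Λ : ℕ → ℝ) (d : ℕ) (κ C δ : ℝ) : Prop where
  c_nonneg : ∀ n, 0 ≤ c n
  c_zero : c 0 = 0
  c_one : c 1 = 1
  L_nonneg : ∀ n, 0 ≤ Λ n
  L_le : ∀ n, Λ n ≤ d * ArithmeticFunction.vonMangoldt n
  conv : ∀ n, c n * Real.log n = ∑ x ∈ n.divisorsAntidiagonal, c x.1 * Λ x.2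
  κ_pos : 0 < κ
  one_le_C : 1 ≤ C
  δ_pos : 0 < δ
  δ_le : δ ≤ 1 / 2
  d_pos : 1 ≤ d
  count : ∀ X : ℝ, 1 ≤ X → |∑ n ∈ Finset.Icc 1 ⌊X⌋₊, c n - κ * X| ≤ κ * C * X ^ (1 - δ)

noncomputable def zE (c : ℕ → ℝ) (κ : ℝ) (t : ℝ) : ℝ :=
  if 1 ≤ t then (∑ n ∈ Finset.Icc 1 ⌊t⌋₊, c n) / κ - t else 0

noncomputable def zH (c : ℕ → ℝ) (κ : ℝ) (s : ℂ) : ℂ :=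
  s + s * (s - 1) * mellin (fun t => (zE c κ t : ℂ)) (-s)

namespace ZData
open Filter Topology Complex MeasureTheory Asymptotics
variable {c Λ : ℕ → ℝ} {d : ℕ} {κ C δ : ℝ} (Z : ZData c Λ d κ C δ)
include Z

lemma E_bound (t : ℝ) (ht : 0 < t) : |zE c κ t| ≤ C * t ^ (1 - δ) := by
  have hC := Z.one_le_C
  unfold zE
  split_ifs with h
  · have h1 := Z.count t h
    have hk := Z.κ_pos
    have : (∑ n ∈ Finset.Icc 1 ⌊t⌋₊, c n) / κ - t =
      (∑ n ∈ Finset.Icc 1 ⌊t⌋₊, c n - κ * t) / κ := by field_simp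
    rw [this, abs_div, abs_of_pos hk, div_le_iff₀ hk]
    linarith
  · simp only [abs_zero]; positivity

omit Z in
lemma E_meas : Measurable (zE c κ) := by
  unfold zE
  refine Measurable.ite measurableSet_Ici ?_ measurable_const
  have : Measurable (fun t : ℝ => ∑ n ∈ Finset.Icc 1 ⌊t⌋₊, c n) :=
    (measurable_from_nat (f := fun k => ∑ n ∈ Finset.Icc 1 k, c n)).comp Nat.measurable_floor
  exact (this.div_const _).sub measurable_id

lemma E_li : LocallyIntegrableOn (fun t => (zE c κ t : ℂ)) (Set.Ioi 0) := by
  have h1 : LocallyIntegrableOn (fun t : ℝ => C * t ^ (1 - δ)) (Set.Ioi 0) :=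
    ContinuousOn.locallyIntegrableOn (by
      intro t ht
      exact (continuousAt_const.mul (Real.continuousAt_rpow_const _ _ (Or.inl (ne_of_gt ht)))).continuousWithinAt)
      measurableSet_Ioi
  refine (locallyIntegrableOn_iff isOpen_Ioi.isLocallyClosed).2 fun k hk hkc => ?_
  have h2 := (locallyIntegrableOn_iff isOpen_Ioi.isLocallyClosed).1 h1 k hk hkc
  refine Integrable.mono' h2 ?_ ?_
  · exact (Complex.measurable_ofReal.comp E_meas).aestronglyMeasurable
  · refine (ae_restrict_mem hkc.measurableSet).mono fun t ht => ?_
    rw [Complex.norm_real]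
    exact Z.E_bound t (hk ht)

lemma E_top : (fun t => (zE c κ t : ℂ)) =O[atTop] (fun t : ℝ => t ^ (-(δ - 1))) := by
  refine IsBigO.of_bound C ?_
  filter_upwards [eventually_gt_atTop 0] with t ht
  rw [Complex.norm_real, Real.norm_of_nonneg (by positivity : (0:ℝ) ≤ t ^ (-(δ-1))), neg_sub]
  exact Z.E_bound t ht

omit Z in
lemma E_bot (b : ℝ) : (fun t => (zE c κ t : ℂ)) =O[𝓝[>] 0] (fun t : ℝ => t ^ (-b)) := by
  refine IsBigO.of_bound 0 ?_
  have : ∀ᶠ t : ℝ in 𝓝[>] 0, t < 1 := nhdsWithin_le_nhds (eventually_lt_nhds one_pos)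
  filter_upwards [this] with t ht
  simp [zE, not_le.2 ht]

lemma H_diffAt {s : ℂ} (hs : 1 - δ < s.re) : DifferentiableAt ℂ (zH c κ) s := by
  have h1 := mellin_differentiableAt_of_isBigO_rpow (s := -s) (b := (-s).re - 1) Z.E_li Z.E_top
    (by simp; linarith) (E_bot _) (by linarith)
  have h2 : DifferentiableAt ℂ (fun s => mellin (fun t => (zE c κ t : ℂ)) (-s)) s :=
    DifferentiableAt.fun_comp' (f := fun s : ℂ => -s) s h1 differentiableAt_id.neg
  unfold zH
  exact differentiableAt_id.add ((differentiableAt_id.mul (differentiableAt_id.sub_const _)).mul h2)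

lemma H_analytic {s : ℂ} (hs : 1 - δ < s.re) : AnalyticAt ℂ (zH c κ) s := by
  have : IsOpen {s : ℂ | 1 - δ < s.re} := isOpen_lt continuous_const Complex.continuous_re
  exact DifferentiableOn.analyticAt (s := {s : ℂ | 1 - δ < s.re})
    (fun z hz => (Z.H_diffAt hz).differentiableWithinAt) (this.mem_nhds hs)

omit Z in
lemma E_mellin_eq (s : ℂ) : mellin (fun t => (zE c κ t : ℂ)) (-s) =
    ∫ t in Set.Ioi (1:ℝ), (t:ℂ) ^ (-s - 1) * (zE c κ t : ℂ) := by
  unfold mellin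
  simp only [smul_eq_mul]
  rw [← integral_Ici_eq_integral_Ioi (x := (1:ℝ)), ← integral_indicator measurableSet_Ioi,
    ← integral_indicator measurableSet_Ici]
  congr 1
  ext t
  by_cases h : 1 ≤ t
  · rw [Set.indicator_of_mem (show t ∈ Set.Ioi (0:ℝ) from lt_of_lt_of_le one_pos h),
      Set.indicator_of_mem (show t ∈ Set.Ici (1:ℝ) from h)]
  · rw [Set.indicator_of_notMem (show t ∉ Set.Ici (1:ℝ) from h)]
    by_cases h0 : t ∈ Set.Ioi (0:ℝ)
    · rw [Set.indicator_of_mem h0]; simp [zE, h]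
    · rw [Set.indicator_of_notMem h0]

lemma mellin_bound {s : ℂ} (hs : 1 - δ / 2 ≤ s.re) :
    ‖mellin (fun t => (zE c κ t : ℂ)) (-s)‖ ≤ 2 * C / δ := by
  have hδ := Z.δ_pos
  have hC := Z.one_le_C
  rw [E_mellin_eq]
  have hlt : -1 - δ / 2 < -1 := by linarith
  have hint := (integrableOn_Ioi_rpow_of_lt hlt one_pos).const_mul C
  have h := norm_integral_le_of_norm_le (μ := volume.restrict (Set.Ioi (1:ℝ))) (f := fun t : ℝ => (t:ℂ) ^ (-s - 1) * (zE c κ t : ℂ)) hint ?_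
  · refine h.trans (le_of_eq ?_)
    rw [integral_const_mul, integral_Ioi_rpow_of_lt hlt one_pos]
    simp; ring_nf
  · refine (ae_restrict_mem measurableSet_Ioi).mono fun t (ht : 1 < t) => ?_
    have ht0 : 0 < t := by linarith
    rw [norm_mul, Complex.norm_real, Complex.norm_cpow_eq_rpow_re_of_pos ht0]
    calc t ^ (-s - 1).re * |zE c κ t| ≤ t ^ (-s - 1).re * (C * t ^ (1 - δ)) := by
          gcongr; exact Z.E_bound t ht0
      _ = C * t ^ ((-s - 1).re + (1 - δ)) := by rw [Real.rpow_add ht0]; ring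
      _ ≤ _ := by
          gcongr
          · exact ht.le
          · simp; linarith

lemma H_bound {s : ℂ} (hs : 1 - δ / 2 ≤ s.re) : ‖zH c κ s‖ ≤ ‖s‖ + ‖s‖ * ‖s - 1‖ * (2 * C / δ) := by
  unfold zH
  refine (norm_add_le _ _).trans ?_
  rw [norm_mul, norm_mul]
  gcongr
  exact Z.mellin_bound hs

omit Z in
lemma H_one : zH c κ 1 = 1 := by simp [zH]

omit Z in
lemma H_conj (s : ℂ) : zH c κ (starRingEnd ℂ s) = starRingEnd ℂ (zH c κ s) := by
  have : mellin (fun t => (zE c κ t : ℂ)) (-(starRingEnd ℂ s)) =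
      starRingEnd ℂ (mellin (fun t => (zE c κ t : ℂ)) (-s)) := by
    rw [E_mellin_eq, E_mellin_eq, ← integral_conj]
    refine setIntegral_congr_fun measurableSet_Ioi fun t (ht : 1 < t) => ?_
    simp only [map_mul, Complex.conj_ofReal]
    congr 1
    have h1 : (t:ℂ).arg ≠ Real.pi := by
      rw [Complex.arg_ofReal_of_nonneg (by linarith)]; exact Real.pi_pos.ne
    have := Complex.cpow_conj (t:ℂ) (-s - 1) h1
    simp only [map_sub, map_neg, map_one, Complex.conj_ofReal] at this
    exact this
  simp [zH, this]

lemma H_real (β : ℝ) (hβ : 1 - δ / (2 * C) < β) (hβ1 : β ≤ 1) : zH c κ β ≠ 0 := by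
  have hδ := Z.δ_pos
  have hC := Z.one_le_C
  have hδ2 := Z.δ_le
  have h0 : δ / (2 * C) ≤ δ / 2 := by gcongr; linarith
  have hm := Z.mellin_bound (s := (β:ℂ)) (by simp; linarith)
  intro h
  unfold zH at h
  have hβ0 : (β:ℂ) ≠ 0 := by
    rw [Complex.ofReal_ne_zero]; linarith
  have h2 : (1:ℂ) = (1 - β : ℝ) * mellin (fun t => (zE c κ t : ℂ)) (-(β:ℂ)) := by
    have : (β:ℂ) * (1 + (β - 1) * mellin (fun t => (zE c κ t : ℂ)) (-(β:ℂ))) = 0 := by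
      rw [← h]; ring
    have := (mul_eq_zero.1 this).resolve_left hβ0
    push_cast
    linear_combination this
  have h3 : (1:ℝ) ≤ (1 - β) * (2 * C / δ) := by
    calc (1:ℝ) = ‖(1:ℂ)‖ := by simp
      _ = |1 - β| * ‖mellin (fun t => (zE c κ t : ℂ)) (-(β:ℂ))‖ := by
        rw [h2, norm_mul, Complex.norm_real, Real.norm_eq_abs]
      _ ≤ _ := by rw [abs_of_nonneg (by linarith)]; gcongr
  have h4 : (1 - β) * (2 * C / δ) < (δ / (2 * C)) * (2 * C / δ) := by
    apply mul_lt_mul_of_pos_right (by linarith) (by positivity)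
  rw [div_mul_div_cancel₀ (by positivity), div_self (by positivity)] at h4
  linarith

lemma sum_bigO : (fun n : ℕ ↦ ∑ k ∈ Finset.Icc 1 n, c k) =O[atTop] fun n ↦ (n : ℝ) ^ (1:ℝ) := by
  refine IsBigO.of_bound (κ + κ * C) ?_
  filter_upwards [eventually_ge_atTop 1] with n hn
  have hn1 : (1:ℝ) ≤ n := by exact_mod_cast hn
  have h := Z.count n hn1
  rw [Nat.floor_natCast] at h
  have hk := Z.κ_pos
  have hC := Z.one_le_C
  rw [Real.rpow_one, Real.norm_eq_abs, Real.norm_of_nonneg (by positivity)]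
  have h2 : (n:ℝ) ^ (1 - δ) ≤ n := by
    calc (n:ℝ) ^ (1 - δ) ≤ n ^ (1:ℝ) := Real.rpow_le_rpow_of_exponent_le hn1 (by linarith [Z.δ_pos])
      _ = n := Real.rpow_one _
  have h3 := abs_sub_abs_le_abs_sub (∑ k ∈ Finset.Icc 1 n, c k) (κ * n)
  rw [abs_of_nonneg (a := κ * n) (by positivity)] at h3
  have h4 : κ * C * (n:ℝ) ^ (1 - δ) ≤ κ * C * n := by gcongr
  linarith

lemma c_summable {s : ℂ} (hs : 1 < s.re) : LSeriesSummable (fun n => (c n : ℂ)) s :=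
  LSeriesSummable_of_sum_norm_bigO_and_nonneg Z.sum_bigO Z.c_nonneg zero_le_one hs

lemma H_eq {s : ℂ} (hs : 1 < s.re) : zH c κ s = (s - 1) * LSeries (fun n => (c n : ℂ)) s / κ := by
  have hk := Z.κ_pos
  have hs1 : s - 1 ≠ 0 := by
    intro h; rw [sub_eq_zero.1 h] at hs; simp at hs
  rw [LSeries_eq_mul_integral_of_nonneg c zero_le_one hs Z.sum_bigO Z.c_nonneg]
  have hlt : (-s).re < -1 := by simp; linarith
  have hi1 := integrableOn_Ioi_cpow_of_lt hlt one_pos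
  have hi2 : IntegrableOn (fun t : ℝ => (t:ℂ) ^ (-s - 1) * (zE c κ t : ℂ)) (Set.Ioi 1) := by
    have := mellinConvergent_of_isBigO_rpow (s := -s) (b := (-s).re - 1) Z.E_li Z.E_top
      (by simp; linarith [Z.δ_pos]) (E_bot _) (by linarith)
    exact IntegrableOn.mono_set this (Set.Ioi_subset_Ioi zero_le_one)
  have : ∫ t in Set.Ioi (1 : ℝ), (∑ k ∈ Finset.Icc 1 ⌊t⌋₊, (c k : ℂ)) * (t:ℂ) ^ (-(s + 1)) =
      κ * (mellin (fun t => (zE c κ t : ℂ)) (-s) + 1 / (s - 1)) := by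
    have h1 : (1:ℂ) / (s - 1) = ∫ t in Set.Ioi (1:ℝ), (t:ℂ) ^ (-s) := by
      rw [integral_Ioi_cpow_of_lt hlt one_pos]
      have : -s + 1 = -(s - 1) := by ring
      rw [this, Complex.ofReal_one, Complex.one_cpow, neg_div_neg_eq]
    rw [h1, E_mellin_eq, ← integral_add hi2 hi1, ← integral_const_mul]
    refine setIntegral_congr_fun measurableSet_Ioi fun t (ht : 1 < t) => ?_
    have ht0 : (t:ℂ) ≠ 0 := by rw [Complex.ofReal_ne_zero]; linarith
    simp only [zE, ht.le, if_true]
    have e1 : (t:ℂ) ^ (-s) = t ^ (-s - 1) * t := by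
      rw [Complex.cpow_sub _ _ ht0, Complex.cpow_one]; field_simp
    have e2 : -(s + 1) = -s - 1 := by ring
    rw [e1, e2]
    push_cast
    have : (κ:ℂ) ≠ 0 := by exact_mod_cast hk.ne'
    field_simp
    ring
  rw [this]
  unfold zH
  have : (κ:ℂ) ≠ 0 := by exact_mod_cast hk.ne'
  field_simp
  ring
end ZData

namespace ZData
open Filter Topology Complex MeasureTheory Asymptotics
variable {c Λ : ℕ → ℝ} {d : ℕ} {κ C δ : ℝ} (Z : ZData c Λ d κ C δ)
include Z

lemma L_zero : Λ 0 = 0 := le_antisymm (by simpa using Z.L_le 0) (Z.L_nonneg 0)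
lemma L_one : Λ 1 = 0 := le_antisymm (by simpa using Z.L_le 1) (Z.L_nonneg 1)

lemma c_le (n : ℕ) : c n ≤ (n:ℝ) ^ d := by
  induction n using Nat.strong_induction_on with
  | _ n ih =>
  rcases Nat.lt_or_ge n 2 with h | h
  · interval_cases n
    · rw [Z.c_zero]; positivity
    · rw [Z.c_one]; simp
  · have hl : 0 < Real.log n := Real.log_pos (by exact_mod_cast h)
    have h1 : c n * Real.log n ≤ (n:ℝ) ^ d * Real.log n := by
      rw [Z.conv n, ← ArithmeticFunction.vonMangoldt_sum,
        ← Nat.sum_divisorsAntidiagonal' (n := n) (f := fun _ i => ArithmeticFunction.vonMangoldt i),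
        Finset.mul_sum]
      refine Finset.sum_le_sum fun x hx => ?_
      obtain ⟨hx1, hx2⟩ := Nat.mem_divisorsAntidiagonal.1 hx
      rcases Nat.lt_or_ge x.2 2 with h2 | h2
      · have : x.2 = 0 ∨ x.2 = 1 := by omega
        rcases this with h3 | h3 <;> simp [h3, Z.L_zero, Z.L_one]
      · have hx0 : 0 < x.1 := Nat.pos_of_ne_zero (by rintro h; simp [h] at hx1; omega)
        have hlt : x.1 < n := by rw [← hx1]; nlinarith
        have hv := ArithmeticFunction.vonMangoldt_nonneg (n := x.2)
        calc c x.1 * Λ x.2 ≤ (x.1:ℝ) ^ d * (d * ArithmeticFunction.vonMangoldt x.2) :=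
              mul_le_mul (ih _ hlt) (Z.L_le _) (Z.L_nonneg _) (by positivity)
          _ ≤ (x.1:ℝ) ^ d * ((x.2:ℝ) ^ d * ArithmeticFunction.vonMangoldt x.2) := by
              gcongr
              calc (d:ℝ) ≤ 2 ^ d := by exact_mod_cast (Nat.lt_two_pow_self).le
                _ ≤ (x.2:ℝ) ^ d := by gcongr; exact_mod_cast h2
          _ = (n:ℝ) ^ d * ArithmeticFunction.vonMangoldt x.2 := by
              rw [← hx1]; push_cast; ring
    exact le_of_mul_le_mul_right h1 hl

lemma κ_le : κ ≤ 2 * (2 * C) ^ (d / δ) := by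
  have hC := Z.one_le_C
  have hδ := Z.δ_pos
  have hk := Z.κ_pos
  set X : ℝ := (2 * C) ^ (1 / δ) with hX
  have hX1 : 1 ≤ X := Real.one_le_rpow (by linarith) (by positivity)
  have h := (abs_le.1 (Z.count X hX1)).1
  have h1 : X ^ (1 - δ) = X / (2 * C) := by
    rw [Real.rpow_sub (by linarith), Real.rpow_one, hX, ← Real.rpow_mul (by linarith),
      one_div_mul_cancel hδ.ne', Real.rpow_one]
  have h2 : ∑ n ∈ Finset.Icc 1 ⌊X⌋₊, c n ≤ X * X ^ d := by
    calc ∑ n ∈ Finset.Icc 1 ⌊X⌋₊, c n ≤ ∑ n ∈ Finset.Icc 1 ⌊X⌋₊, X ^ d := by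
          refine Finset.sum_le_sum fun n hn => (Z.c_le n).trans ?_
          gcongr
          exact (Nat.le_floor_iff (by linarith)).1 (Finset.mem_Icc.1 hn).2
      _ = ⌊X⌋₊ * X ^ d := by simp
      _ ≤ X * X ^ d := by gcongr; exact Nat.floor_le (by linarith)
  have h3 : (2 * C) ^ (d / δ) = X ^ d := by
    rw [hX, ← Real.rpow_natCast, ← Real.rpow_mul (by linarith)]; congr 1; ring
  have h4 : κ * C * X ^ (1 - δ) = κ * X / 2 := by rw [h1]; field_simp
  rw [h3]
  rw [h4] at h
  have : κ * X ≤ (2 * X ^ d) * X := by nlinarith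
  exact le_of_mul_le_mul_right this (by linarith)

lemma L_summable {s : ℂ} (hs : 1 < s.re) : LSeriesSummable (fun n => (Λ n : ℂ)) s := by
  have h := (ArithmeticFunction.LSeriesSummable_vonMangoldt hs).smul (d:ℂ)
  refine Summable.of_norm_bounded h.norm fun n => LSeries.norm_term_le s ?_
  simp only [Pi.smul_apply, smul_eq_mul, norm_mul, Complex.norm_real, Complex.norm_natCast]
  rw [Real.norm_of_nonneg (Z.L_nonneg n),
    Real.norm_of_nonneg ArithmeticFunction.vonMangoldt_nonneg]
  exact Z.L_le n

omit Z in
lemma abs_lt {f : ℕ → ℂ} (h : ∀ s : ℂ, 1 < s.re → LSeriesSummable f s) {s : ℂ} (hs : 1 < s.re) :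
    LSeries.abscissaOfAbsConv f < s.re := by
  have : LSeries.abscissaOfAbsConv f ≤ (1:ℝ) :=
    LSeries.abscissaOfAbsConv_le_of_forall_lt_LSeriesSummable fun y hy => h y (by simpa using hy)
  exact lt_of_le_of_lt this (by exact_mod_cast hs)

lemma Z_hasDeriv {s : ℂ} (hs : 1 < s.re) : HasDerivAt (LSeries fun n => (c n : ℂ))
    (-(LSeries (fun n => (c n : ℂ)) s * LSeries (fun n => (Λ n : ℂ)) s)) s := by
  have h := LSeries_hasDerivAt (abs_lt (fun s hs => Z.c_summable hs) hs)
  rw [← LSeries_convolution' (Z.c_summable hs) (Z.L_summable hs)]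
  convert h using 2
  refine LSeries_congr (fun {n} hn => ?_) s
  rw [LSeries.convolution_def, LSeries.logMul]
  have := Z.conv n
  rw [← Complex.ofReal_natCast, ← Complex.ofReal_log (by positivity)]
  simp only [← Complex.ofReal_mul]
  rw [mul_comm (Real.log _), this]
  push_cast
  rfl

lemma ell_summable {s : ℂ} (hs : 1 < s.re) :
    LSeriesSummable (fun n => ((Λ n / Real.log n : ℝ) : ℂ)) s := by
  have h := (Z.L_summable hs).smul (2:ℂ)
  refine Summable.of_norm_bounded h.norm fun n => LSeries.norm_term_le s ?_
  simp only [Pi.smul_apply, smul_eq_mul, norm_mul, Complex.norm_real]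
  rw [Real.norm_of_nonneg (Z.L_nonneg n), norm_div, Real.norm_of_nonneg (Z.L_nonneg n)]
  rcases Nat.lt_or_ge n 2 with h2 | h2
  · interval_cases n <;> simp [Z.L_zero, Z.L_one]
  · have : Real.log 2 ≤ Real.log n := Real.log_le_log (by norm_num) (by exact_mod_cast h2)
    have h3 := Real.log_two_gt_d9
    rw [Real.norm_of_nonneg (by linarith), div_le_iff₀ (by linarith)]
    have := Z.L_nonneg n
    simp
    nlinarith

lemma ell_hasDeriv {s : ℂ} (hs : 1 < s.re) :
    HasDerivAt (LSeries fun n => ((Λ n / Real.log n : ℝ) : ℂ))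
    (-(LSeries (fun n => (Λ n : ℂ)) s)) s := by
  have h := LSeries_hasDerivAt (abs_lt (fun s hs => Z.ell_summable hs) hs)
  convert h using 2
  refine LSeries_congr (fun {n} hn => ?_) s
  rw [LSeries.logMul, ← Complex.ofReal_natCast, ← Complex.ofReal_log (by positivity),
    ← Complex.ofReal_mul]
  congr 1
  rcases Nat.lt_or_ge n 2 with h2 | h2
  · interval_cases n <;> simp [Z.L_zero, Z.L_one]
  · have : 0 < Real.log n := Real.log_pos (by exact_mod_cast h2)
    field_simp

lemma Z_eq_exp {s : ℂ} (hs : 1 < s.re) : LSeries (fun n => (c n : ℂ)) s =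
    Complex.exp (LSeries (fun n => ((Λ n / Real.log n : ℝ) : ℂ)) s) := by
  set f := LSeries fun n => (c n : ℂ) with hf
  set l := LSeries fun n => ((Λ n / Real.log n : ℝ) : ℂ) with hl
  have hopen : IsOpen {s : ℂ | 1 < s.re} := isOpen_lt continuous_const Complex.continuous_re
  have hconv : Convex ℝ {s : ℂ | 1 < s.re} := convex_halfSpace_re_gt 1
  have key : ∀ s ∈ {s : ℂ | 1 < s.re}, HasDerivAt (fun s => f s * Complex.exp (-l s)) 0 s := by
    intro s hs
    have h3 := (Z.Z_hasDeriv hs).mul (Z.ell_hasDeriv hs).fun_neg.cexp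
    have e : -(f s * LSeries (fun n => (Λ n : ℂ)) s) * Complex.exp (-l s) +
        f s * (Complex.exp (-l s) * -(-LSeries (fun n => (Λ n : ℂ)) s)) = 0 := by ring
    rw [e] at h3
    exact h3
  have hc : ∀ x : ℝ, 1 < x → f x * Complex.exp (-l x) = f s * Complex.exp (-l s) := by
    intro x hx
    exact hconv.is_const_of_fderivWithin_eq_zero (𝕜 := ℂ)
      (f := fun s => f s * Complex.exp (-l s))
      (fun s hs => (key s hs).differentiableAt.differentiableWithinAt) (fun s hs => by
        rw [fderivWithin_of_isOpen hopen hs]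
        rw [(key s hs).hasFDerivAt.fderiv]; simp) (by simpa using hx) hs
  have h1 : Tendsto (fun x : ℝ => f x * Complex.exp (-l x)) atTop (𝓝 (((c 1 : ℝ) : ℂ) *
      Complex.exp (-((Λ 1 / Real.log (1:ℕ) : ℝ) : ℂ)))) := by
    have e1 : (1:ℝ) < ((2:ℂ)).re := by simp
    have t1 := LSeries.tendsto_atTop (f := fun n => (c n : ℂ))
      ((abs_lt (fun s hs => Z.c_summable hs) e1).trans (EReal.coe_lt_top _))
    have t2 := LSeries.tendsto_atTop (f := fun n => ((Λ n / Real.log n : ℝ) : ℂ))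
      ((abs_lt (fun s hs => Z.ell_summable hs) e1).trans (EReal.coe_lt_top _))
    exact t1.mul (Complex.continuous_exp.continuousAt.tendsto.comp t2.neg)
  have h2 : Tendsto (fun x : ℝ => f x * Complex.exp (-l x)) atTop (𝓝 (f s * Complex.exp (-l s))) := by
    refine tendsto_const_nhds.congr' ?_
    filter_upwards [eventually_gt_atTop 1] with x hx
    exact (hc x hx).symm
  have h3 := tendsto_nhds_unique h2 h1
  simp only [Z.c_one, Z.L_one, zero_div, Complex.ofReal_zero, neg_zero, Complex.exp_zero,
    Complex.ofReal_one, mul_one] at h3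
  rw [Complex.exp_neg] at h3
  field_simp at h3
  exact h3

lemma Z_ne_zero {s : ℂ} (hs : 1 < s.re) : LSeries (fun n => (c n : ℂ)) s ≠ 0 := by
  rw [Z.Z_eq_exp hs]; exact Complex.exp_ne_zero _

lemma Z_lower {s : ℂ} (hs : 1 < s.re) : 1 ≤ ‖LSeries (fun n => (c n : ℂ)) s‖ *
    ‖LSeries (fun n => (c n : ℂ)) s.re‖ := by
  have hs' : 1 < ((s.re : ℝ) : ℂ).re := by simpa using hs
  rw [Z.Z_eq_exp hs, Z.Z_eq_exp hs', Complex.norm_exp, Complex.norm_exp, ← Real.exp_add]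
  rw [Real.one_le_exp_iff]
  set l := fun n => ((Λ n / Real.log n : ℝ) : ℂ)
  have h1 : ‖LSeries l s‖ ≤ ∑' n, ‖LSeries.term l s n‖ :=
    norm_tsum_le_tsum_norm (Z.ell_summable hs).norm
  have h2 : ∑' n, ‖LSeries.term l s n‖ = (LSeries l s.re).re := by
    unfold LSeries
    rw [Complex.re_tsum (Z.ell_summable hs')]
    congr 1
    ext n
    have hl0 : 0 ≤ Λ n / Real.log n := div_nonneg (Z.L_nonneg n) (Real.log_natCast_nonneg n)
    rw [LSeries.norm_term_eq]
    by_cases hn : n = 0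
    · simp [hn]
    · rw [if_neg hn, LSeries.term_of_ne_zero hn, ← Complex.ofReal_natCast,
        ← Complex.ofReal_cpow (by positivity), ← Complex.ofReal_div, Complex.ofReal_re]
      simp only [l]
      rw [Complex.norm_real, Real.norm_of_nonneg hl0]
  have h3 := (_root_.abs_le.1 (Complex.abs_re_le_norm (LSeries l s))).1
  linarith

lemma F_eq {s : ℂ} (hs : 1 < s.re) : LSeries (fun n => (Λ n : ℂ)) s =
    1 / (s - 1) - deriv (zH c κ) s / zH c κ s := by
  have hopen : IsOpen {s : ℂ | 1 < s.re} := isOpen_lt continuous_const Complex.continuous_re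
  have hk : (κ:ℂ) ≠ 0 := by exact_mod_cast Z.κ_pos.ne'
  have hs1 : s - 1 ≠ 0 := by
    intro h; rw [sub_eq_zero.1 h] at hs; simp at hs
  have hz := Z.Z_ne_zero hs
  have h1 : HasDerivAt (zH c κ) ((1 * LSeries (fun n => (c n : ℂ)) s + (s - 1) *
      (-(LSeries (fun n => (c n : ℂ)) s * LSeries (fun n => (Λ n : ℂ)) s))) / κ) s := by
    have := (((hasDerivAt_id s).sub_const 1).mul (Z.Z_hasDeriv hs)).div_const (κ:ℂ)
    refine this.congr_of_eventuallyEq ?_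
    filter_upwards [hopen.mem_nhds hs] with z hz
    exact Z.H_eq hz
  rw [h1.deriv, Z.H_eq hs]
  field_simp
  ring

lemma H_ne_zero {s : ℂ} (hs : 1 < s.re) : zH c κ s ≠ 0 := by
  have hs1 : s - 1 ≠ 0 := by
    intro h; rw [sub_eq_zero.1 h] at hs; simp at hs
  have hk : (κ:ℂ) ≠ 0 := by exact_mod_cast Z.κ_pos.ne'
  rw [Z.H_eq hs]
  exact div_ne_zero (mul_ne_zero hs1 (Z.Z_ne_zero hs)) hk

lemma F_re (σ t : ℝ) (hσ : 1 < σ) : (LSeries (fun n => (Λ n : ℂ)) (σ + t * I)).re =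
    ∑' n : ℕ, Λ n * (n:ℝ) ^ (-σ) * (((n:ℂ) ^ (-(t * I))).re) ∧
    Summable fun n : ℕ => Λ n * (n:ℝ) ^ (-σ) * (((n:ℂ) ^ (-(t * I))).re) := by
  have hs : 1 < ((σ:ℂ) + t * I).re := by simpa using hσ
  have hsum := Z.L_summable hs
  have e : ∀ n : ℕ, (LSeries.term (fun n => (Λ n : ℂ)) (σ + t * I) n).re =
      Λ n * (n:ℝ) ^ (-σ) * (((n:ℂ) ^ (-(t * I))).re) := by
    intro n
    rcases eq_or_ne n 0 with rfl | hn
    · simp [Z.L_zero]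
    · rw [LSeries.term_of_ne_zero hn, div_eq_mul_inv, ← Complex.cpow_neg, neg_add,
        Complex.cpow_add _ _ (by exact_mod_cast hn)]
      have : (n:ℂ) ^ (-(σ:ℂ)) = ((n:ℝ) ^ (-σ) : ℝ) := by
        rw [Complex.ofReal_cpow (by positivity)]; simp
      rw [this, ← mul_assoc, ← Complex.ofReal_mul, Complex.re_ofReal_mul]
  constructor
  · unfold LSeries; rw [Complex.re_tsum hsum]; exact tsum_congr e
  · refine (Complex.hasSum_re hsum.hasSum).summable.congr fun n => (e n)

lemma F_nonneg (σ : ℝ) (hσ : 1 < σ) : 0 ≤ (LSeries (fun n => (Λ n : ℂ)) σ).re := by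
  have := (Z.F_re σ 0 hσ).1
  simp only [Complex.ofReal_zero, zero_mul, add_zero, neg_zero, Complex.cpow_zero,
    Complex.one_re, mul_one] at this
  rw [this]
  exact tsum_nonneg fun n => mul_nonneg (Z.L_nonneg n) (by positivity)

lemma F_341 (σ t : ℝ) (hσ : 1 < σ) : 0 ≤ 3 * (LSeries (fun n => (Λ n : ℂ)) σ).re +
    4 * (LSeries (fun n => (Λ n : ℂ)) (σ + t * I)).re +
    (LSeries (fun n => (Λ n : ℂ)) (σ + (2 * t : ℝ) * I)).re := by
  have h0 := Z.F_re σ 0 hσ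
  have h1 := Z.F_re σ t hσ
  have h2 := Z.F_re σ (2 * t) hσ
  simp only [Complex.ofReal_zero, zero_mul, add_zero] at h0
  rw [h0.1, h1.1, h2.1, ← tsum_mul_left, ← tsum_mul_left, ← (h0.2.mul_left 3).tsum_add (h1.2.mul_left 4),
    ← ((h0.2.mul_left 3).add (h1.2.mul_left 4)).tsum_add h2.2]
  refine tsum_nonneg fun n => ?_
  rcases eq_or_ne n 0 with rfl | hn
  · simp [Z.L_zero]
  have hn0 : (n:ℂ) ≠ 0 := by exact_mod_cast hn
  have e2 : (n:ℂ) ^ (-((2 * t : ℝ) * I)) = (n:ℂ) ^ (-(t * I)) * (n:ℂ) ^ (-(t * I)) := by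
    rw [← Complex.cpow_add _ _ hn0]; congr 1; push_cast; ring
  have e1 : ‖(n:ℂ) ^ (-(t * I))‖ = 1 := by
    rw [Complex.norm_natCast_cpow_of_pos (Nat.pos_of_ne_zero hn)]; simp
  set w := (n:ℂ) ^ (-(t * I))
  rw [e2]
  have e3 : w.re * w.re + w.im * w.im = 1 := by
    have := Complex.normSq_eq_norm_sq w
    rw [e1, Complex.normSq_apply] at this; simpa using this
  have hA : 0 ≤ Λ n * (n:ℝ) ^ (-σ) := mul_nonneg (Z.L_nonneg n) (by positivity)
  simp only [neg_zero, Complex.cpow_zero, Complex.one_re, mul_one, Complex.mul_re]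
  have : 3 * (Λ n * (n:ℝ) ^ (-σ)) + 4 * (Λ n * (n:ℝ) ^ (-σ) * w.re) +
    Λ n * (n:ℝ) ^ (-σ) * (w.re * w.re - w.im * w.im) =
    Λ n * (n:ℝ) ^ (-σ) * (2 * (1 + w.re) ^ 2) := by
    linear_combination (-(Λ n * (n:ℝ) ^ (-σ))) * e3
  rw [this]; positivity
end ZData

namespace ZData
open Filter Topology Complex MeasureTheory Asymptotics Metric
variable {c Λ : ℕ → ℝ} {d : ℕ} {κ C δ : ℝ} (Z : ZData c Λ d κ C δ)
include Z

lemma H_bound' {s : ℂ} (hs : 1 - δ / 2 ≤ s.re) {T : ℝ} (hT : 1 ≤ T) (h1 : ‖s‖ ≤ T)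
    (h2 : ‖s - 1‖ ≤ T) : ‖zH c κ s‖ ≤ T ^ 2 * (3 * C / δ) := by
  have hC := Z.one_le_C
  have hδ := Z.δ_pos
  have hδ' := Z.δ_le
  have h := Z.H_bound hs
  have h3 : ‖s‖ * ‖s - 1‖ ≤ T ^ 2 := by
    rw [sq]; exact mul_le_mul h1 h2 (norm_nonneg _) (by linarith)
  have h4 : 1 ≤ C / δ := by rw [le_div_iff₀ hδ]; linarith
  calc ‖zH c κ s‖ ≤ T ^ 2 * 1 + T ^ 2 * (2 * C / δ) := by
        refine h.trans (add_le_add (by nlinarith) (mul_le_mul_of_nonneg_right h3 (by positivity)))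
    _ ≤ T ^ 2 * (C / δ) + T ^ 2 * (2 * C / δ) := by gcongr
    _ = _ := by ring

lemma near {lam t : ℝ} (hl : 0 < lam) (hl1 : lam ≤ 1) : ∀ s ∈ closedBall ((1 + lam : ℝ) + t * I : ℂ) (δ / 2),
    ‖zH c κ s‖ ≤ (81 * (3 + |t|) ^ 2 * C ^ 2 * κ ^ 2 / (δ ^ 2 * lam ^ 2)) *
      ‖zH c κ ((1 + lam : ℝ) + t * I : ℂ)‖ := by
  have hC := Z.one_le_C
  have hδ := Z.δ_pos
  have hδ' := Z.δ_le
  have hk := Z.κ_pos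
  intro s hs
  set c0 : ℂ := (1 + lam : ℝ) + t * I with hc0
  have hre : c0.re = 1 + lam := by simp [hc0]
  rw [mem_closedBall, dist_eq_norm] at hs
  have a1 : ‖c0‖ ≤ 2 + |t| := by
    calc ‖c0‖ ≤ ‖((1 + lam : ℝ):ℂ)‖ + ‖(t * I : ℂ)‖ := norm_add_le _ _
      _ = 1 + lam + |t| := by
        rw [Complex.norm_real, Real.norm_of_nonneg (by linarith)]; simp
      _ ≤ _ := by linarith
  have a2 : ‖c0 - 1‖ ≤ 1 + |t| := by
    have : c0 - 1 = (lam : ℂ) + t * I := by rw [hc0]; push_cast; ring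
    rw [this]
    calc _ ≤ ‖(lam:ℂ)‖ + ‖(t * I : ℂ)‖ := norm_add_le _ _
      _ = lam + |t| := by
        rw [Complex.norm_real, Real.norm_of_nonneg hl.le]; simp
      _ ≤ _ := by linarith
  have b0 : 1 - δ / 2 ≤ s.re := by
    have := (abs_re_le_norm (s - c0)).trans hs
    rw [sub_re, hre] at this
    have := (abs_le.1 this).1
    linarith
  have b1 : ‖s‖ ≤ 3 + |t| := by
    have : ‖s‖ ≤ ‖s - c0‖ + ‖c0‖ := by simpa using norm_add_le (s - c0) c0
    linarith
  have b2 : ‖s - 1‖ ≤ 3 + |t| := by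
    have : ‖s - 1‖ ≤ ‖s - c0‖ + ‖c0 - 1‖ := by simpa using norm_add_le (s - c0) (c0 - 1)
    linarith
  have ht := abs_nonneg t
  have up := Z.H_bound' b0 (by linarith) b1 b2
  have hr1 : 1 < ((1 + lam : ℝ) : ℂ).re := by simp [hl]
  have up1 : ‖zH c κ ((1 + lam : ℝ):ℂ)‖ ≤ 3 ^ 2 * (3 * C / δ) := by
    refine Z.H_bound' (by rw [ofReal_re]; linarith) (by norm_num) ?_ ?_
    · rw [Complex.norm_real, Real.norm_of_nonneg (by linarith)]; linarith
    · rw [show (((1 + lam : ℝ):ℂ) - 1) = (lam:ℂ) by push_cast; ring, Complex.norm_real,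
        Real.norm_of_nonneg hl.le]; linarith
  have low := Z.Z_lower (s := c0) (by rw [hre]; linarith)
  rw [hre] at low
  rw [Z.H_eq hr1, show (((1 + lam : ℝ):ℂ) - 1) = (lam:ℂ) by push_cast; ring] at up1
  rw [norm_div, norm_mul, Complex.norm_real, Complex.norm_real, Real.norm_of_nonneg hl.le,
    Real.norm_of_nonneg hk.le] at up1
  set z1 := ‖LSeries (fun n => (c n : ℂ)) ((1 + lam : ℝ):ℂ)‖ with hz1
  have e : ‖zH c κ c0‖ = ‖c0 - 1‖ * ‖LSeries (fun n => (c n : ℂ)) c0‖ / κ := by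
    rw [Z.H_eq (by rw [hre]; linarith), norm_div, norm_mul, Complex.norm_real,
      Real.norm_of_nonneg hk.le]
  set z0 := ‖LSeries (fun n => (c n : ℂ)) c0‖ with hz0
  have a3 : lam ≤ ‖c0 - 1‖ := by
    have := abs_re_le_norm (c0 - 1)
    rw [sub_re, hre] at this
    simp only [one_re, add_sub_cancel_left] at this
    exact (le_abs_self _).trans this
  have z0n : 0 ≤ z0 := norm_nonneg _
  have z1b : z1 ≤ 27 * C * κ / (δ * lam) := by
    rw [div_le_iff₀ hk] at up1
    rw [le_div_iff₀ (by positivity)]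
    calc z1 * (δ * lam) = δ * (lam * z1) := by ring
      _ ≤ δ * (3 ^ 2 * (3 * C / δ) * κ) := by gcongr
      _ = _ := by field_simp; norm_num
  have k1 : 1 ≤ z0 * (27 * C * κ / (δ * lam)) := low.trans (by gcongr)
  have k2 : lam * z0 / κ ≤ ‖zH c κ c0‖ := by rw [e]; gcongr
  calc ‖zH c κ s‖ ≤ (3 + |t|) ^ 2 * (3 * C / δ) * 1 := by simpa using up
    _ ≤ (3 + |t|) ^ 2 * (3 * C / δ) * (z0 * (27 * C * κ / (δ * lam))) := by gcongr
    _ = (81 * (3 + |t|) ^ 2 * C ^ 2 * κ ^ 2 / (δ ^ 2 * lam ^ 2)) * (lam * z0 / κ) := by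
        field_simp; ring
    _ ≤ _ := by gcongr

omit Z in
lemma log_le_half {w : ℝ} (hw : 0 < w) : Real.log w ≤ w := (Real.log_le_sub_one_of_pos hw).trans (by linarith)

lemma logM {P w lam t : ℝ} (hP : 1 ≤ P) (hd : (d:ℝ) ≤ P) (hδP : 1 / δ ≤ P) (hCP : Real.log C ≤ P)
    (hw : 1 ≤ w) (htw : |t| ≤ w) (hlam : lam = 1 / (200000 * P ^ 4 * w)) :
    24 * (Real.log (81 * (3 + |t|) ^ 2 * C ^ 2 * κ ^ 2 / (δ ^ 2 * lam ^ 2)) + 1) / (δ / 2) ≤ 1 / (20 * lam) := by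
  have hC := Z.one_le_C
  have hδ := Z.δ_pos
  have hδ' := Z.δ_le
  have hk := Z.κ_pos
  have hl : 0 < lam := by rw [hlam]; positivity
  have ht := abs_nonneg t
  have e : Real.log (81 * (3 + |t|) ^ 2 * C ^ 2 * κ ^ 2 / (δ ^ 2 * lam ^ 2)) =
      Real.log 81 + 2 * Real.log (3 + |t|) + 2 * Real.log C + 2 * Real.log κ +
        2 * Real.log (1 / δ) + 2 * Real.log (1 / lam) := by
    rw [Real.log_div (by positivity) (by positivity), Real.log_mul (by positivity) (by positivity),
      Real.log_mul (by positivity) (by positivity), Real.log_mul (by positivity) (by positivity),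
      Real.log_mul (by positivity) (by positivity), Real.log_pow, Real.log_pow, Real.log_pow,
      Real.log_pow, Real.log_pow, one_div, one_div, Real.log_inv, Real.log_inv]
    push_cast; ring
  have l2 := Real.log_two_lt_d9
  have l2' := Real.log_two_gt_d9
  have e81 : Real.log 81 ≤ 7 * Real.log 2 := by
    rw [← Real.log_rpow (by norm_num)]; exact Real.log_le_log (by norm_num) (by norm_num)
  have e200 : Real.log 200000 ≤ 18 * Real.log 2 := by
    rw [← Real.log_rpow (by norm_num)]; exact Real.log_le_log (by norm_num) (by norm_num)
  have e3 : Real.log (3 + |t|) ≤ 2 * Real.log 2 + w := by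
    calc Real.log (3 + |t|) ≤ Real.log (2 ^ 2 * w) := Real.log_le_log (by positivity) (by nlinarith)
      _ = 2 * Real.log 2 + Real.log w := by
        rw [Real.log_mul (by positivity) (by positivity), Real.log_pow]; push_cast; ring
      _ ≤ _ := by linarith [log_le_half (w := w) (by linarith)]
  have hPl := log_le_half (w := P) (by linarith)
  have e4 : Real.log (1 / δ) ≤ P := (Real.log_le_log (by positivity) hδP).trans hPl
  have e5 : Real.log (1 / lam) ≤ 18 * Real.log 2 + 4 * P + w := by
    rw [hlam, one_div_one_div, Real.log_mul (by positivity) (by positivity),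
      Real.log_mul (by positivity) (by positivity), Real.log_pow]
    push_cast
    linarith [log_le_half (w := w) (by linarith)]
  have e6 : Real.log κ ≤ Real.log 2 + P ^ 2 * (Real.log 2 + P) := by
    calc Real.log κ ≤ Real.log (2 * (2 * C) ^ (d / δ)) := Real.log_le_log hk Z.κ_le
      _ = Real.log 2 + (d / δ) * (Real.log 2 + Real.log C) := by
        rw [Real.log_mul (by positivity) (by positivity), Real.log_rpow (by positivity),
          Real.log_mul (by positivity) (by positivity)]
      _ ≤ _ := by
        have : (d:ℝ) / δ ≤ P ^ 2 := by
          rw [div_eq_mul_one_div, sq]; exact mul_le_mul hd hδP (by positivity) (by linarith)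
        have h0 : 0 ≤ Real.log C := Real.log_nonneg hC
        gcongr
  have P3 : 1 ≤ P ^ 3 := one_le_pow₀ hP
  have P2 : P ≤ P ^ 3 := by nlinarith
  have P22 : P ^ 2 ≤ P ^ 3 := by nlinarith [sq_nonneg P]
  have hw3 : w ≤ P ^ 3 * w := by nlinarith
  have hp3 : P ^ 3 ≤ P ^ 3 * w := by nlinarith
  have e7 : Real.log (81 * (3 + |t|) ^ 2 * C ^ 2 * κ ^ 2 / (δ ^ 2 * lam ^ 2)) + 1 ≤ 100 * (P ^ 3 * w) := by
    rw [e]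
    have : P ^ 2 * (Real.log 2 + P) ≤ 2 * P ^ 3 := by nlinarith
    nlinarith
  rw [div_le_iff₀ (by positivity)]
  have : 1 ≤ P * δ := by rwa [div_le_iff₀ hδ] at hδP
  have e9 : 1 / (20 * lam) * (δ / 2) = 5000 * (P ^ 3 * w) * (P * δ) := by
    rw [hlam]; field_simp; norm_num
  rw [e9]
  have h0 : 0 < P ^ 3 * w := by positivity
  calc 24 * _ ≤ 24 * (100 * (P ^ 3 * w)) := by gcongr
    _ ≤ 5000 * (P ^ 3 * w) * 1 := by linarith
    _ ≤ _ := by gcongr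

lemma land {P w lam t : ℝ} (hP : 1 ≤ P) (hd : (d:ℝ) ≤ P) (hδP : 1 / δ ≤ P) (hCP : Real.log C ≤ P)
    (hw : 1 ≤ w) (htw : |t| ≤ w) (hlam : lam = 1 / (200000 * P ^ 4 * w)) :
    -(1 / (20 * lam)) ≤ (deriv (zH c κ) ((1 + lam : ℝ) + t * I) / zH c κ ((1 + lam : ℝ) + t * I)).re ∧
    (∀ z ∈ closedBall ((1 + lam : ℝ) + t * I : ℂ) (10 * lam), zH c κ z = 0 →
      -(1 / (20 * lam)) + (1 / (((1 + lam : ℝ) + t * I : ℂ) - z)).re ≤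
        (deriv (zH c κ) ((1 + lam : ℝ) + t * I) / zH c κ ((1 + lam : ℝ) + t * I)).re) ∧
    (∀ z ∈ closedBall ((1 + lam : ℝ) + t * I : ℂ) (10 * lam),
      ∀ w ∈ closedBall ((1 + lam : ℝ) + t * I : ℂ) (10 * lam), zH c κ z = 0 → zH c κ w = 0 →
      (w = z → deriv (zH c κ) z = 0) →
      -(1 / (20 * lam)) + (1 / (((1 + lam : ℝ) + t * I : ℂ) - z)).re +
        (1 / (((1 + lam : ℝ) + t * I : ℂ) - w)).re ≤
        (deriv (zH c κ) ((1 + lam : ℝ) + t * I) / zH c κ ((1 + lam : ℝ) + t * I)).re) := by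
  have hδ := Z.δ_pos
  have hδ' := Z.δ_le
  have hl : 0 < lam := by rw [hlam]; positivity
  have hP4 : 1 ≤ P ^ 3 := one_le_pow₀ hP
  have hld : 60 * lam ≤ δ := by
    have h1 : 1 ≤ δ * P := by rw [mul_comm]; rwa [div_le_iff₀ hδ] at hδP
    rw [hlam, mul_one_div, div_le_iff₀ (by positivity)]
    calc (60:ℝ) ≤ 200000 * 1 * 1 * 1 := by norm_num
      _ ≤ 200000 * (δ * P) * P ^ 3 * w := by gcongr
      _ = _ := by ring
  set c0 : ℂ := (1 + lam : ℝ) + t * I with hc0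
  have hre : c0.re = 1 + lam := by simp [hc0]
  have key := landau (f := zH c κ) (c := c0) (ρ := δ / 2) (by positivity) (by
    intro s hs
    apply Z.H_analytic
    rw [mem_closedBall, dist_eq_norm] at hs
    have := (abs_re_le_norm (s - c0)).trans hs
    rw [sub_re, hre] at this
    have := (abs_le.1 this).1
    linarith) (Z.near (t := t) hl (by linarith)) (Z.H_ne_zero (by rw [hre]; linarith)) (by
      intro s hs h0
      by_contra hcon
      exact Z.H_ne_zero (by rw [hre] at hcon; linarith) h0)
  have hL := Z.logM hP hd hδP hCP hw htw hlam
  obtain ⟨k1, k2, k3⟩ := key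
  have hsub : closedBall c0 (10 * lam) ⊆ closedBall c0 (δ / 2 / 3) := closedBall_subset_closedBall (by linarith)
  refine ⟨by linarith, fun z hz h0 => ?_, fun z hz v hv h0 h1 h2 => ?_⟩
  · have := k2 z (hsub hz) h0; linarith
  · have := k3 z (hsub hz) v (hsub hv) h0 h1 h2; linarith
end ZData

namespace ZData
open Filter Topology Complex MeasureTheory Asymptotics Metric
variable {c Λ : ℕ → ℝ} {d : ℕ} {κ C δ : ℝ} (Z : ZData c Λ d κ C δ)
include Z

omit Z in
lemma re_inv (x y : ℝ) : (1 / ((x:ℂ) + y * I)).re = x / (x ^ 2 + y ^ 2) := by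
  rw [one_div, inv_re, normSq_apply]; simp [sq]

lemma zero_far {P b γ lam : ℝ} (hP : 1 ≤ P) (hd : (d:ℝ) ≤ P) (hδP : 1 / δ ≤ P) (hCP : Real.log C ≤ P)
    (hlam : lam = 1 / (200000 * P ^ 4 * (24 * (1 + |γ|)))) (h0 : zH c κ ((1 - b : ℝ) + γ * I) = 0)
    (hγ : 6 * lam ≤ |γ|) : lam / 8 ≤ b := by
  by_contra hb
  push Not at hb
  have hg := abs_nonneg γ
  have hl : 0 < lam := by rw [hlam]; positivity
  have hb0 : 0 ≤ b := by
    by_contra hcon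
    exact Z.H_ne_zero (by simp; linarith) h0
  have hw : 1 ≤ 24 * (1 + |γ|) := by linarith
  have h1 := (Z.land (t := 0) hP hd hδP hCP hw (by simp; positivity) hlam).1
  have h2 := (Z.land (t := γ) hP hd hδP hCP hw (by linarith) hlam).2.1 _ (by
    rw [mem_closedBall, dist_eq_norm,
      show (((1 - b : ℝ) + γ * I : ℂ) - ((1 + lam : ℝ) + γ * I)) = ((-(b + lam) : ℝ) : ℂ) by push_cast; ring,
      Complex.norm_real, Real.norm_eq_abs, abs_neg, abs_of_nonneg (by linarith)]
    linarith) h0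
  have h3 := (Z.land (t := 2 * γ) hP hd hδP hCP hw (by rw [abs_mul]; simp; linarith) hlam).1
  have k := Z.F_341 (1 + lam) γ (by linarith)
  rw [Z.F_eq (by simp [hl]), Z.F_eq (by simp [hl]), Z.F_eq (by simp [hl]), sub_re, sub_re, sub_re,
    show (((1 + lam : ℝ) : ℂ) - 1) = (lam:ℂ) + (0:ℝ) * I by push_cast; ring,
    show (((1 + lam : ℝ) : ℂ) + γ * I - 1) = (lam:ℂ) + γ * I by push_cast; ring,
    show (((1 + lam : ℝ) : ℂ) + (2 * γ : ℝ) * I - 1) = (lam:ℂ) + (2 * γ : ℝ) * I by push_cast; ring,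
    re_inv, re_inv, re_inv] at k
  rw [show (((1 + lam : ℝ):ℂ) + γ * I - ((1 - b : ℝ) + γ * I)) = ((lam + b : ℝ):ℂ) + (0:ℝ) * I by
    push_cast; ring, re_inv] at h2
  simp only [ofReal_zero, zero_mul, add_zero] at h1
  have hg2 : 36 * lam ^ 2 ≤ γ ^ 2 := by
    rw [← sq_abs γ]; nlinarith
  have e1 : lam / (lam ^ 2 + 0 ^ 2) = 1 / lam := by field_simp; simp
  have e2 : lam / (lam ^ 2 + γ ^ 2) ≤ 1 / 37 * (1 / lam) := by
    rw [div_le_iff₀ (by positivity)]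
    have : 1 / 37 * (1 / lam) * (lam ^ 2 + γ ^ 2) = (lam ^ 2 + γ ^ 2) / (37 * lam) := by field_simp
    rw [this, le_div_iff₀ (by positivity)]; nlinarith
  have e3 : lam / (lam ^ 2 + (2 * γ) ^ 2) ≤ 1 / 145 * (1 / lam) := by
    rw [div_le_iff₀ (by positivity)]
    have : 1 / 145 * (1 / lam) * (lam ^ 2 + (2 * γ) ^ 2) = (lam ^ 2 + 4 * γ ^ 2) / (145 * lam) := by
      field_simp; ring
    rw [this, le_div_iff₀ (by positivity)]; nlinarith
  have e4 : 8 / 9 * (1 / lam) ≤ (lam + b) / ((lam + b) ^ 2 + 0 ^ 2) := by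
    have : (lam + b) / ((lam + b) ^ 2 + 0 ^ 2) = 1 / (lam + b) := by
      have : 0 < lam + b := by linarith
      field_simp; simp
    rw [this, le_div_iff₀ (by linarith)]
    have : 8 / 9 * (1 / lam) * (lam + b) = (8 * (lam + b)) / (9 * lam) := by field_simp
    rw [this, div_le_iff₀ (by positivity)]; linarith
  have e5 : 1 / (20 * lam) = 1 / 20 * (1 / lam) := by field_simp
  rw [e5] at h1 h2 h3
  rw [e1] at k
  have : 0 < 1 / lam := by positivity
  linarith

lemma zero_near {P b γ lam : ℝ} (hP : 1 ≤ P) (hd : (d:ℝ) ≤ P) (hδP : 1 / δ ≤ P) (hCP : Real.log C ≤ P)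
    (hlam : lam = 1 / (200000 * P ^ 4 * 1)) (h0 : zH c κ ((1 - b : ℝ) + γ * I) = 0)
    (hγ : |γ| ≤ lam / 4) (hd0 : γ = 0 → deriv (zH c κ) ((1 - b : ℝ) + γ * I) = 0) : lam / 8 ≤ b := by
  by_contra hb
  push Not at hb
  have hl : 0 < lam := by rw [hlam]; positivity
  have hb0 : 0 ≤ b := by
    by_contra hcon
    exact Z.H_ne_zero (by simp; linarith) h0
  have hconj : ((1 - b : ℝ) + (-γ : ℝ) * I : ℂ) = starRingEnd ℂ ((1 - b : ℝ) + γ * I) := by simp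
  have h0' : zH c κ ((1 - b : ℝ) + (-γ : ℝ) * I) = 0 := by
    rw [hconj, H_conj, h0, map_zero]
  have hn : ∀ y : ℝ, |y| ≤ lam / 4 →
      ((1 - b : ℝ) + y * I : ℂ) ∈ closedBall ((1 + lam : ℝ) + (0:ℝ) * I : ℂ) (10 * lam) := by
    intro y hy
    rw [mem_closedBall, dist_eq_norm,
      show (((1 - b : ℝ) + y * I : ℂ) - ((1 + lam : ℝ) + (0:ℝ) * I)) = ((-(b + lam) : ℝ) : ℂ) + y * I by
        push_cast; ring]
    refine (norm_add_le _ _).trans ?_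
    rw [Complex.norm_real, Real.norm_eq_abs, abs_neg, abs_of_nonneg (by linarith), norm_mul, norm_I,
      Complex.norm_real, Real.norm_eq_abs]
    linarith
  have h2 := (Z.land (t := 0) hP hd hδP hCP le_rfl (by simp) hlam).2.2 _ (hn γ hγ) _
    (hn (-γ) (by rwa [abs_neg])) h0 h0' (by
      intro he
      apply hd0
      have := congrArg Complex.im he
      simp at this
      linarith)
  have k := Z.F_nonneg (1 + lam) (by linarith)
  rw [Z.F_eq (by simp [hl]), sub_re,
    show (((1 + lam : ℝ) : ℂ) - 1) = (lam:ℂ) + (0:ℝ) * I by push_cast; ring, re_inv] at k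
  rw [show (((1 + lam : ℝ):ℂ) + (0:ℝ) * I - ((1 - b : ℝ) + γ * I)) = ((lam + b : ℝ):ℂ) + (-γ:ℝ) * I by
    push_cast; ring,
    show (((1 + lam : ℝ):ℂ) + (0:ℝ) * I - ((1 - b : ℝ) + (-γ:ℝ) * I)) = ((lam + b : ℝ):ℂ) + (γ:ℝ) * I by
    push_cast; ring, re_inv, re_inv] at h2
  simp only [ofReal_zero, zero_mul, add_zero] at h2
  have e1 : lam / (lam ^ 2 + 0 ^ 2) = 1 / lam := by field_simp; simp
  have hg2 : γ ^ 2 ≤ lam ^ 2 / 16 := by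
    rw [← sq_abs γ]; nlinarith [abs_nonneg γ]
  have e4 : 3 / 4 * (1 / lam) ≤ (lam + b) / ((lam + b) ^ 2 + γ ^ 2) := by
    rw [le_div_iff₀ (by positivity)]
    have : 3 / 4 * (1 / lam) * ((lam + b) ^ 2 + γ ^ 2) = (3 * ((lam + b) ^ 2 + γ ^ 2)) / (4 * lam) := by field_simp
    rw [this, div_le_iff₀ (by positivity)]; nlinarith
  have e5 : 1 / (20 * lam) = 1 / 20 * (1 / lam) := by field_simp
  rw [e5] at h2
  rw [e1] at k
  have : 0 < 1 / lam := by positivity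
  rw [neg_sq] at h2
  linarith

lemma zero_loc {P : ℝ} (hP : 1 ≤ P) (hd : (d:ℝ) ≤ P) (hδP : 1 / δ ≤ P) (hCP : Real.log C ≤ P)
    {z : ℂ} (h0 : zH c κ z = 0) (hz : 1 - 1 / (40000000 * P ^ 4 * (1 + |z.im|)) < z.re) :
    z.im = 0 ∧ deriv (zH c κ) z ≠ 0 := by
  set γ := z.im with hγ
  have hg := abs_nonneg γ
  have hz' : z = ((1 - (1 - z.re) : ℝ) : ℂ) + γ * I := by
    simp [hγ, Complex.re_add_im]
  have hpos : 0 < 200000 * P ^ 4 := by positivity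
  set μ := 1 / (200000 * P ^ 4 * 1) with hμ
  have hμ0 : 0 < μ := by positivity
  have e1 : 1 / (40000000 * P ^ 4 * (1 + |γ|)) = μ / (200 * (1 + |γ|)) := by
    rw [hμ]; field_simp; norm_num
  have hsm : μ / (200 * (1 + |γ|)) ≤ μ / 200 := by
    apply div_le_div_of_nonneg_left hμ0.le (by norm_num); linarith
  rw [e1] at hz
  by_contra hcon
  have hcon' : γ = 0 → deriv (zH c κ) z = 0 := by
    intro h; by_contra h'; exact hcon ⟨h, h'⟩
  by_cases hc : |γ| ≤ μ / 4
  · have := Z.zero_near hP hd hδP hCP hμ (b := 1 - z.re) (γ := γ) (by rw [← hz']; exact h0) hc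
      (by rw [← hz']; exact hcon')
    linarith
  · push Not at hc
    have e2 : 1 / (200000 * P ^ 4 * (24 * (1 + |γ|))) = μ / (24 * (1 + |γ|)) := by
      rw [hμ]; field_simp
    have := Z.zero_far hP hd hδP hCP rfl (b := 1 - z.re) (γ := γ) (by rw [← hz']; exact h0) (by
      rw [e2]
      have : μ / (24 * (1 + |γ|)) ≤ μ / 24 := by
        apply div_le_div_of_nonneg_left hμ0.le (by norm_num); linarith
      linarith)
    rw [e2, div_div] at this
    have h3 : μ / (200 * (1 + |γ|)) ≤ μ / (24 * (1 + |γ|) * 8) := by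
      apply div_le_div_of_nonneg_left hμ0.le (by positivity); linarith
    linarith

set_option maxHeartbeats 800000 in
lemma G_bound {P τ : ℝ} (hP : 1 ≤ P) (hd : (d:ℝ) ≤ P) (hδP : 1 / δ ≤ P) (hCP : Real.log C ≤ P)
    (hτ : 0 < τ) (hτ1 : τ ≤ 1) (hno : ∀ β : ℝ, 1 - τ < β → β ≤ 1 → zH c κ β ≠ 0)
    {σ t : ℝ} (hσ : 1 < σ) (hσ2 : σ ≤ 2) :
    ‖deriv (zH c κ) (σ + t * I) / zH c κ (σ + t * I)‖ ≤ 128 * (40000000 * P ^ 4 / τ) ^ 3 * (2 + |t|) ^ 3 ∧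
    ‖deriv (fun s => deriv (zH c κ) s / zH c κ s) (σ + t * I)‖ ≤
      128 * (40000000 * P ^ 4 / τ) ^ 3 * (2 + |t|) ^ 3 := by
  have hδ := Z.δ_pos
  have hδ' := Z.δ_le
  have ht := abs_nonneg t
  have hP4 : 1 ≤ P ^ 3 := one_le_pow₀ hP
  set w := 200 * (2 + |t|) / τ with hw
  set η := 1 / (200000 * P ^ 4 * w) with hη
  have hw1 : 400 + |t| ≤ w := by
    rw [hw, le_div_iff₀ hτ]; nlinarith
  have hη0 : 0 < η := by positivity
  have hη' : 1 / η = 40000000 * P ^ 4 / τ * (2 + |t|) := by rw [hη, hw]; field_simp; norm_num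
  have hηδ : 60 * η ≤ δ := by
    have h1 : 1 ≤ δ * P := by rw [mul_comm]; rwa [div_le_iff₀ hδ] at hδP
    rw [hη, mul_one_div, div_le_iff₀ (by positivity)]
    calc (60:ℝ) ≤ 200000 * 1 * 1 * 1 := by norm_num
      _ ≤ 200000 * (δ * P) * P ^ 3 * w := by gcongr; linarith
      _ = _ := by ring
  set lam := max (σ - 1) η with hlam
  have hl : 0 < lam := lt_max_of_lt_right hη0
  have hl1 : lam ≤ 1 := max_le (by linarith) (by linarith)
  set c0 : ℂ := (1 + lam : ℝ) + t * I with hc0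
  have hre : c0.re = 1 + lam := by simp [hc0]
  have him : c0.im = t := by simp [hc0]
  have hM := Z.logM hP hd hδP hCP (by linarith) (by linarith : |t| ≤ w) hη
  have hC := Z.one_le_C
  have hk := Z.κ_pos
  have hLM : 81 * (3 + |t|) ^ 2 * C ^ 2 * κ ^ 2 / (δ ^ 2 * lam ^ 2) ≤ Real.exp (1 / η) := by
    have h1 : 81 * (3 + |t|) ^ 2 * C ^ 2 * κ ^ 2 / (δ ^ 2 * lam ^ 2) ≤
        81 * (3 + |t|) ^ 2 * C ^ 2 * κ ^ 2 / (δ ^ 2 * η ^ 2) := by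
      gcongr; exact le_max_right _ _
    refine h1.trans ?_
    set M := 81 * (3 + |t|) ^ 2 * C ^ 2 * κ ^ 2 / (δ ^ 2 * η ^ 2)
    have hM0 : 0 < M := by positivity
    rw [← Real.log_le_iff_le_exp hM0]
    by_contra hcon
    push Not at hcon
    have p : 0 < 1 / η := by positivity
    have : 24 * (Real.log M + 1) ≤ 24 * (Real.log M + 1) / (δ / 2) := by
      rw [le_div_iff₀ (by positivity)]; nlinarith
    have : 1 / (20 * η) = 1 / 20 * (1 / η) := by field_simp
    linarith
  have hb : ∀ s ∈ ball c0 (2 * η), 1 - η < s.re ∧ |s.im| ≤ |t| + 1 := by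
    intro s hs
    rw [mem_ball, dist_eq_norm] at hs
    have h1 := (abs_re_le_norm (s - c0)).trans_lt hs
    have h2 := (abs_im_le_norm (s - c0)).trans hs.le
    rw [sub_re, hre] at h1
    rw [sub_im, him] at h2
    have := le_max_right (σ - 1) η
    refine ⟨by have := (_root_.abs_lt.1 h1).1; linarith, ?_⟩
    have := abs_sub_abs_le_abs_sub s.im t
    linarith
  have hnz : ∀ s ∈ ball c0 (2 * η), zH c κ s ≠ 0 := by
    intro s hs h0
    obtain ⟨h1, h2⟩ := hb s hs
    have hs0 := abs_nonneg s.im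
    have hη2 : η = τ / (40000000 * P ^ 4 * (2 + |t|)) := by
      rw [hη, hw]; field_simp; norm_num
    have h3 : η ≤ τ / (40000000 * P ^ 4 * (1 + |s.im|)) := by
      rw [hη2]; apply div_le_div_of_nonneg_left hτ.le (by positivity)
      apply mul_le_mul_of_nonneg_left _ (by positivity); linarith
    have h4 : τ / (40000000 * P ^ 4 * (1 + |s.im|)) ≤ 1 / (40000000 * P ^ 4 * (1 + |s.im|)) := by gcongr
    have h5 := Z.zero_loc hP hd hδP hCP h0 (by linarith)
    have h6 : s = (s.re : ℂ) := by apply Complex.ext <;> simp [h5.1]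
    have hP44 : 1 ≤ P ^ 4 := one_le_pow₀ hP
    have h7 : η ≤ τ := by
      rw [hη2]
      apply div_le_self hτ.le
      nlinarith
    have h8 : s.re ≤ 1 := by
      by_contra hcon
      exact Z.H_ne_zero (by linarith) h0
    rw [h6] at h0
    exact hno s.re (by linarith) h8 h0
  have hdiff : DifferentiableOn ℂ (zH c κ) (ball c0 (2 * η)) := fun s hs =>
    (Z.H_diffAt (by have := (hb s hs).1; linarith)).differentiableWithinAt
  have key := logDeriv_bound (f := zH c κ) (c := c0) (R := 2 * η) (r := 3 / 2 * η) (L := 1 / η)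
    (by positivity) (by linarith) hdiff hnz (by positivity) (by
      intro s hs
      refine (Z.near (t := t) hl hl1 s ?_).trans ?_
      · exact closedBall_subset_closedBall (by linarith) (ball_subset_closedBall hs)
      · exact mul_le_mul_of_nonneg_right hLM (norm_nonneg _))
  have e1 : 8 * (1 / η) * (2 * η) / (2 * η - 3 / 2 * η) ^ 2 = 64 * (1 / η) ^ 2 := by
    field_simp; norm_num
  rw [e1] at key
  set s0 : ℂ := σ + t * I with hs0
  have hs1 : closedBall s0 (η / 2) ⊆ closedBall c0 (3 / 2 * η) := by
    apply closedBall_subset_closedBall'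
    rw [dist_eq_norm, show s0 - c0 = ((σ - 1 - lam : ℝ):ℂ) by rw [hs0, hc0]; push_cast; ring,
      Complex.norm_real, Real.norm_eq_abs]
    have : |σ - 1 - lam| ≤ η := by
      rw [abs_le]
      rcases max_cases (σ - 1) η with h | h <;> rw [hlam, h.1] <;> constructor <;> linarith
    linarith
  have hr : 1 ≤ 1 / η := by rw [le_div_iff₀ hη0]; linarith
  have hpow : 128 * (1 / η) ^ 3 = 128 * (40000000 * P ^ 4 / τ) ^ 3 * (2 + |t|) ^ 3 := by
    rw [hη']; ring
  rw [← hpow]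
  constructor
  · refine (key s0 (hs1 (mem_closedBall_self (by positivity)))).trans ?_
    have : (1 / η) ^ 2 ≤ (1 / η) ^ 3 := pow_le_pow_right₀ hr (by norm_num)
    have h4 := pow_nonneg (zero_le_one.trans hr) 3
    linarith only [this, h4]
  · have hsb : closedBall c0 (3 / 2 * η) ⊆ ball c0 (2 * η) := closedBall_subset_ball (by linarith)
    have hd1 : DifferentiableOn ℂ (fun s => deriv (zH c κ) s / zH c κ s) (ball c0 (2 * η)) :=
      (hdiff.deriv isOpen_ball).div hdiff hnz
    have := Complex.norm_deriv_le_of_forall_mem_sphere_norm_le (c := s0) (R := η / 2)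
      (C := 64 * (1 / η) ^ 2) (f := fun s => deriv (zH c κ) s / zH c κ s) (by positivity) (by
        apply DifferentiableOn.diffContOnCl
        rw [closure_ball _ (by positivity)]
        exact hd1.mono (hs1.trans hsb)) (fun z hz => key z (hs1 (sphere_subset_closedBall hz)))
    refine this.trans (le_of_eq ?_)
    field_simp; norm_num
end ZData

namespace ZData
open Filter Topology Complex MeasureTheory Asymptotics Metric

lemma powsum {f : ℕ → ℂ} {D : ℝ} (T : Finset ℕ) (hf : ∀ n, ‖f n‖ ≤ D)
    (hs : ∀ n, f n ≠ 0 → n ∈ T ∨ ∃ a b : ℕ, n = a ^ 2 * b ^ 3) {s : ℂ} (hσ : 1 / 2 < s.re) :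
    LSeriesSummable f s := by
  have hD : 0 ≤ D := (norm_nonneg _).trans (hf 0)
  set S : Set ℕ := {n | n ∉ T ∧ LSeries.term f s n ≠ 0} with hS
  have h1 : Summable (S.indicator (LSeries.term f s)) := by
    rw [← summable_subtype_iff_indicator]
    have hex : ∀ n : S, ∃ q : ℕ × ℕ, (n:ℕ) = q.1 ^ 2 * q.2 ^ 3 := by
      rintro ⟨n, hnT, hn⟩
      have hfn : f n ≠ 0 := by
        intro h; apply hn; rcases eq_or_ne n 0 with rfl | h0
        · simp
        · simp [LSeries.term_of_ne_zero h0, h]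
      rcases hs n hfn with h | ⟨a, b, h⟩
      · exact absurd h hnT
      · exact ⟨(a, b), h⟩
    choose i hi using hex
    have hinj : Function.Injective i := fun m n h => Subtype.ext (by rw [hi m, hi n, h])
    have hsum : Summable fun q : ℕ × ℕ => D * ((q.1:ℝ) ^ (-(2 * s.re)) * (q.2:ℝ) ^ (-(3 * s.re))) := by
      apply Summable.mul_left
      exact Summable.mul_of_nonneg (Real.summable_nat_rpow.2 (by linarith))
        (Real.summable_nat_rpow.2 (by linarith)) (fun _ => by positivity) (fun _ => by positivity)
    refine Summable.of_norm_bounded (hsum.comp_injective hinj) ?_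
    intro n
    have hn0 : (n:ℕ) ≠ 0 := by
      intro h; apply n.2.2; rw [h]; simp
    simp only [Function.comp]
    rw [LSeries.norm_term_eq, if_neg hn0, div_eq_mul_inv, ← Real.rpow_neg (by positivity)]
    apply mul_le_mul (hf _) _ (by positivity) hD
    conv_lhs => rw [hi n]
    push_cast
    rw [Real.mul_rpow (by positivity) (by positivity), ← Real.rpow_natCast, ← Real.rpow_natCast,
      ← Real.rpow_mul (by positivity), ← Real.rpow_mul (by positivity)]
    apply le_of_eq; congr 2 <;> push_cast <;> ring
  have h2 : Summable (fun n => LSeries.term f s n - S.indicator (LSeries.term f s) n) := by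
    apply summable_of_ne_finset_zero (s := T)
    intro n hn
    by_cases h0 : LSeries.term f s n = 0
    · simp [Set.indicator, h0]
    · rw [Set.indicator_of_mem (show n ∈ S from ⟨hn, h0⟩), sub_self]
  have := h2.add h1
  simpa [LSeriesSummable] using this

lemma pp_form {q : ℕ} (h : IsPrimePow q) (hq : ¬ q.Prime) : ∃ a b : ℕ, q = a ^ 2 * b ^ 3 := by
  obtain ⟨p, k, hp, hk, rfl⟩ := h
  have hp' := hp.nat_prime
  have hk1 : k ≠ 1 := by rintro rfl; simp at hq; exact hq hp'
  rcases Nat.even_or_odd' k with ⟨m, rfl | rfl⟩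
  · exact ⟨p ^ m, 1, by ring⟩
  · refine ⟨p ^ (m - 1), p, ?_⟩
    rw [← pow_mul, ← pow_add]; congr 1; omega

variable {c Λ : ℕ → ℝ} {d : ℕ} {κ C δ : ℝ}

lemma ord_ne_top (Z : ZData c Λ d κ C δ) {β : ℂ} (hβ : 1 - δ < β.re) :
    analyticOrderAt (zH c κ) β ≠ ⊤ := by
  rw [Ne, analyticOrderAt_eq_top]
  intro h
  have hU : AnalyticOnNhd ℂ (zH c κ) {s | 1 - δ < s.re} := fun s hs => Z.H_analytic hs
  have hc : IsPreconnected {s : ℂ | 1 - δ < s.re} := (convex_halfSpace_re_gt _).isPreconnected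
  have := hU.eqOn_zero_of_preconnected_of_eventuallyEq_zero hc hβ h
    (show (1:ℂ) ∈ {s : ℂ | 1 - δ < s.re} by simp [Z.δ_pos])
  rw [H_one] at this
  simp at this

lemma ell_norm (Z : ZData c Λ d κ C δ) (n : ℕ) : |Λ n / Real.log n| ≤ d := by
  have h1 := Z.L_nonneg n
  have h2 := Z.L_le n
  have h3 : ArithmeticFunction.vonMangoldt n ≤ Real.log n := ArithmeticFunction.vonMangoldt_le_log
  have h4 : 0 ≤ Real.log n := Real.log_natCast_nonneg n
  rw [abs_div, abs_of_nonneg h1, abs_of_nonneg h4]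
  apply div_le_of_le_mul₀ h4 (by positivity)
  exact h2.trans (by gcongr)

lemma ell_supp (Z : ZData c Λ d κ C δ) (n : ℕ) (h : ¬ IsPrimePow n) : Λ n = 0 := by
  have h2 := Z.L_le n
  rw [ArithmeticFunction.vonMangoldt_apply, if_neg h, mul_zero] at h2
  exact le_antisymm h2 (Z.L_nonneg n)

lemma parity {cA ΛA cB ΛB cD ΛD cE ΛE : ℕ → ℝ} {dA dB dD dE : ℕ} {κA CA δA κB CB δB κD CD δD κE CE δE : ℝ}
    (ZA : ZData cA ΛA dA κA CA δA) (ZB : ZData cB ΛB dB κB CB δB)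
    (ZD : ZData cD ΛD dD κD CD δD) (ZE : ZData cE ΛE dE κE CE δE)
    (m : ℕ) (hm : m ≠ 0) (hrel : ∀ p : ℕ, p.Prime → ¬ p ∣ m → ΛA p + 2 * ΛB p = ΛD p + 2 * ΛE p)
    {β : ℝ} (hA : 1 - δA < β) (hB : 1 - δB < β) (hD : 1 - δD < β) (hE : 1 - δE < β)
    (h0 : zH cA κA β = 0) (h1 : deriv (zH cA κA) β ≠ 0) : zH cD κD β = 0 := by
  set lam : ℕ → ℂ := fun n => ((ΛA n / Real.log n : ℝ) : ℂ) + (2:ℂ) * ((ΛB n / Real.log n : ℝ) : ℂ) -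
    ((ΛD n / Real.log n : ℝ) : ℂ) - (2:ℂ) * ((ΛE n / Real.log n : ℝ) : ℂ) with hlam
  have hsum : ∀ s : ℂ, 1 / 2 < s.re → LSeriesSummable lam s := by
    intro s hs
    refine powsum (D := dA + 2 * dB + dD + 2 * dE) m.divisors ?_ ?_ hs
    · intro n
      have e : lam n = ((ΛA n / Real.log n + 2 * (ΛB n / Real.log n) - ΛD n / Real.log n -
        2 * (ΛE n / Real.log n) : ℝ) : ℂ) := by simp [hlam]
      rw [e, Complex.norm_real, Real.norm_eq_abs, abs_le]
      have a1 := abs_le.1 (ZA.ell_norm n)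
      have a2 := abs_le.1 (ZB.ell_norm n)
      have a3 := abs_le.1 (ZD.ell_norm n)
      have a4 := abs_le.1 (ZE.ell_norm n)
      constructor <;> linarith
    · intro n hn
      by_cases hpp : IsPrimePow n
      · by_cases hp : n.Prime
        · by_cases hd : n ∣ m
          · left; simp [hd, hm]
          · exfalso; apply hn
            have := hrel n hp hd
            have e : lam n = (((ΛA n + 2 * ΛB n - (ΛD n + 2 * ΛE n)) / Real.log n : ℝ) : ℂ) := by
              simp [hlam]; ring
            rw [e, this]; simp
        · right; exact pp_form hpp hp
      · exfalso; apply hn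
        simp [hlam, ZA.ell_supp n hpp, ZB.ell_supp n hpp, ZD.ell_supp n hpp, ZE.ell_supp n hpp]
  have hW : ∀ s : ℂ, 1 / 2 < s.re → AnalyticAt ℂ (LSeries lam) s := by
    intro s hs
    apply LSeries_analyticOnNhd
    have : LSeries.abscissaOfAbsConv lam ≤ ((1 / 2 : ℝ) : EReal) :=
      LSeries.abscissaOfAbsConv_le_of_forall_lt_LSeriesSummable (fun y hy => hsum y (by simpa using hy))
    exact this.trans_lt (by exact_mod_cast hs)
  set x0 : ℝ := 1 - min (min δA δB) (min δD δE) with hx0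
  have q1 : 1 - δA ≤ x0 := by
    have : min (min δA δB) (min δD δE) ≤ δA := (min_le_left _ _).trans (min_le_left _ _)
    linarith
  have q2 : 1 - δB ≤ x0 := by
    have : min (min δA δB) (min δD δE) ≤ δB := (min_le_left _ _).trans (min_le_right _ _)
    linarith
  have q3 : 1 - δD ≤ x0 := by
    have : min (min δA δB) (min δD δE) ≤ δD := (min_le_right _ _).trans (min_le_left _ _)
    linarith
  have q4 : 1 - δE ≤ x0 := by
    have : min (min δA δB) (min δD δE) ≤ δE := (min_le_right _ _).trans (min_le_right _ _)
    linarith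
  have qβ : x0 < β := by
    have : 1 - β < min (min δA δB) (min δD δE) := by
      simp only [lt_min_iff]; refine ⟨⟨?_, ?_⟩, ?_, ?_⟩ <;> linarith
    linarith
  have q5 : 1 / 2 ≤ x0 := by have := ZA.δ_le; linarith
  have q6 : x0 < 1 := by
    have : 0 < min (min δA δB) (min δD δE) := by
      simp only [lt_min_iff]; exact ⟨⟨ZA.δ_pos, ZB.δ_pos⟩, ZD.δ_pos, ZE.δ_pos⟩
    linarith
  set U : Set ℂ := {s | x0 < s.re} with hU
  have kA := ZA.κ_pos.ne'
  have kB := ZB.κ_pos.ne'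
  have kD := ZD.κ_pos.ne'
  have kE := ZE.κ_pos.ne'
  set k0 : ℂ := ((κD * κE ^ 2 / (κA * κB ^ 2) : ℝ) : ℂ) with hk0
  have hk0' : k0 ≠ 0 := by
    rw [hk0, Complex.ofReal_ne_zero]; positivity
  have anA : AnalyticOnNhd ℂ (zH cA κA) U := fun s hs => ZA.H_analytic (q1.trans_lt hs)
  have anB : AnalyticOnNhd ℂ (zH cB κB) U := fun s hs => ZB.H_analytic (q2.trans_lt hs)
  have anD : AnalyticOnNhd ℂ (zH cD κD) U := fun s hs => ZD.H_analytic (q3.trans_lt hs)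
  have anE : AnalyticOnNhd ℂ (zH cE κE) U := fun s hs => ZE.H_analytic (q4.trans_lt hs)
  have anW : AnalyticOnNhd ℂ (fun s => k0 * Complex.exp (LSeries lam s)) U := fun s hs =>
    analyticAt_const.mul (hW s (q5.trans_lt hs)).cexp
  have hid : Set.EqOn (zH cA κA * zH cB κB ^ 2)
      ((fun s => k0 * Complex.exp (LSeries lam s)) * (zH cD κD * zH cE κE ^ 2)) U := by
    refine AnalyticOnNhd.eqOn_of_preconnected_of_eventuallyEq (anA.mul (anB.pow 2))
      (anW.mul (anD.mul (anE.pow 2))) (convex_halfSpace_re_gt _).isPreconnected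
      (show (2:ℂ) ∈ U by simp [hU]; linarith) ?_
    have : {s : ℂ | 1 < s.re} ∈ 𝓝 (2:ℂ) :=
      (isOpen_lt continuous_const continuous_re).mem_nhds (by simp)
    filter_upwards [this] with s hs
    have hs : 1 < s.re := hs
    have e : LSeries lam s = LSeries (fun n => ((ΛA n / Real.log n : ℝ) : ℂ)) s +
        2 * LSeries (fun n => ((ΛB n / Real.log n : ℝ) : ℂ)) s -
        LSeries (fun n => ((ΛD n / Real.log n : ℝ) : ℂ)) s -
        2 * LSeries (fun n => ((ΛE n / Real.log n : ℝ) : ℂ)) s := by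
      have hl : lam = (fun n => ((ΛA n / Real.log n : ℝ) : ℂ)) + (2:ℂ) • (fun n => ((ΛB n / Real.log n : ℝ) : ℂ)) -
        (fun n => ((ΛD n / Real.log n : ℝ) : ℂ)) - (2:ℂ) • (fun n => ((ΛE n / Real.log n : ℝ) : ℂ)) := by
        funext n; simp [hlam]
      have sA := ZA.ell_summable hs
      have sB := ZB.ell_summable hs
      have sD := ZD.ell_summable hs
      have sE := ZE.ell_summable hs
      rw [hl, LSeries_sub ((sA.add (sB.smul 2)).sub sD) (sE.smul 2),
        LSeries_sub (sA.add (sB.smul 2)) sD, LSeries_add sA (sB.smul 2), LSeries_smul, LSeries_smul]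
    have ee : Complex.exp (LSeries lam s) * (LSeries (fun n => (cD n : ℂ)) s * LSeries (fun n => (cE n : ℂ)) s ^ 2) =
        LSeries (fun n => (cA n : ℂ)) s * LSeries (fun n => (cB n : ℂ)) s ^ 2 := by
      rw [ZA.Z_eq_exp hs, ZB.Z_eq_exp hs, ZD.Z_eq_exp hs, ZE.Z_eq_exp hs, e,
        ← Complex.exp_nat_mul, ← Complex.exp_nat_mul, ← Complex.exp_add, ← Complex.exp_add, ← Complex.exp_add]
      congr 1; push_cast; ring
    simp only [Pi.mul_apply, Pi.pow_apply]
    rw [ZA.H_eq hs, ZB.H_eq hs, ZD.H_eq hs, ZE.H_eq hs, hk0]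
    have kA' : (κA:ℂ) ≠ 0 := by exact_mod_cast kA
    have kB' : (κB:ℂ) ≠ 0 := by exact_mod_cast kB
    have kD' : (κD:ℂ) ≠ 0 := by exact_mod_cast kD
    have kE' : (κE:ℂ) ≠ 0 := by exact_mod_cast kE
    push_cast
    field_simp
    linear_combination -(s - 1) ^ 3 * ee
  have hβU : (β:ℂ) ∈ U := by simp [hU, qβ]
  have hord := analyticOrderAt_congr (hid.eventuallyEq_of_mem
    ((isOpen_lt continuous_const continuous_re).mem_nhds hβU))
  rw [analyticOrderAt_mul (anA _ hβU) ((anB _ hβU).pow 2), analyticOrderAt_pow (anB _ hβU),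
    analyticOrderAt_mul (anW _ hβU) ((anD _ hβU).mul ((anE _ hβU).pow 2)),
    analyticOrderAt_mul (anD _ hβU) ((anE _ hβU).pow 2), analyticOrderAt_pow (anE _ hβU),
    (anW _ hβU).analyticOrderAt_eq_zero.2 (mul_ne_zero hk0' (Complex.exp_ne_zero _))] at hord
  have oA : analyticOrderAt (zH cA κA) β = 1 := by
    have := (anA _ hβU).analyticOrderAt_sub_eq_one_of_deriv_ne_zero h1
    simpa [h0] using this
  by_contra hD0
  rw [oA, (anD _ hβU).analyticOrderAt_eq_zero.2 hD0] at hord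
  obtain ⟨n1, e1⟩ := ENat.ne_top_iff_exists.1 (ZB.ord_ne_top (β := β) (by simpa using hB))
  obtain ⟨n2, e2⟩ := ENat.ne_top_iff_exists.1 (ZE.ord_ne_top (β := β) (by simpa using hE))
  rw [← e1, ← e2] at hord
  simp only [zero_add, nsmul_eq_mul] at hord
  have : 1 + 2 * n1 = 2 * n2 := by exact_mod_cast hord
  omega
end ZData

namespace Tau
open Filter Topology Complex MeasureTheory FourierTransform

noncomputable def ek (σ : ℝ) (j : ℕ) (u : ℝ) : ℂ :=
  if 0 < u then ((u ^ j * Real.exp (-(σ * u)) : ℝ) : ℂ) else 0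

lemma intOn (j : ℕ) {σ : ℝ} (hσ : 0 < σ) :
    IntegrableOn (fun u : ℝ => u ^ j * Real.exp (-(σ * u))) (Set.Ioi 0) := by
  have := integrableOn_rpow_mul_exp_neg_mul_rpow (p := 1) (s := j) (b := σ)
    (by have : (0:ℝ) ≤ j := by positivity
        linarith) one_pos hσ
  refine this.congr_fun ?_ measurableSet_Ioi
  intro u hu
  simp

lemma intOnC (j : ℕ) {s : ℂ} (hs : 0 < s.re) :
    IntegrableOn (fun u : ℝ => (u:ℂ) ^ j * Complex.exp (-(s * u))) (Set.Ioi 0) := by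
  refine (intOn j hs).mono' (by fun_prop) ?_
  filter_upwards [ae_restrict_mem measurableSet_Ioi] with u hu
  rw [norm_mul, norm_pow, Complex.norm_real, Complex.norm_exp, Real.norm_of_nonneg (le_of_lt hu)]
  simp

lemma lap (j : ℕ) {s : ℂ} (hs : 0 < s.re) :
    ∫ u in Set.Ioi (0:ℝ), (u:ℂ) ^ j * Complex.exp (-(s * u)) = (j.factorial : ℂ) / s ^ (j + 1) := by
  have hs0 : s ≠ 0 := by rintro rfl; simp at hs
  induction j with
  | zero =>
    have := integral_exp_mul_complex_Ioi (a := -s) (by simpa using hs) 0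
    simp only [neg_mul, ofReal_zero, mul_zero, Complex.exp_zero] at this
    simp only [pow_zero, one_mul]
    rw [this]; simp [neg_div_neg_eq]
  | succ j ih =>
    have hd : ∀ u : ℝ, HasDerivAt (fun u : ℝ => (u:ℂ) ^ (j + 1) * Complex.exp (-(s * u)))
        ((j + 1 : ℂ) * ((u:ℂ) ^ j * Complex.exp (-(s * u))) - s * ((u:ℂ) ^ (j + 1) * Complex.exp (-(s * u)))) u := by
      intro u
      have h1 : HasDerivAt (fun u : ℂ => u ^ (j + 1) * Complex.exp (-(s * u)))
          (((j + 1 : ℕ) : ℂ) * (u:ℂ) ^ j * Complex.exp (-(s * u)) + (u:ℂ) ^ (j + 1) * (Complex.exp (-(s * u)) * (-(s * 1)))) u := by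
        exact (hasDerivAt_pow (j + 1) (u:ℂ)).fun_mul (((hasDerivAt_id (u:ℂ)).const_mul s).fun_neg.cexp)
      convert h1.comp_ofReal using 1
      push_cast; ring
    have hlim : Tendsto (fun u : ℝ => (u:ℂ) ^ (j + 1) * Complex.exp (-(s * u))) atTop (𝓝 0) := by
      rw [tendsto_zero_iff_norm_tendsto_zero]
      have := Real.tendsto_pow_mul_exp_neg_atTop_nhds_zero (j + 1)
      have h2 : Tendsto (fun u : ℝ => (1 / s.re) ^ (j + 1) * ((s.re * u) ^ (j + 1) * Real.exp (-(s.re * u)))) atTop (𝓝 0) := by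
        have := (this.comp (tendsto_id.const_mul_atTop hs)).const_mul ((1 / s.re) ^ (j + 1))
        simpa using this
      refine h2.congr' ?_
      filter_upwards [eventually_gt_atTop 0] with u hu
      rw [norm_mul, norm_pow, Complex.norm_real, Complex.norm_exp, Real.norm_of_nonneg (le_of_lt hu)]
      rw [mul_pow, ← mul_assoc, ← mul_assoc, ← mul_pow, one_div_mul_cancel hs.ne']
      simp
    have i1 := (intOnC j hs).const_mul (j + 1 : ℂ)
    have i2 := (intOnC (j + 1) hs).const_mul s
    have := integral_Ioi_of_hasDerivAt_of_tendsto (a := 0) (hd 0).continuousAt.continuousWithinAt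
      (fun u _ => hd u) (i1.sub i2) hlim
    rw [integral_sub i1 i2, integral_const_mul, integral_const_mul, ih] at this
    simp only [ofReal_zero, ne_eq, Nat.add_eq_zero_iff, one_ne_zero, and_false, not_false_eq_true, zero_pow, zero_mul, sub_zero] at this
    rw [sub_eq_zero] at this
    rw [eq_div_iff (by positivity), pow_succ s (j + 1), Nat.factorial_succ]
    push_cast
    calc _ = (s * ∫ u in Set.Ioi (0:ℝ), (u:ℂ) ^ (j + 1) * Complex.exp (-(s * u))) * s ^ (j + 1) := by ring
      _ = _ := by rw [← this]; field_simp

lemma ek_eq (σ : ℝ) (j : ℕ) : ek σ j = (Set.Ioi (0:ℝ)).indicator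
    (fun u => ((u ^ j * Real.exp (-(σ * u)) : ℝ) : ℂ)) := by
  funext u; simp [ek, Set.indicator]

lemma ek_int {σ : ℝ} (hσ : 0 < σ) (j : ℕ) : Integrable (ek σ j) := by
  rw [ek_eq, integrable_indicator_iff measurableSet_Ioi]
  exact (intOn j hσ).ofReal

lemma ek_fourier {σ : ℝ} (hσ : 0 < σ) (j : ℕ) (ξ : ℝ) :
    𝓕 (ek σ j) ξ = (j.factorial : ℂ) / (σ + (2 * Real.pi * ξ : ℝ) * I) ^ (j + 1) := by
  rw [Real.fourier_real_eq_integral_exp_smul, ← lap j (by simpa using hσ), ek_eq]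
  rw [← integral_indicator measurableSet_Ioi]
  congr 1
  funext u
  by_cases hu : u ∈ Set.Ioi (0:ℝ)
  · rw [Set.indicator_of_mem hu, Set.indicator_of_mem hu]
    push_cast
    rw [smul_eq_mul, mul_left_comm, ← Complex.exp_add]
    congr 2; push_cast; ring
  · rw [Set.indicator_of_notMem hu, Set.indicator_of_notMem hu]; simp

lemma ek_cont (σ : ℝ) {j : ℕ} (hj : j ≠ 0) : Continuous (ek σ j) := by
  unfold ek
  have : (fun u : ℝ => if 0 < u then ((u ^ j * Real.exp (-(σ * u)) : ℝ) : ℂ) else 0) =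
      fun u : ℝ => (((max u 0) ^ j * Real.exp (-(σ * u)) : ℝ) : ℂ) := by
    funext u
    split_ifs with h
    · rw [max_eq_left h.le]
    · rw [max_eq_right (not_lt.1 h)]; simp [hj]
  rw [this]; fun_prop

lemma ek_contAt (σ : ℝ) (j : ℕ) {v : ℝ} (hv : 0 < v) : ContinuousAt (ek σ j) v := by
  have : (fun u => ((u ^ j * Real.exp (-(σ * u)) : ℝ) : ℂ)) =ᶠ[𝓝 v] ek σ j := by
    filter_upwards [lt_mem_nhds hv] with u hu
    simp [ek, hu]
  exact ContinuousAt.congr (by fun_prop) this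

lemma ek_norm (σ : ℝ) (hσ : 1 ≤ σ) (j : ℕ) (u : ℝ) : ‖ek σ j u‖ ≤ j.factorial := by
  unfold ek
  split_ifs with h
  · rw [Complex.norm_real, Real.norm_of_nonneg (by positivity), Real.exp_neg, ← div_eq_mul_inv,
      div_le_iff₀ (Real.exp_pos _)]
    have h1 := Real.pow_div_factorial_le_exp u h.le j
    have h2 : Real.exp u ≤ Real.exp (σ * u) := Real.exp_le_exp.2 (by nlinarith)
    rw [div_le_iff₀ (by positivity)] at h1
    have h3 : (0:ℝ) < j.factorial := by positivity
    nlinarith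
  · simp

lemma int_tsum {F : ℕ → ℝ → ℂ} (hF : ∀ n, Integrable (F n)) (hs : Summable fun n => ∫ u, ‖F n u‖)
    (hm : AEStronglyMeasurable (fun u => ∑' n, F n u)) : Integrable fun u => ∑' n, F n u := by
  refine ⟨hm, ?_⟩
  unfold HasFiniteIntegral
  calc ∫⁻ u, ‖∑' n, F n u‖ₑ ≤ ∫⁻ u, ∑' n, ‖F n u‖ₑ := lintegral_mono fun u => enorm_tsum_le_tsum_enorm
    _ = ∑' n, ∫⁻ u, ‖F n u‖ₑ := lintegral_tsum fun n => (hF n).1.enorm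
    _ = ∑' n, ENNReal.ofReal (∫ u, ‖F n u‖) := by
      congr 1; funext n
      rw [ofReal_integral_norm_eq_lintegral_enorm (hF n)]
    _ < ⊤ := by
      rw [← ENNReal.ofReal_tsum_of_nonneg (fun n => integral_nonneg fun u => norm_nonneg _) hs]
      exact ENNReal.ofReal_lt_top
end Tau

noncomputable def Wk (Λ : ℕ → ℝ) (k : ℕ) (x : ℝ) : ℝ :=
  ∑ n ∈ Finset.Icc 1 ⌊x⌋₊, Λ n * (Real.log (x / n) ^ k / k.factorial)

namespace ZData
open Filter Topology Complex MeasureTheory FourierTransform Tau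
variable {c Λ : ℕ → ℝ} {d : ℕ} {κ C δ : ℝ} (Z : ZData c Λ d κ C δ)
include Z

noncomputable def fF (Λ : ℕ → ℝ) (σ : ℝ) (n : ℕ) (u : ℝ) : ℂ :=
  ((Λ n * (n:ℝ) ^ (-σ) / 24 : ℝ) : ℂ) * ek σ 4 (u - Real.log n)

noncomputable def fM (σ : ℝ) (u : ℝ) : ℂ :=
  ek (σ - 1) 0 u - ∑ j ∈ Finset.range 5, ((1 / (j.factorial : ℝ) : ℝ) : ℂ) * ek σ j u

noncomputable def fT (Λ : ℕ → ℝ) (σ : ℝ) (u : ℝ) : ℂ := (∑' n, fF Λ σ n u) - fM σ u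

omit Z in
lemma fM_int {σ : ℝ} (hσ : 1 < σ) : Integrable (fM σ) := by
  refine (ek_int (by linarith) 0).sub ?_
  exact integrable_finsetSum _ fun j _ => (ek_int (by linarith) j).const_mul _

omit Z in
lemma fM_fourier {σ : ℝ} (hσ : 1 < σ) (ξ : ℝ) : 𝓕 (fM σ) ξ =
    1 / ((σ + (2 * Real.pi * ξ : ℝ) * I - 1) * (σ + (2 * Real.pi * ξ : ℝ) * I) ^ 5) := by
  set s : ℂ := σ + (2 * Real.pi * ξ : ℝ) * I with hs
  have hs0 : s ≠ 0 := by
    intro h; have := congrArg Complex.re h; simp [hs] at this; linarith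
  have hs1 : s - 1 ≠ 0 := by
    intro h; have := congrArg Complex.re h; simp [hs] at this; linarith
  have i : ∀ f : ℝ → ℂ, Integrable f → Integrable fun v : ℝ => Complex.exp ((-2 * Real.pi * v * ξ : ℝ) * I) • f v := by
    intro f hf
    have := (Real.fourierIntegral_convergent_iff ξ (f := f)).2 hf
    refine hf.mono (by have := hf.1; fun_prop) (ae_of_all _ fun v => ?_)
    rw [norm_smul, Complex.norm_exp_ofReal_mul_I, one_mul]
  rw [Real.fourier_real_eq_integral_exp_smul]
  unfold fM
  simp only [smul_sub, Finset.smul_sum]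
  rw [integral_sub (i _ (ek_int (by linarith) 0)) (integrable_finsetSum _ fun j _ => i _ ((ek_int (by linarith) j).const_mul _)),
    integral_finsetSum _ fun j _ => i _ ((ek_int (by linarith) j).const_mul _)]
  simp only [smul_eq_mul]
  have e0 := ek_fourier (σ := σ - 1) (by linarith) 0 ξ
  rw [Real.fourier_real_eq_integral_exp_smul] at e0
  simp only [smul_eq_mul] at e0
  rw [e0]
  have ej : ∀ j, ∫ v : ℝ, Complex.exp ((-2 * Real.pi * v * ξ : ℝ) * I) * (((1 / (j.factorial : ℝ) : ℝ) : ℂ) * ek σ j v) =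
      1 / s ^ (j + 1) := by
    intro j
    have e1 := ek_fourier (σ := σ) (by linarith) j ξ
    rw [Real.fourier_real_eq_integral_exp_smul] at e1
    simp only [smul_eq_mul] at e1
    simp only [mul_left_comm _ (((1 / (j.factorial : ℝ) : ℝ) : ℂ)) _]
    rw [integral_const_mul, e1, ← hs]
    have : (j.factorial : ℂ) ≠ 0 := by exact_mod_cast j.factorial_ne_zero
    push_cast
    field_simp
  simp only [ej]
  have : (((σ - 1 : ℝ):ℂ) + (2 * Real.pi * ξ : ℝ) * I) = s - 1 := by rw [hs]; push_cast; ring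
  rw [this]
  simp only [Finset.sum_range_succ, Finset.sum_range_zero]
  simp only [Nat.factorial]
  field_simp
  push_cast
  ring

omit Z in
lemma fF_int {σ : ℝ} (hσ : 1 < σ) (n : ℕ) : Integrable (fF Λ σ n) :=
  ((ek_int (by linarith) 4).comp_sub_right _).const_mul _

lemma LS {σ : ℝ} (hσ : 1 < σ) : Summable fun n : ℕ => Λ n * (n:ℝ) ^ (-σ) := by
  have := (Z.F_re σ 0 hσ).2
  refine this.congr fun n => by simp

lemma fF_sum {σ : ℝ} (hσ : 1 < σ) : Summable fun n => ∫ u, ‖fF Λ σ n u‖ := by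
  have : ∀ n, ∫ u, ‖fF Λ σ n u‖ = Λ n * (n:ℝ) ^ (-σ) * ((∫ u, ‖ek σ 4 u‖) / 24) := by
    intro n
    simp only [fF, norm_mul, Complex.norm_real]
    rw [integral_const_mul, integral_sub_right_eq_self (fun u => ‖ek σ 4 u‖) (Real.log n),
      Real.norm_of_nonneg]
    · ring
    · have := Z.L_nonneg n; positivity
  simp only [this]
  exact (Z.LS hσ).mul_right _

lemma fF_cont {σ : ℝ} (hσ : 1 < σ) : Continuous fun u => ∑' n, fF Λ σ n u := by
  refine continuous_tsum (u := fun n => Λ n * (n:ℝ) ^ (-σ)) (fun n => ?_) (Z.LS hσ) ?_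
  · unfold fF
    exact continuous_const.mul ((ek_cont σ (by norm_num)).comp (by fun_prop))
  · intro n u
    have hn := Z.L_nonneg n
    have h := ek_norm σ hσ.le 4 (u - Real.log n)
    rw [fF, norm_mul, Complex.norm_real, Real.norm_of_nonneg (by positivity)]
    have h2 : 0 ≤ Λ n * (n:ℝ) ^ (-σ) := by positivity
    calc _ ≤ Λ n * (n:ℝ) ^ (-σ) / 24 * ((Nat.factorial 4 : ℕ) : ℝ) := by gcongr
      _ = _ := by norm_num [Nat.factorial]

lemma fT_int {σ : ℝ} (hσ : 1 < σ) : Integrable (fT Λ σ) :=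
  (int_tsum (fF_int hσ) (Z.fF_sum hσ) (Z.fF_cont hσ).aestronglyMeasurable).sub (fM_int hσ)

lemma fT_fourier {σ : ℝ} (hσ : 1 < σ) (ξ : ℝ) : 𝓕 (fT Λ σ) ξ =
    -(deriv (zH c κ) (σ + (2 * Real.pi * ξ : ℝ) * I) / zH c κ (σ + (2 * Real.pi * ξ : ℝ) * I)) /
      (σ + (2 * Real.pi * ξ : ℝ) * I) ^ 5 := by
  have hM := fM_fourier hσ ξ
  set s : ℂ := σ + (2 * Real.pi * ξ : ℝ) * I with hs
  have hsre : s.re = σ := by simp [hs]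
  have hs0 : s ≠ 0 := by
    intro h; have := congrArg Complex.re h; rw [hsre] at this; simp at this; linarith
  have hs1 : s - 1 ≠ 0 := by
    intro h; have := congrArg Complex.re h; simp [hs] at this; linarith
  have i : ∀ f : ℝ → ℂ, Integrable f → Integrable fun v : ℝ => Complex.exp ((-2 * Real.pi * v * ξ : ℝ) * I) • f v := by
    intro f hf
    refine hf.mono (by have := hf.1; fun_prop) (ae_of_all _ fun v => ?_)
    rw [norm_smul, Complex.norm_exp_ofReal_mul_I, one_mul]
  rw [Real.fourier_real_eq_integral_exp_smul] at hM ⊢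
  unfold fT
  simp only [smul_sub]
  rw [integral_sub (i _ (int_tsum (fF_int hσ) (Z.fF_sum hσ) (Z.fF_cont hσ).aestronglyMeasurable))
    (i _ (fM_int hσ)), hM]
  have key := hasSum_integral_of_summable_integral_norm
    (F := fun n v => Complex.exp ((-2 * Real.pi * v * ξ : ℝ) * I) • fF Λ σ n v)
    (fun n => i _ (fF_int hσ n)) (by
      refine (Z.fF_sum hσ).congr fun n => ?_
      congr 1; funext v
      rw [norm_smul, Complex.norm_exp_ofReal_mul_I, one_mul])
  have e1 : ∀ n, ∫ v : ℝ, Complex.exp ((-2 * Real.pi * v * ξ : ℝ) * I) • fF Λ σ n v =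
      LSeries.term (fun n => (Λ n : ℂ)) s n / s ^ 5 := by
    intro n
    rcases eq_or_ne n 0 with rfl | hn
    · simp [fF, Z.L_zero]
    have hn0 : (n:ℂ) ≠ 0 := by exact_mod_cast hn
    rw [LSeries.term_of_ne_zero hn]
    rw [← integral_add_right_eq_self _ (Real.log n)]
    have e2 : ∀ v : ℝ, Complex.exp ((-2 * Real.pi * (v + Real.log n) * ξ : ℝ) * I) • fF Λ σ n (v + Real.log n) =
      ((Λ n : ℂ) * (n:ℂ) ^ (-s) / 24) * (Complex.exp ((-2 * Real.pi * v * ξ : ℝ) * I) • ek σ 4 v) := by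
      intro v
      have e3 : (n:ℂ) ^ (-s) = (((n:ℝ) ^ (-σ) : ℝ) : ℂ) * Complex.exp ((-2 * Real.pi * Real.log n * ξ : ℝ) * I) := by
        rw [Complex.ofReal_cpow (by positivity), show -s = ((-σ : ℝ):ℂ) + (-(2 * Real.pi * ξ : ℝ) * I) by rw [hs]; push_cast; ring,
          Complex.cpow_add _ _ hn0]
        simp only [ofReal_natCast]
        congr 1
        rw [Complex.cpow_def_of_ne_zero hn0, ← Complex.natCast_log]
        congr 1; push_cast; ring
      have e4 : Complex.exp ((-2 * Real.pi * (v + Real.log n) * ξ : ℝ) * I) =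
          Complex.exp ((-2 * Real.pi * Real.log n * ξ : ℝ) * I) * Complex.exp ((-2 * Real.pi * v * ξ : ℝ) * I) := by
        rw [← Complex.exp_add]; congr 1; push_cast; ring
      rw [e3, e4, fF, add_sub_cancel_right]
      simp only [smul_eq_mul]
      push_cast; ring
    simp only [e2]
    rw [integral_const_mul]
    have e5 := ek_fourier (σ := σ) (by linarith) 4 ξ
    rw [Real.fourier_real_eq_integral_exp_smul, ← hs] at e5
    rw [e5, Complex.cpow_neg]
    norm_num [Nat.factorial]
    field_simp
  have e6 : HasSum (fun n => LSeries.term (fun n => (Λ n : ℂ)) s n / s ^ 5) (LSeries (fun n => (Λ n : ℂ)) s / s ^ 5) :=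
    (Z.L_summable (by rw [hsre]; exact hσ)).LSeriesHasSum.div_const _
  simp only [e1] at key
  have e7 := key.unique e6
  have e8 : ∀ v : ℝ, Complex.exp ((-2 * Real.pi * v * ξ : ℝ) * I) • ∑' n, fF Λ σ n v =
      ∑' n, Complex.exp ((-2 * Real.pi * v * ξ : ℝ) * I) • fF Λ σ n v := fun v => (tsum_const_smul'' _).symm
  simp only [e8]
  rw [e7, Z.F_eq (by rw [hsre]; exact hσ)]
  field_simp
  ring

lemma fT_val {σ x : ℝ} (hx : 1 < x) : fT Λ σ (Real.log x) =
    ((x ^ (-σ) * (Wk Λ 4 x - x + ∑ j ∈ Finset.range 5, Real.log x ^ j / j.factorial) : ℝ) : ℂ) := by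
  have hl : 0 < Real.log x := Real.log_pos hx
  have e1 : fM σ (Real.log x) = ((x ^ (-σ) * (x - ∑ j ∈ Finset.range 5, Real.log x ^ j / j.factorial) : ℝ) : ℂ) := by
    have ex : x ^ (-σ) = Real.exp (-(σ * Real.log x)) := by
      rw [Real.rpow_def_of_pos (by linarith)]; congr 1; ring
    have ex1 : Real.exp (-((σ - 1) * Real.log x)) = x ^ (-σ) * x := by
      rw [ex]; nth_rewrite 3 [← Real.exp_log (by linarith : 0 < x)]
      rw [← Real.exp_add]; congr 1; ring
    simp only [fM, ek, if_pos hl]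
    rw [ex1, ← ex, mul_sub]
    push_cast
    rw [Finset.mul_sum]
    congr 1
    · simp
    · refine Finset.sum_congr rfl fun j _ => by ring
  have e2 : ∑' n, fF Λ σ n (Real.log x) = ((x ^ (-σ) * Wk Λ 4 x : ℝ) : ℂ) := by
    rw [tsum_eq_sum (s := Finset.Icc 1 ⌊x⌋₊)]
    · rw [Wk, Finset.mul_sum]; push_cast
      refine Finset.sum_congr rfl fun n hn => ?_
      rw [Finset.mem_Icc] at hn
      have hn1 : (1:ℝ) ≤ n := by exact_mod_cast hn.1
      have hnx : (n:ℝ) ≤ x := (Nat.le_floor_iff (by linarith)).1 hn.2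
      have e : Real.log x - Real.log n = Real.log (x / n) := by
        rw [Real.log_div (by linarith) (by linarith)]
      rw [fF, e]
      have e3 : ek σ 4 (Real.log (x / n)) = ((Real.log (x / n) ^ 4 * Real.exp (-(σ * Real.log (x / n))) : ℝ) : ℂ) := by
        unfold ek; split_ifs with h
        · rfl
        · have : Real.log (x / n) = 0 := le_antisymm (not_lt.1 h) (Real.log_nonneg (by rw [le_div_iff₀ (by linarith)]; linarith))
          rw [this]; simp
      have e4 : (n:ℝ) ^ (-σ) * Real.exp (-(σ * Real.log (x / n))) = x ^ (-σ) := by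
        rw [Real.rpow_def_of_pos (by linarith), Real.rpow_def_of_pos (by linarith), ← Real.exp_add, ← e]
        congr 1; ring
      rw [e3, ← e4]
      norm_num [Nat.factorial]
      ring
    · intro n hn
      rcases eq_or_ne n 0 with rfl | h0
      · simp [fF, Z.L_zero]
      · have : x < n := by
          rw [Finset.mem_Icc, not_and_or] at hn
          rcases hn with h | h
          · omega
          · exact Nat.lt_of_floor_lt (not_le.1 h)
        have : ¬ 0 < Real.log x - Real.log n := by
          rw [sub_pos, not_lt]; exact Real.log_le_log (by linarith) this.le
        simp [fF, ek, this]
  rw [fT, e1, e2, ← Complex.ofReal_sub]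
  congr 1; ring
end ZData

namespace Tau
open Filter Topology Complex MeasureTheory FourierTransform
lemma inv_bound {f : ℝ → ℂ} (hf : Integrable f) {K : ℝ} (hd : Differentiable ℝ (𝓕 f))
    (b0 : ∀ ξ, ‖𝓕 f ξ‖ ≤ K * (1 + ξ ^ 2)⁻¹) (b1 : ∀ ξ, ‖deriv (𝓕 f) ξ‖ ≤ K * (1 + ξ ^ 2)⁻¹)
    {v : ℝ} (hv : 0 < v) (hc : ContinuousAt f v) : 2 * Real.pi * v * ‖f v‖ ≤ K * Real.pi := by
  have hi : Integrable fun ξ : ℝ => K * (1 + ξ ^ 2)⁻¹ := integrable_inv_one_add_sq.const_mul K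
  have i0 : Integrable (𝓕 f) := hi.mono' hd.continuous.aestronglyMeasurable (ae_of_all _ b0)
  have i1 : Integrable (deriv (𝓕 f)) := hi.mono' (stronglyMeasurable_deriv _).aestronglyMeasurable (ae_of_all _ b1)
  have h1 := hf.fourierInv_fourier_eq i0 hc
  rw [Real.fourierInv_eq_fourier_neg] at h1
  have h2 := congrFun (Real.fourier_deriv i0 hd i1) (-v)
  simp only [h1] at h2
  have h3 : ‖𝓕 (deriv (𝓕 f)) (-v)‖ ≤ ∫ ξ, ‖deriv (𝓕 f) ξ‖ := by
    rw [Real.fourier_real_eq_integral_exp_smul]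
    refine (norm_integral_le_integral_norm _).trans (le_of_eq ?_)
    congr 1; funext ξ
    rw [norm_smul, Complex.norm_exp_ofReal_mul_I, one_mul]
  rw [h2, norm_smul] at h3
  have h4 : ‖(2 * Real.pi * I * ((-v : ℝ) : ℂ))‖ = 2 * Real.pi * v := by
    simp [abs_of_pos Real.pi_pos, abs_of_pos hv]
  rw [h4] at h3
  refine h3.trans ((integral_mono i1.norm hi b1).trans (le_of_eq ?_))
  rw [integral_const_mul, integral_univ_inv_one_add_sq]
end Tau

namespace ZData
open Filter Topology Complex MeasureTheory FourierTransform Tau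
variable {c Λ : ℕ → ℝ} {d : ℕ} {κ C δ : ℝ} (Z : ZData c Λ d κ C δ)
include Z

lemma fT_bound {P τ : ℝ} (hP : 1 ≤ P) (hd : (d:ℝ) ≤ P) (hδP : 1 / δ ≤ P) (hCP : Real.log C ≤ P)
    (hτ : 0 < τ) (hτ1 : τ ≤ 1) (hno : ∀ β : ℝ, 1 - τ < β → β ≤ 1 → zH c κ β ≠ 0)
    {σ v : ℝ} (hσ : 1 < σ) (hσ2 : σ ≤ 2) (hv : 0 < v) :
    v * ‖fT Λ σ v‖ ≤ 2000 * (128 * (40000000 * P ^ 4 / τ) ^ 3) := by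
  set B : ℝ := 128 * (40000000 * P ^ 4 / τ) ^ 3 with hB
  have hB0 : 0 ≤ B := by positivity
  have hpi := Real.pi_pos
  set sf : ℝ → ℂ := fun ξ => (σ : ℂ) + (2 * Real.pi * ξ : ℝ) * I with hsf
  set G : ℂ → ℂ := fun s => deriv (zH c κ) s / zH c κ s with hG
  have hre : ∀ ξ, (sf ξ).re = σ := fun ξ => by simp [hsf]
  have hs0 : ∀ ξ, sf ξ ≠ 0 := fun ξ h => by
    have := congrArg Complex.re h; rw [hre] at this; simp at this; linarith
  have hsd : ∀ ξ, HasDerivAt sf (2 * Real.pi * I) ξ := fun ξ => by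
    have h1 : HasDerivAt (fun ξ : ℝ => ((2 * Real.pi * ξ : ℝ) : ℂ)) ((2 * Real.pi * 1 : ℝ) : ℂ) ξ :=
      ((hasDerivAt_id ξ).const_mul (2 * Real.pi)).ofReal_comp
    have := (h1.mul_const I).const_add (σ : ℂ)
    refine this.congr_deriv ?_
    push_cast; ring
  have hGd : ∀ ξ, HasDerivAt G (deriv G (sf ξ)) (sf ξ) := fun ξ => by
    have hδ := Z.δ_pos
    have ha : AnalyticAt ℂ (zH c κ) (sf ξ) := Z.H_analytic (by rw [hre]; linarith)
    exact (ha.deriv.div ha (Z.H_ne_zero (by rw [hre]; exact hσ))).differentiableAt.hasDerivAt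
  have hF : 𝓕 (fT Λ σ) = fun ξ => -(G (sf ξ)) / sf ξ ^ 5 := funext fun ξ => Z.fT_fourier hσ ξ
  have hdg : ∀ ξ, HasDerivAt (fun ξ => -(G (sf ξ)) / sf ξ ^ 5)
      (2 * Real.pi * I * (-(deriv G (sf ξ)) / sf ξ ^ 5 + 5 * G (sf ξ) / sf ξ ^ 6)) ξ := fun ξ => by
    have h1 : HasDerivAt (fun s => -(G s) / s ^ 5) (-(deriv G (sf ξ)) / sf ξ ^ 5 + 5 * G (sf ξ) / sf ξ ^ 6) (sf ξ) := by
      refine ((hGd ξ).fun_neg.fun_div (hasDerivAt_pow 5 _) (pow_ne_zero _ (hs0 ξ))).congr_deriv ?_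
      have := hs0 ξ
      field_simp
      push_cast; ring
    have := h1.comp ξ (hsd ξ)
    exact this.congr_deriv (by ring)
  have hb : ∀ ξ, ‖G (sf ξ)‖ ≤ B * (2 + |2 * Real.pi * ξ|) ^ 3 ∧ ‖deriv G (sf ξ)‖ ≤ B * (2 + |2 * Real.pi * ξ|) ^ 3 :=
    fun ξ => Z.G_bound hP hd hδP hCP hτ hτ1 hno hσ hσ2
  have hn : ∀ ξ, 1 ≤ ‖sf ξ‖ ∧ 2 + |2 * Real.pi * ξ| ≤ 3 * ‖sf ξ‖ ∧ 1 + ξ ^ 2 ≤ ‖sf ξ‖ ^ 2 := fun ξ => by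
    have h1 : σ ≤ ‖sf ξ‖ := by have := Complex.re_le_norm (sf ξ); rwa [hre] at this
    have h2 : |2 * Real.pi * ξ| ≤ ‖sf ξ‖ := by
      have := Complex.abs_im_le_norm (sf ξ); simpa [hsf] using this
    refine ⟨by linarith, by linarith, ?_⟩
    rw [← Complex.normSq_eq_norm_sq, Complex.normSq_apply, hre]
    have : (sf ξ).im = 2 * Real.pi * ξ := by simp [hsf]
    rw [this]
    have : 1 ≤ (2 * Real.pi) ^ 2 := by nlinarith [Real.pi_gt_three]
    nlinarith [sq_nonneg ξ]
  have kb : ∀ ξ, B * (2 + |2 * Real.pi * ξ|) ^ 3 / ‖sf ξ‖ ^ 5 ≤ 27 * B * (1 + ξ ^ 2)⁻¹ := fun ξ => by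
    obtain ⟨h1, h2, h3⟩ := hn ξ
    have h0 : 0 < ‖sf ξ‖ := by linarith
    have hp : 0 < 1 + ξ ^ 2 := by positivity
    calc _ ≤ B * (3 * ‖sf ξ‖) ^ 3 / ‖sf ξ‖ ^ 5 := by gcongr
      _ = 27 * B * (‖sf ξ‖ ^ 2)⁻¹ := by field_simp; ring
      _ ≤ _ := by gcongr
  have c0 : ∀ ξ, ‖-(G (sf ξ)) / sf ξ ^ 5‖ ≤ 27 * B * (1 + ξ ^ 2)⁻¹ := fun ξ => by
    refine le_trans ?_ (kb ξ)
    rw [norm_div, norm_neg, norm_pow]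
    gcongr; exact (hb ξ).1
  have c1 : ∀ ξ, ‖2 * Real.pi * I * (-(deriv G (sf ξ)) / sf ξ ^ 5 + 5 * G (sf ξ) / sf ξ ^ 6)‖ ≤
      324 * Real.pi * B * (1 + ξ ^ 2)⁻¹ := fun ξ => by
    have e1 : ‖-(deriv G (sf ξ)) / sf ξ ^ 5‖ ≤ 27 * B * (1 + ξ ^ 2)⁻¹ := by
      refine le_trans ?_ (kb ξ)
      rw [norm_div, norm_neg, norm_pow]
      gcongr; exact (hb ξ).2
    have e2 : ‖5 * G (sf ξ) / sf ξ ^ 6‖ ≤ 5 * (27 * B * (1 + ξ ^ 2)⁻¹) := by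
      refine le_trans ?_ (mul_le_mul_of_nonneg_left (c0 ξ) (by norm_num))
      have e4 : ‖-(G (sf ξ)) / sf ξ ^ 5‖ = ‖G (sf ξ)‖ / ‖sf ξ‖ ^ 5 := by rw [norm_div, norm_neg, norm_pow]
      rw [e4, norm_div, norm_mul, norm_pow, Complex.norm_ofNat, mul_div_assoc]
      gcongr
      · exact pow_pos (by linarith [(hn ξ).1]) _
      · exact (hn ξ).1
      · norm_num
    have e3 : ‖(2 * Real.pi * I : ℂ)‖ = 2 * Real.pi := by simp [abs_of_pos hpi]
    rw [norm_mul, e3]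
    have := (norm_add_le _ _).trans (add_le_add e1 e2)
    calc _ ≤ 2 * Real.pi * (27 * B * (1 + ξ ^ 2)⁻¹ + 5 * (27 * B * (1 + ξ ^ 2)⁻¹)) := by gcongr
      _ = _ := by ring
  have hcont : ContinuousAt (fT Λ σ) v := by
    refine (Z.fF_cont hσ).continuousAt.sub ?_
    unfold fM
    refine (ek_contAt _ _ hv).sub ?_
    exact tendsto_finsetSum _ fun j _ => (continuousAt_const.mul (ek_contAt _ _ hv))
  have key := inv_bound (K := 324 * Real.pi * B) (Z.fT_int hσ) (by rw [hF]; exact fun ξ => (hdg ξ).differentiableAt)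
    (fun ξ => by
      rw [hF]; refine (c0 ξ).trans ?_
      have : 27 ≤ 324 * Real.pi := by nlinarith [Real.pi_gt_three]
      gcongr)
    (fun ξ => by rw [hF, (hdg ξ).deriv]; exact c1 ξ) hv hcont
  have h5 : v * ‖fT Λ σ v‖ * (2 * Real.pi) ≤ (162 * Real.pi * B) * (2 * Real.pi) := by nlinarith
  have h6 := le_of_mul_le_mul_right h5 (by positivity)
  have := Real.pi_lt_four
  nlinarith

lemma W4_bound {P τ : ℝ} (hP : 1 ≤ P) (hd : (d:ℝ) ≤ P) (hδP : 1 / δ ≤ P) (hCP : Real.log C ≤ P)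
    (hτ : 0 < τ) (hτ1 : τ ≤ 1) (hno : ∀ β : ℝ, 1 - τ < β → β ≤ 1 → zH c κ β ≠ 0)
    {x : ℝ} (hx : Real.exp 1 ≤ x) :
    |Wk Λ 4 x - x| ≤ 7000 * (128 * (40000000 * P ^ 4 / τ) ^ 3) * x / Real.log x := by
  have hx0 : 0 < x := (Real.exp_pos 1).trans_le hx
  have hl : 1 ≤ Real.log x := by rwa [Real.le_log_iff_exp_le hx0]
  have hx1 : 1 < x := by linarith [Real.add_one_le_exp 1]
  set L := Real.log x with hL
  have hσ : 1 < 1 + 1 / L := by have : 0 < 1 / L := by positivity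
                                linarith
  have hσ2 : 1 + 1 / L ≤ 2 := by have : 1 / L ≤ 1 := by rw [div_le_one (by linarith)]; exact hl
                                 linarith
  have h := Z.fT_bound hP hd hδP hCP hτ hτ1 hno hσ hσ2 (by linarith : 0 < L)
  set B : ℝ := 128 * (40000000 * P ^ 4 / τ) ^ 3 with hB
  have hB1 : 1 ≤ B := by
    have : 1 ≤ 40000000 * P ^ 4 / τ := by
      rw [one_le_div hτ]; have := one_le_pow₀ hP (n := 4); linarith
    have := one_le_pow₀ this (n := 3); linarith
  rw [hL, Z.fT_val hx1, Complex.norm_real, Real.norm_eq_abs, abs_mul, abs_of_pos (by positivity), ← hL] at h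
  have e1 : x ^ (-(1 + 1 / L)) = Real.exp (-1) / x := by
    rw [Real.rpow_def_of_pos hx0, ← hL, show L * -(1 + 1 / L) = -1 - L by field_simp; ring, Real.exp_sub, hL, Real.exp_log hx0]
  rw [e1, Real.exp_neg] at h
  have h2 : L * |Wk Λ 4 x - x + ∑ j ∈ Finset.range 5, L ^ j / j.factorial| ≤ 6000 * B * x := by
    have he := Real.exp_one_lt_d9
    have he0 := Real.exp_pos 1
    have h3 : L * |Wk Λ 4 x - x + ∑ j ∈ Finset.range 5, L ^ j / j.factorial| =
      (L * ((Real.exp 1)⁻¹ / x * |Wk Λ 4 x - x + ∑ j ∈ Finset.range 5, L ^ j / j.factorial|)) * (Real.exp 1 * x) := by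
      field_simp
    rw [h3]
    calc _ ≤ 2000 * B * (3 * x) := by gcongr; linarith
      _ = _ := by ring
  have h4 : L * ∑ j ∈ Finset.range 5, L ^ j / j.factorial ≤ 200 * B * x := by
    have h5 := Real.pow_div_factorial_le_exp L (by linarith) 
    have e2 : Real.exp L = x := Real.exp_log hx0
    have q1 := h5 1; have q2 := h5 2; have q3 := h5 3; have q4 := h5 4; have q5 := h5 5
    rw [e2] at q1 q2 q3 q4 q5
    simp only [Finset.sum_range_succ, Finset.sum_range_zero, Nat.factorial] at *
    norm_num at *
    nlinarith
  have h6 : 0 ≤ ∑ j ∈ Finset.range 5, L ^ j / j.factorial := Finset.sum_nonneg fun j _ => by positivity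
  rw [le_div_iff₀ (by linarith), mul_comm]
  have h7 : |Wk Λ 4 x - x| ≤ |Wk Λ 4 x - x + ∑ j ∈ Finset.range 5, L ^ j / j.factorial| + ∑ j ∈ Finset.range 5, L ^ j / j.factorial := by
    rw [abs_le]; constructor
    · linarith [neg_abs_le (Wk Λ 4 x - x + ∑ j ∈ Finset.range 5, L ^ j / j.factorial)]
    · linarith [le_abs_self (Wk Λ 4 x - x + ∑ j ∈ Finset.range 5, L ^ j / j.factorial)]
  calc _ ≤ L * (|Wk Λ 4 x - x + ∑ j ∈ Finset.range 5, L ^ j / j.factorial| + ∑ j ∈ Finset.range 5, L ^ j / j.factorial) := by gcongr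
    _ ≤ _ := by rw [mul_add]; nlinarith
end ZData

namespace ZData
open Finset

lemma pow_lo {u h : ℝ} (hu : 0 ≤ u) (hh : 0 ≤ h) (k : ℕ) : u ^ (k + 1) + (k + 1) * h * u ^ k ≤ (u + h) ^ (k + 1) := by
  induction k with
  | zero => simp
  | succ k ih =>
    have : 0 ≤ (k + 1) * h * u ^ k * h := by positivity
    calc _ ≤ (u ^ (k + 1) + (k + 1) * h * u ^ k) * (u + h) := by push_cast; ring_nf at this ⊢; linarith
      _ ≤ (u + h) ^ (k + 1) * (u + h) := by gcongr
      _ = _ := by ring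

lemma pow_hi {u h : ℝ} (hh : 0 ≤ h) (hu : h ≤ u) (k : ℕ) : u ^ (k + 1) ≤ (u - h) ^ (k + 1) + (k + 1) * h * u ^ k := by
  induction k with
  | zero => simp
  | succ k ih =>
    have h1 : (u - h) ^ (k + 1) ≤ u ^ (k + 1) := pow_le_pow_left₀ (by linarith) (by linarith) _
    have h2 := mul_le_mul_of_nonneg_right ih (by linarith : (0:ℝ) ≤ u)
    have h3 := mul_le_mul_of_nonneg_left h1 hh
    push_cast
    ring_nf at h2 h3 ⊢
    linarith

lemma Wk_up {Λ : ℕ → ℝ} (hΛ : ∀ n, 0 ≤ Λ n) (k : ℕ) {x h : ℝ} (hx : 0 < x) (hh : 0 ≤ h) :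
    h * Wk Λ k x ≤ Wk Λ (k + 1) (x * Real.exp h) - Wk Λ (k + 1) x := by
  have he : 1 ≤ Real.exp h := Real.one_le_exp hh
  have hxx : x ≤ x * Real.exp h := le_mul_of_one_le_right hx.le he
  have hsub : Icc 1 ⌊x⌋₊ ⊆ Icc 1 ⌊x * Real.exp h⌋₊ := Icc_subset_Icc_right (Nat.floor_le_floor hxx)
  have h1 : ∑ n ∈ Icc 1 ⌊x⌋₊, Λ n * (Real.log (x * Real.exp h / n) ^ (k + 1) / (k + 1).factorial) ≤ Wk Λ (k + 1) (x * Real.exp h) := by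
    refine sum_le_sum_of_subset_of_nonneg hsub fun n hn _ => ?_
    rw [mem_Icc] at hn
    have hn1 : (1:ℝ) ≤ n := by exact_mod_cast hn.1
    have hnx : (n:ℝ) ≤ x * Real.exp h := (Nat.le_floor_iff (by positivity)).1 hn.2
    have : 0 ≤ Real.log (x * Real.exp h / n) := Real.log_nonneg (by rw [le_div_iff₀ (by linarith)]; linarith)
    have := hΛ n
    positivity
  refine le_trans ?_ (sub_le_sub_right h1 _)
  unfold Wk
  rw [mul_sum, ← sum_sub_distrib]
  refine sum_le_sum fun n hn => ?_
  rw [mem_Icc] at hn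
  have hn1 : (1:ℝ) ≤ n := by exact_mod_cast hn.1
  have hnx : (n:ℝ) ≤ x := (Nat.le_floor_iff hx.le).1 hn.2
  have hu : 0 ≤ Real.log (x / n) := Real.log_nonneg (by rw [le_div_iff₀ (by linarith)]; linarith)
  have e : Real.log (x * Real.exp h / n) = Real.log (x / n) + h := by
    rw [mul_div_right_comm, Real.log_mul (by positivity) (by positivity), Real.log_exp]
  rw [e, ← mul_sub, mul_left_comm]
  refine mul_le_mul_of_nonneg_left ?_ (hΛ n)
  have := pow_lo hu hh k
  rw [← sub_div, le_div_iff₀ (by positivity), Nat.factorial_succ]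
  push_cast
  have hf : (k.factorial : ℝ) ≠ 0 := by positivity
  field_simp
  linarith

lemma Wk_dn {Λ : ℕ → ℝ} (hΛ : ∀ n, 0 ≤ Λ n) (k : ℕ) {x h : ℝ} (hx : 0 < x) (hh : 0 ≤ h) :
    Wk Λ (k + 1) x - Wk Λ (k + 1) (x * Real.exp (-h)) ≤ h * Wk Λ k x := by
  have he : Real.exp (-h) ≤ 1 := by simpa using hh
  have hxx : x * Real.exp (-h) ≤ x := mul_le_of_le_one_right hx.le he
  have hsub : Icc 1 ⌊x * Real.exp (-h)⌋₊ ⊆ Icc 1 ⌊x⌋₊ := Icc_subset_Icc_right (Nat.floor_le_floor hxx)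
  unfold Wk
  rw [← sum_sdiff hsub, mul_sum, ← sum_sdiff hsub, add_sub_assoc, ← sum_sub_distrib]
  have hf : (0:ℝ) < k.factorial := by positivity
  refine add_le_add (sum_le_sum fun n hn => ?_) (sum_le_sum fun n hn => ?_)
  · rw [mem_sdiff, mem_Icc, mem_Icc, not_and] at hn
    have hn1 : (1:ℝ) ≤ n := by exact_mod_cast hn.1.1
    have hnx : (n:ℝ) ≤ x := (Nat.le_floor_iff hx.le).1 hn.1.2
    have hu : 0 ≤ Real.log (x / n) := Real.log_nonneg (by rw [le_div_iff₀ (by linarith)]; linarith)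
    have hlt : x * Real.exp (-h) < n := Nat.lt_of_floor_lt (not_le.1 (hn.2 hn.1.1))
    have huh : Real.log (x / n) ≤ h := by
      rw [Real.log_le_iff_le_exp (by positivity), div_le_iff₀ (by linarith)]
      rw [Real.exp_neg, ← div_eq_mul_inv, div_lt_iff₀ (Real.exp_pos _)] at hlt
      linarith
    rw [mul_left_comm]
    refine mul_le_mul_of_nonneg_left ?_ (hΛ n)
    rw [Nat.factorial_succ, pow_succ, div_le_iff₀ (by positivity)]
    push_cast
    have : Real.log (x / n) ^ k * Real.log (x / n) ≤ Real.log (x / n) ^ k * h := by gcongr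
    have h2 : 0 ≤ Real.log (x / n) ^ k * h * k := by positivity
    field_simp
    nlinarith
  · rw [mem_Icc] at hn
    have hn1 : (1:ℝ) ≤ n := by exact_mod_cast hn.1
    have hnx : (n:ℝ) ≤ x * Real.exp (-h) := (Nat.le_floor_iff (by positivity)).1 hn.2
    have e : Real.log (x * Real.exp (-h) / n) = Real.log (x / n) - h := by
      rw [mul_div_right_comm, Real.log_mul (by positivity) (by positivity), Real.log_exp]; ring
    have hu : h ≤ Real.log (x / n) := by
      rw [← sub_nonneg, ← e]
      exact Real.log_nonneg (by rw [le_div_iff₀ (by linarith)]; linarith)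
    rw [e, ← mul_sub, mul_left_comm]
    refine mul_le_mul_of_nonneg_left ?_ (hΛ n)
    have := pow_hi hh hu k
    rw [← sub_div, div_le_iff₀ (by positivity), Nat.factorial_succ]
    push_cast
    field_simp
    linarith

lemma Wk_step {Λ : ℕ → ℝ} (hΛ : ∀ n, 0 ≤ Λ n) (k : ℕ) {Y h : ℝ} (hY : 0 < Y) (hh : 0 < h) (hh1 : h ≤ 1)
    (H : ∀ y, Y ≤ y → |Wk Λ (k + 1) y - y| ≤ h ^ 2 * y) {x : ℝ} (hx : Real.exp 1 * Y ≤ x) :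
    |Wk Λ k x - x| ≤ 5 * h * x := by
  have hx0 : 0 < x := lt_of_lt_of_le (by positivity) hx
  have hYx : Y ≤ x := le_trans (by nlinarith [Real.add_one_le_exp 1]) hx
  have b1 := Real.abs_exp_sub_one_sub_id_le (x := h) (by rw [abs_of_pos hh]; exact hh1)
  have b2 := Real.abs_exp_sub_one_sub_id_le (x := -h) (by rw [abs_neg, abs_of_pos hh]; exact hh1)
  rw [abs_le] at b1 b2
  have c1 := abs_le.1 (H x hYx)
  have c2 := abs_le.1 (H (x * Real.exp h) (hYx.trans (le_mul_of_one_le_right hx0.le (Real.one_le_exp hh.le))))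
  have c3 := abs_le.1 (H (x * Real.exp (-h)) (by
    have : Real.exp (-1) ≤ Real.exp (-h) := Real.exp_le_exp.2 (by linarith)
    calc Y = Real.exp 1 * Y * Real.exp (-1) := by rw [mul_right_comm, ← Real.exp_add]; simp
      _ ≤ _ := by gcongr))
  have u := Wk_up hΛ k hx0 hh.le
  have l := Wk_dn hΛ k hx0 hh.le
  set E := Real.exp h
  set F := Real.exp (-h)
  have hE3 : E ≤ 3 := by nlinarith
  have hF1 : F ≤ 1 := by simpa [F] using hh.le
  have hh2 : 0 < h ^ 2 := by positivity
  rw [abs_le]; constructor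
  · have : h * (x - 5 * h * x) ≤ h * Wk Λ k x := by
      refine le_trans ?_ l
      have : h ^ 2 * (x * F) ≤ h ^ 2 * (x * 1) := by gcongr
      have : x * F ≤ x * (1 - h + h ^ 2) := by gcongr; nlinarith
      nlinarith
    linarith [le_of_mul_le_mul_left this hh]
  · have : h * Wk Λ k x ≤ h * (x + 5 * h * x) := by
      refine u.trans ?_
      have : h ^ 2 * (x * E) ≤ h ^ 2 * (x * 3) := by gcongr
      have : x * E ≤ x * (1 + h + h ^ 2) := by gcongr; nlinarith
      nlinarith
    linarith [le_of_mul_le_mul_left this hh]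

variable {c Λ : ℕ → ℝ} {d : ℕ} {κ C δ : ℝ} (Z : ZData c Λ d κ C δ)
include Z

lemma psi_bound {P τ η : ℝ} (hP : 1 ≤ P) (hd : (d:ℝ) ≤ P) (hδP : 1 / δ ≤ P) (hCP : Real.log C ≤ P)
    (hτ : 0 < τ) (hτ1 : τ ≤ 1) (hno : ∀ β : ℝ, 1 - τ < β → β ≤ 1 → zH c κ β ≠ 0)
    {x : ℝ} (hx : Real.exp 10 ≤ x) (hη : 0 < η) (hη5 : η ≤ 1 / 5)
    (hB : 14000 * (128 * (40000000 * P ^ 4 / τ) ^ 3) ≤ η ^ 16 * Real.log x) :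
    |∑ n ∈ Icc 1 ⌊x⌋₊, Λ n - x| ≤ 25 * η * x := by
  have hx0 : 0 < x := (Real.exp_pos _).trans_le hx
  have hl : 10 ≤ Real.log x := by rwa [Real.le_log_iff_exp_le hx0]
  set B : ℝ := 128 * (40000000 * P ^ 4 / τ) ^ 3
  set Y := x * Real.exp (-4) with hY
  have hY0 : 0 < Y := by positivity
  have hlY : Real.log Y = Real.log x - 4 := by rw [hY, Real.log_mul hx0.ne' (Real.exp_pos _).ne', Real.log_exp]; ring
  have hΛ := Z.L_nonneg
  have s4 : ∀ y, Y ≤ y → |Wk Λ 4 y - y| ≤ (η ^ 8) ^ 2 * y := by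
    intro y hy
    have hy0 : 0 < y := hY0.trans_le hy
    have hly : Real.log x / 2 ≤ Real.log y := by have := Real.log_le_log hY0 hy; linarith
    refine (Z.W4_bound hP hd hδP hCP hτ hτ1 hno (x := y) ?_).trans ?_
    · rw [← Real.le_log_iff_exp_le hy0]; linarith
    · rw [div_le_iff₀ (by linarith)]
      have h1 : η ^ 16 * (Real.log x / 2) ≤ η ^ 16 * Real.log y := by gcongr
      have h2 : 7000 * B ≤ η ^ 16 * Real.log y := by linarith
      calc 7000 * B * y ≤ η ^ 16 * Real.log y * y := by gcongr
        _ = _ := by ring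
  have p1 : ∀ n : ℕ, η ^ n ≤ 1 := fun n => pow_le_one₀ hη.le (by linarith)
  have s3 : ∀ y, Real.exp 1 * Y ≤ y → |Wk Λ 3 y - y| ≤ (5 * η ^ 4) ^ 2 * y := by
    intro y hy
    have hy0 : 0 < y := lt_of_lt_of_le (by positivity) hy
    refine (Wk_step hΛ 3 hY0 (by positivity) (p1 8) s4 hy).trans ?_
    gcongr
    nlinarith [pow_pos hη 8]
  have s2 : ∀ y, Real.exp 1 * (Real.exp 1 * Y) ≤ y → |Wk Λ 2 y - y| ≤ (5 * η ^ 2) ^ 2 * y := by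
    intro y hy
    have : 5 * η ^ 4 ≤ 1 := by nlinarith [p1 3, pow_pos hη 3]
    refine (Wk_step hΛ 2 (by positivity) (by positivity) this s3 hy).trans (le_of_eq (by ring))
  have s1 : ∀ y, Real.exp 1 * (Real.exp 1 * (Real.exp 1 * Y)) ≤ y → |Wk Λ 1 y - y| ≤ (5 * η) ^ 2 * y := by
    intro y hy
    have : 5 * η ^ 2 ≤ 1 := by nlinarith
    refine (Wk_step hΛ 1 (by positivity) (by positivity) this s2 hy).trans (le_of_eq (by ring))
  have s0 := Wk_step hΛ 0 (by positivity) (by positivity : 0 < 5 * η) (by linarith) s1 (x := x) (by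
    rw [hY, ← mul_assoc, ← mul_assoc, ← mul_assoc, ← Real.exp_add, ← Real.exp_add, ← Real.exp_add, mul_comm, mul_assoc, ← Real.exp_add]
    norm_num)
  simp only [Wk, pow_zero, Nat.factorial_zero, Nat.cast_one, div_one, mul_one] at s0
  refine s0.trans (le_of_eq (by ring))
end ZData

set_option linter.unusedSectionVars false
namespace Lat
open MeasureTheory Metric Module
open scoped Pointwise

variable {E : Type*} [NormedAddCommGroup E] [NormedSpace ℝ E] [FiniteDimensional ℝ E] [MeasurableSpace E]
  [BorelSpace E] (L : Submodule ℤ E) [DiscreteTopology L] [IsZLattice ℝ L] (μ : Measure E) [μ.IsAddHaarMeasure]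

noncomputable def cnt (y : E) (r : ℝ) : ℕ := ((L : Set E) ∩ closedBall y r).ncard

lemma cnt_fin (y : E) (r : ℝ) : ((L : Set E) ∩ closedBall y r).Finite := by
  have := FiniteDimensional.proper ℝ E
  rw [Set.inter_comm]
  refine Metric.finite_isBounded_inter_isClosed DiscreteTopology.isDiscrete isBounded_closedBall ?_
  have : DiscreteTopology L.toAddSubgroup := inferInstanceAs (DiscreteTopology L)
  rw [← Submodule.coe_toAddSubgroup]
  exact AddSubgroup.isClosed_of_discrete

lemma avg (r : ℝ) : ∃ F : Set E, MeasurableSet F ∧ ZLattice.covolume L μ = μ.real F ∧ μ F ≠ ⊤ ∧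
    μ (closedBall 0 r) = ∫⁻ y in F, (cnt L y r : ENNReal) ∂μ := by
  have : Module.Finite ℤ L := ZLattice.module_finite ℝ L
  have : Module.Free ℤ L := ZLattice.module_free ℝ L
  let b := Module.Free.chooseBasis ℤ L
  have hF := ZLattice.isAddFundamentalDomain b μ
  refine ⟨_, ZSpan.fundamentalDomain_measurableSet _, ZLattice.covolume_eq_measure_fundamentalDomain L μ hF,
    (ZSpan.fundamentalDomain_isBounded _).measure_lt_top.ne, ?_⟩
  set F := ZSpan.fundamentalDomain (b.ofZLatticeBasis ℝ L)
  have : Countable L := inferInstance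
  have : VAddInvariantMeasure L E μ := inferInstanceAs (VAddInvariantMeasure L.toAddSubgroup E μ)
  rw [hF.measure_eq_tsum]
  have e1 : ∀ g : L, μ ((g +ᵥ closedBall (0:E) r) ∩ F) = ∫⁻ y in F, (closedBall (g:E) r).indicator 1 y ∂μ := by
    intro g
    rw [lintegral_indicator_one measurableSet_closedBall, Measure.restrict_apply measurableSet_closedBall]
    congr 2
    ext y
    rw [Set.mem_vadd_set_iff_neg_vadd_mem]
    simp [mem_closedBall, Submodule.vadd_def, dist_eq_norm, sub_eq_neg_add]
  simp only [e1]
  rw [← lintegral_tsum fun g => (measurable_one.indicator measurableSet_closedBall).aemeasurable]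
  congr 1; funext y
  have e2 : ∀ g : L, (closedBall (g:E) r).indicator (1 : E → ENNReal) y = ({g : L | (g:E) ∈ closedBall y r}).indicator 1 g := by
    intro g; simp [Set.indicator_apply, mem_closedBall, dist_comm]
  simp only [e2]
  rw [← tsum_subtype ({g : L | (g:E) ∈ closedBall y r}) (1 : L → ENNReal)]
  simp only [Pi.one_apply]
  rw [ENNReal.tsum_set_one, cnt]
  have e3 : (L : Set E) ∩ closedBall y r = Subtype.val '' ({g : L | (g:E) ∈ closedBall y r}) := by
    ext z; simp; tauto
  have hfin := cnt_fin L y r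
  rw [e3] at hfin ⊢
  rw [Set.ncard_image_of_injective _ Subtype.val_injective]
  rw [← (hfin.of_finite_image Subtype.val_injective.injOn).cast_ncard_eq]
  simp

lemma vol_ball {r : ℝ} (hr : 0 ≤ r) : μ.real (closedBall (0:E) r) = r ^ finrank ℝ E * μ.real (ball (0:E) 1) := by
  rw [measureReal_def, Measure.addHaar_closedBall μ 0 hr, ENNReal.toReal_mul, ENNReal.toReal_ofReal (by positivity)]
  rfl

lemma avg_le {r : ℝ} {n : ℕ} (h : ∀ y, cnt L y r ≤ n) : μ.real (closedBall (0:E) r) ≤ n * ZLattice.covolume L μ := by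
  obtain ⟨F, hF, hc, ht, h1⟩ := avg L μ r
  rw [hc, measureReal_def, measureReal_def, h1, ← ENNReal.toReal_natCast, ← ENNReal.toReal_mul]
  refine ENNReal.toReal_mono (ENNReal.mul_ne_top (by simp) ht) ?_
  rw [← setLIntegral_const]
  exact lintegral_mono fun y => Nat.cast_le.2 (h y)

lemma avg_ge {r : ℝ} {n : ℕ} (h : ∀ y, n ≤ cnt L y r) : n * ZLattice.covolume L μ ≤ μ.real (closedBall (0:E) r) := by
  obtain ⟨F, hF, hc, ht, h1⟩ := avg L μ r
  rw [hc, measureReal_def, measureReal_def, ← ENNReal.toReal_natCast, ← ENNReal.toReal_mul]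
  refine ENNReal.toReal_mono measure_closedBall_lt_top.ne ?_
  rw [h1, ← setLIntegral_const]
  exact lintegral_mono fun y => Nat.cast_le.2 (h y)

variable {L} in
lemma cnt_mono {y z : E} {r R : ℝ} (hR : ∀ z : E, ∃ l ∈ L, ‖z - l‖ ≤ R) : cnt L y r ≤ cnt L z (r + R) := by
  obtain ⟨l, hl, h⟩ := hR (z - y)
  unfold cnt
  rw [← Set.ncard_image_of_injective _ (add_right_injective l)]
  refine Set.ncard_le_ncard ?_ (cnt_fin L _ _)
  rintro _ ⟨u, ⟨hu, hu2⟩, rfl⟩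
  refine ⟨L.add_mem hl hu, ?_⟩
  rw [mem_closedBall, dist_eq_norm] at hu2 ⊢
  have : l + u - z = (u - y) - (z - y - l) := by abel
  simp only [this]
  exact (norm_sub_le _ _).trans (add_le_add hu2 h)

variable {L} in
lemma cnt_upper {R r : ℝ} (hR : ∀ z : E, ∃ l ∈ L, ‖z - l‖ ≤ R) (h0 : 0 ≤ r + R) (y : E) :
    cnt L y r * ZLattice.covolume L μ ≤ (r + R) ^ finrank ℝ E * μ.real (ball (0:E) 1) := by
  rw [← vol_ball μ h0]
  exact avg_ge L μ fun z => cnt_mono hR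

variable {L} in
lemma cnt_lower {R r : ℝ} (hR : ∀ z : E, ∃ l ∈ L, ‖z - l‖ ≤ R) (h0 : R ≤ r) (y : E) :
    (r - R) ^ finrank ℝ E * μ.real (ball (0:E) 1) ≤ cnt L y r * ZLattice.covolume L μ := by
  rw [← vol_ball μ (by linarith : 0 ≤ r - R)]
  refine avg_le L μ fun z => ?_
  have := cnt_mono (y := z) (z := y) (r := r - R) hR
  rwa [sub_add_cancel] at this

lemma exists_short {s : ℝ} (hs : 0 ≤ s) (h : ZLattice.covolume L μ < s ^ finrank ℝ E * μ.real (ball (0:E) 1)) :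
    ∃ l ∈ L, l ≠ 0 ∧ ‖l‖ ≤ 2 * s := by
  by_contra! hc
  rw [← vol_ball μ hs] at h
  refine absurd (avg_le L μ (r := s) (n := 1) fun y => ?_) (by simpa using h)
  rw [cnt, Set.ncard_le_one (cnt_fin L y s)]
  intro a ha b hb
  by_contra hab
  have := hc (a - b) (L.sub_mem ha.1 hb.1) (sub_ne_zero.2 hab)
  have h1 := ha.2; have h2 := hb.2
  rw [mem_closedBall] at h1 h2
  have h3 := dist_triangle_right a b y
  rw [dist_eq_norm] at h3
  linarith

variable {L} in
lemma covol_le {R : ℝ} (h0 : 0 ≤ R) (hR : ∀ z : E, ∃ l ∈ L, ‖z - l‖ ≤ R) :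
    ZLattice.covolume L μ ≤ R ^ finrank ℝ E * μ.real (ball (0:E) 1) := by
  rw [← vol_ball μ h0]
  have := avg_ge L μ (r := R) (n := 1) fun y => by
    obtain ⟨l, hl, h⟩ := hR y
    rw [cnt, Nat.one_le_iff_ne_zero, ← Nat.pos_iff_ne_zero, Set.ncard_pos (cnt_fin L y R)]
    exact ⟨l, hl, by rwa [mem_closedBall, dist_comm, dist_eq_norm]⟩
  simpa using this
end Lat

namespace NF
open NumberField nonZeroDivisors Module MeasureTheory Lat

variable (K : Type*) [Field K] [NumberField K]

noncomputable def nm (c : (Ideal (𝓞 K))⁰) : ℝ := Ideal.absNorm (c : Ideal (𝓞 K))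
noncomputable abbrev LL (c : (Ideal (𝓞 K))⁰) := mixedEmbedding.idealLattice K (FractionalIdeal.mk0 K c)⁻¹
noncomputable def V0 : ℝ := volume.real (Metric.ball (0 : mixedEmbedding.mixedSpace K) 1)
noncomputable def D0 : ℝ := ZLattice.covolume (mixedEmbedding.idealLattice K 1) volume

def Cov (ρ : ℝ) : Prop := 1 ≤ ρ ∧ ∀ z : mixedEmbedding.mixedSpace K, ∃ l : 𝓞 K, ‖z - mixedEmbedding K (l : K)‖ ≤ ρ

variable {K}
lemma nm_pos (c : (Ideal (𝓞 K))⁰) : 0 < nm K c := by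
  unfold nm
  exact_mod_cast Nat.pos_of_ne_zero (Ideal.absNorm_ne_zero_of_nonZeroDivisors c)

lemma d_pos : 0 < finrank ℚ K := finrank_pos

variable (K) in
lemma V0_pos : 0 < V0 K := by
  unfold V0
  exact ENNReal.toReal_pos (Metric.measure_ball_pos _ _ one_pos).ne' measure_ball_lt_top.ne

variable (K) in
lemma D0_pos : 0 < D0 K := ZLattice.covolume_pos _ _

lemma covol_LL (c : (Ideal (𝓞 K))⁰) : ZLattice.covolume (LL K c) volume = D0 K / nm K c := by
  have h0 := nm_pos c
  unfold D0
  rw [mixedEmbedding.covolume_idealLattice, mixedEmbedding.covolume_idealLattice]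
  have : (FractionalIdeal.absNorm ((FractionalIdeal.mk0 K c)⁻¹ : (FractionalIdeal (𝓞 K)⁰ K)ˣ).1 : ℝ) = 1 / nm K c := by
    rw [Units.val_inv_eq_inv_val, map_inv₀, FractionalIdeal.coe_mk0, FractionalIdeal.coeIdeal_absNorm]
    push_cast
    rw [one_div]; rfl
  rw [this, Units.val_one, map_one]
  push_cast
  ring

lemma cov_LL {ρ : ℝ} (hρ : Cov K ρ) (c : (Ideal (𝓞 K))⁰) (z : mixedEmbedding.mixedSpace K) :
    ∃ l ∈ LL K c, ‖z - l‖ ≤ 3 * ρ ^ 2 * nm K c ^ (-(1 / (finrank ℚ K : ℝ))) := by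
  have hN := nm_pos c
  set N := nm K c
  have hd : 0 < finrank ℚ K := d_pos
  have hρ0 : 0 < ρ := by linarith [hρ.1]
  set q : ℝ := N ^ (-(1 / (finrank ℚ K : ℝ))) with hq
  have hq0 : 0 < q := by positivity
  have hqd : q ^ finrank ℚ K = 1 / N := by
    rw [hq, ← Real.rpow_natCast, ← Real.rpow_mul hN.le]
    have : -(1 / (finrank ℚ K : ℝ)) * (finrank ℚ K : ℝ) = -1 := by
      have : (finrank ℚ K : ℝ) ≠ 0 := by exact_mod_cast hd.ne'
      field_simp
    rw [this, Real.rpow_neg_one, one_div]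
  have h1 : D0 K ≤ ρ ^ finrank ℚ K * V0 K := by
    have := covol_le (L := mixedEmbedding.idealLattice K 1) volume hρ0.le (fun z => by
      obtain ⟨l, hl⟩ := hρ.2 z
      refine ⟨_, ?_, hl⟩
      rw [mixedEmbedding.mem_idealLattice]
      refine ⟨l, ?_, rfl⟩
      exact FractionalIdeal.mem_one_iff _ |>.2 ⟨l, rfl⟩)
    rwa [mixedEmbedding.finrank] at this
  have hV := V0_pos K
  obtain ⟨x, hx, hx0, hxn⟩ := exists_short (LL K c) volume (s := 3 / 2 * ρ * q) (by positivity) (by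
    rw [covol_LL, mixedEmbedding.finrank, mul_pow, hqd, mul_pow]
    change D0 K / N < _ * V0 K
    have : 1 < (3 / 2 : ℝ) ^ finrank ℚ K := one_lt_pow₀ (by norm_num) hd.ne'
    rw [mul_one_div, div_mul_eq_mul_div]
    gcongr
    refine h1.trans_lt ?_
    have h3 : 0 < ρ ^ finrank ℚ K * V0 K := by positivity
    nlinarith)
  rw [mixedEmbedding.mem_idealLattice] at hx
  obtain ⟨ξ, hξ, rfl⟩ := hx
  have hξ0 : ξ ≠ 0 := by rintro rfl; simp at hx0
  obtain ⟨l, hl⟩ := hρ.2 (mixedEmbedding K ξ⁻¹ * z)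
  refine ⟨mixedEmbedding K (ξ * l), ?_, ?_⟩
  · rw [mixedEmbedding.mem_idealLattice]
    refine ⟨_, ?_, rfl⟩
    have := Submodule.smul_mem _ l hξ
    rwa [Algebra.smul_def, mul_comm] at this
  · have : z - mixedEmbedding K (ξ * l) = mixedEmbedding K ξ * (mixedEmbedding K ξ⁻¹ * z - mixedEmbedding K l) := by
      rw [mul_sub, ← mul_assoc, ← map_mul, ← map_mul, mul_inv_cancel₀ hξ0, map_one, one_mul]
    rw [this]
    refine (norm_mul_le _ _).trans ?_
    calc _ ≤ 2 * (3 / 2 * ρ * q) * ρ := by gcongr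
      _ = _ := by ring

lemma w_rat (w : InfinitePlace K) (t : ℚ) : w (t : K) = |(t : ℝ)| := by
  rw [← InfinitePlace.norm_embedding_eq w, map_ratCast]
  simp

variable (K) in
def PS (t : ℚ) (r : ℝ) (c : (Ideal (𝓞 K))⁰) : Set K :=
  {ξ | ξ ∈ (((FractionalIdeal.mk0 K c)⁻¹ : (FractionalIdeal (𝓞 K)⁰ K)ˣ) : FractionalIdeal (𝓞 K)⁰ K) ∧ ∀ w : InfinitePlace K, w (ξ - t) ≤ r}

lemma PS_image (t : ℚ) (r : ℝ) (c : (Ideal (𝓞 K))⁰) :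
    mixedEmbedding K '' (PS K t r c) = (LL K c : Set _) ∩ Metric.closedBall (mixedEmbedding K t) r := by
  have key : ∀ ξ : K, (∀ w : InfinitePlace K, w (ξ - t) ≤ r) ↔ mixedEmbedding K ξ ∈ Metric.closedBall (mixedEmbedding K t) r := by
    intro ξ
    rw [Metric.mem_closedBall, dist_eq_norm, ← map_sub, mixedEmbedding.norm_eq_sup'_normAtPlace, Finset.sup'_le_iff]
    simp only [Finset.mem_univ, forall_const, mixedEmbedding.normAtPlace_apply]
  ext z
  simp only [Set.mem_image, Set.mem_inter_iff, SetLike.mem_coe, mixedEmbedding.mem_idealLattice]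
  constructor
  · rintro ⟨ξ, ⟨h1, h2⟩, rfl⟩
    exact ⟨⟨ξ, h1, rfl⟩, (key ξ).1 h2⟩
  · rintro ⟨⟨ξ, h1, rfl⟩, h2⟩
    exact ⟨ξ, ⟨h1, (key ξ).2 h2⟩, rfl⟩

lemma PS_fin (t : ℚ) (r : ℝ) (c : (Ideal (𝓞 K))⁰) : (PS K t r c).Finite := by
  have := cnt_fin (LL K c) (mixedEmbedding K t) r
  rw [← PS_image] at this
  exact this.of_finite_image (mixedEmbedding_injective K).injOn

lemma PS_card (t : ℚ) (r : ℝ) (c : (Ideal (𝓞 K))⁰) : (PS K t r c).ncard = cnt (LL K c) (mixedEmbedding K t) r := by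
  rw [cnt, ← PS_image, Set.ncard_image_of_injective _ (mixedEmbedding_injective K)]

lemma PS_upper {ρ : ℝ} (hρ : Cov K ρ) (t : ℚ) {r lo : ℝ} (hr : 0 ≤ r) (hlo : 0 < lo) (c : (Ideal (𝓞 K))⁰)
    (hc : lo < nm K c) : (PS K t r c).ncard / nm K c ≤
      (r + 3 * ρ ^ 2 * lo ^ (-(1 / (finrank ℚ K : ℝ)))) ^ finrank ℚ K * (V0 K / D0 K) := by
  have hN := nm_pos c
  have hD := D0_pos K
  have hV := V0_pos K
  have h := cnt_upper (L := LL K c) (r := r) volume (cov_LL hρ c) (by positivity) (mixedEmbedding K t)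
  rw [← PS_card, covol_LL, mixedEmbedding.finrank] at h
  have h2 : nm K c ^ (-(1 / (finrank ℚ K : ℝ))) ≤ lo ^ (-(1 / (finrank ℚ K : ℝ))) :=
    Real.rpow_le_rpow_of_nonpos hlo hc.le (by rw [neg_nonpos]; positivity)
  rw [← mul_div_assoc, le_div_iff₀ hD]
  calc _ = ((PS K t r c).ncard : ℝ) * (D0 K / nm K c) := by ring
    _ ≤ _ := h
    _ ≤ _ := by change _ * V0 K ≤ _; gcongr

lemma PS_lower {ρ : ℝ} (hρ : Cov K ρ) (t : ℚ) {r lo : ℝ} (hlo : 0 < lo)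
    (hr : 3 * ρ ^ 2 * lo ^ (-(1 / (finrank ℚ K : ℝ))) ≤ r) (c : (Ideal (𝓞 K))⁰)
    (hc : lo < nm K c) : 
      (r - 3 * ρ ^ 2 * lo ^ (-(1 / (finrank ℚ K : ℝ)))) ^ finrank ℚ K * (V0 K / D0 K) ≤ (PS K t r c).ncard / nm K c := by
  have hN := nm_pos c
  have hD := D0_pos K
  have hV := V0_pos K
  have h2 : 3 * ρ ^ 2 * nm K c ^ (-(1 / (finrank ℚ K : ℝ))) ≤ 3 * ρ ^ 2 * lo ^ (-(1 / (finrank ℚ K : ℝ))) :=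
    mul_le_mul_of_nonneg_left (Real.rpow_le_rpow_of_nonpos hlo hc.le (by rw [neg_nonpos]; positivity)) (by positivity)
  have h := cnt_lower (L := LL K c) (r := r) volume (cov_LL hρ c) (h2.trans hr) (mixedEmbedding K t)
  rw [← PS_card, covol_LL, mixedEmbedding.finrank] at h
  rw [← mul_div_assoc, div_le_iff₀ hD]
  calc _ ≤ _ := by
          refine le_trans ?_ h
          change _ ≤ _ * V0 K
          refine mul_le_mul_of_nonneg_right (pow_le_pow_left₀ (by linarith) (by linarith) _) hV.le
    _ = _ := by ring
end NF

namespace NF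
open NumberField nonZeroDivisors Module MeasureTheory Lat

variable {K : Type*} [Field K] [NumberField K]

lemma trans1 {t : ℚ} {r : ℝ} (hr : 0 < r) (hrt : r < t) {c : (Ideal (𝓞 K))⁰} {ξ : K} (hξ : ξ ∈ PS K t r c) :
    ξ ≠ 0 ∧ ∃ a : (Ideal (𝓞 K))⁰, ((a : Ideal (𝓞 K)) : FractionalIdeal (𝓞 K)⁰ K) = FractionalIdeal.spanSingleton (𝓞 K)⁰ ξ * ((c : Ideal (𝓞 K)) : FractionalIdeal (𝓞 K)⁰ K) ∧
      ξ⁻¹ ∈ PS K (1 / t) (r / (t * (t - r))) a ∧ (t - r) ^ finrank ℚ K * nm K c ≤ nm K a ∧ nm K a ≤ (t + r) ^ finrank ℚ K * nm K c := by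
  obtain ⟨h1, h2⟩ := hξ
  have ht : (0 : ℝ) < t := hr.trans hrt
  have hwt : ∀ w : InfinitePlace K, w (t : K) = t := fun w => by rw [w_rat, abs_of_pos ht]
  have hlow : ∀ w : InfinitePlace K, t - r ≤ w ξ := fun w => by
    have := w.1.add_le (ξ) (t - ξ)
    rw [add_sub_cancel] at this
    have h3 : w.1 (t - ξ) ≤ r := by rw [w.1.map_sub]; exact h2 w
    have h4 := hwt w
    change w.1 (t : K) = t at h4
    change t - r ≤ w.1 ξ
    linarith
  have hup : ∀ w : InfinitePlace K, w ξ ≤ t + r := fun w => by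
    have := w.1.add_le (ξ - t) t
    rw [sub_add_cancel] at this
    have h3 : w.1 (ξ - t) ≤ r := h2 w
    have h4 := hwt w
    change w.1 (t : K) = t at h4
    change w.1 ξ ≤ _
    linarith
  have hξ0 : ξ ≠ 0 := by
    rintro rfl
    obtain ⟨w⟩ : Nonempty (InfinitePlace K) := inferInstance
    have := hlow w
    rw [map_zero] at this
    linarith
  refine ⟨hξ0, ?_⟩
  have hc0 : ((c : Ideal (𝓞 K)) : FractionalIdeal (𝓞 K)⁰ K) ≠ 0 :=
    FractionalIdeal.coeIdeal_ne_zero.2 (nonZeroDivisors.coe_ne_zero c)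
  have hle : FractionalIdeal.spanSingleton (𝓞 K)⁰ ξ * ((c : Ideal (𝓞 K)) : FractionalIdeal (𝓞 K)⁰ K) ≤ 1 := by
    rw [FractionalIdeal.spanSingleton_mul_le_iff]
    intro z hz
    rw [Units.val_inv_eq_inv_val, FractionalIdeal.coe_mk0, FractionalIdeal.mem_inv_iff hc0] at h1
    exact h1 z hz
  obtain ⟨a, ha⟩ := FractionalIdeal.le_one_iff_exists_coeIdeal.1 hle
  have ha0 : a ≠ ⊥ := by
    rintro rfl
    rw [FractionalIdeal.coeIdeal_bot] at ha
    exact mul_ne_zero (FractionalIdeal.spanSingleton_ne_zero_iff.2 hξ0) hc0 ha.symm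
  refine ⟨⟨a, mem_nonZeroDivisors_of_ne_zero ha0⟩, ha, ⟨?_, ?_⟩, ?_⟩
  · rw [Units.val_inv_eq_inv_val, FractionalIdeal.coe_mk0, FractionalIdeal.mem_inv_iff (FractionalIdeal.coeIdeal_ne_zero.2 ha0)]
    intro z hz
    change z ∈ (a : FractionalIdeal (𝓞 K)⁰ K) at hz
    rw [ha, FractionalIdeal.mem_singleton_mul] at hz
    obtain ⟨y, hy, rfl⟩ := hz
    rw [inv_mul_cancel_left₀ hξ0]
    exact FractionalIdeal.coeIdeal_le_one hy
  · intro w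
    have htK : (t : K) ≠ 0 := by
      intro h
      have := hwt w
      rw [h, map_zero] at this
      linarith
    have e : ξ⁻¹ - ((1 / t : ℚ) : K) = (t - ξ) / (ξ * t) := by
      push_cast
      field_simp
    rw [e, map_div₀, map_mul, hwt]
    have h3 : w (t - ξ) ≤ r := (w.1.map_sub _ _).trans_le (h2 w)
    have := hlow w
    have h5 : 0 < (t : ℝ) - r := by linarith
    rw [mul_comm (t : ℝ)]
    gcongr
  · have hn : nm K ⟨a, mem_nonZeroDivisors_of_ne_zero ha0⟩ = |Algebra.norm ℚ ξ| * nm K c := by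
      have := congrArg FractionalIdeal.absNorm ha
      rw [map_mul, FractionalIdeal.absNorm_span_singleton, FractionalIdeal.coeIdeal_absNorm, FractionalIdeal.coeIdeal_absNorm] at this
      unfold nm
      exact_mod_cast congrArg (fun z : ℚ => (z : ℝ)) this
    rw [hn]
    have hp := InfinitePlace.prod_eq_abs_norm ξ
    have hN := nm_pos c
    have hs := InfinitePlace.sum_mult_eq (K := K)
    have h5 : 0 ≤ (t : ℝ) - r := by linarith
    have e1 : ∀ u : ℝ, u ^ finrank ℚ K = ∏ w : InfinitePlace K, u ^ w.mult := fun u => by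
      rw [Finset.prod_pow_eq_pow_sum, hs]
    push_cast at hp ⊢
    rw [← hp, e1, e1]
    constructor
    · refine mul_le_mul_of_nonneg_right (Finset.prod_le_prod (fun w _ => by positivity) fun w _ => pow_le_pow_left₀ h5 (hlow w) _) hN.le
    · refine mul_le_mul_of_nonneg_right (Finset.prod_le_prod (fun w _ => by positivity) fun w _ => pow_le_pow_left₀ (h5.trans (hlow w)) (hup w) _) hN.le

variable (K) in
lemma fin_le (s : ℝ) : {c : (Ideal (𝓞 K))⁰ | nm K c ≤ s}.Finite := by
  refine (Ideal.finite_setOfPred_absNorm_le₀ (S := 𝓞 K) ⌊s⌋₊).subset fun c hc => ?_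
  exact Nat.le_floor hc

variable (K) in
noncomputable def FF (lo hi : ℝ) : Finset (Ideal (𝓞 K))⁰ := (fin_le K hi).toFinset.filter (fun c => lo < nm K c)

lemma mem_FF {lo hi : ℝ} {c : (Ideal (𝓞 K))⁰} : c ∈ FF K lo hi ↔ lo < nm K c ∧ nm K c ≤ hi := by
  simp [FF, and_comm]

variable (K) in
noncomputable def SS (lo hi : ℝ) (t : ℚ) (r : ℝ) : ℝ := ∑ c ∈ FF K lo hi, (PS K t r c).ncard / nm K c

lemma transfer {lo hi : ℝ} {t : ℚ} {r : ℝ} (hr : 0 < r) (hrt : r < t) :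
    SS K lo hi t r ≤ (t + r) ^ finrank ℚ K * SS K (lo * (t - r) ^ finrank ℚ K) (hi * (t + r) ^ finrank ℚ K) (1 / t) (r / (t * (t - r))) := by
  have ht : (0 : ℝ) < t := hr.trans hrt
  have htr : (0 : ℝ) < t - r := by linarith
  have e : ∀ lo hi t r, SS K lo hi t r = ∑ x ∈ (FF K lo hi).sigma (fun c => (PS_fin t r c).toFinset), 1 / nm K x.1 := by
    intro lo hi t r
    rw [Finset.sum_sigma, SS]
    refine Finset.sum_congr rfl fun c _ => ?_
    change _ = ∑ s ∈ _, 1 / nm K c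
    rw [Finset.sum_const, nsmul_eq_mul, Set.ncard_eq_toFinset_card _ (PS_fin t r c)]
    ring
  rw [e, e, Finset.mul_sum]
  have H : ∀ x : (Σ _ : (Ideal (𝓞 K))⁰, K), ∃ a : (Ideal (𝓞 K))⁰, x ∈ (FF K lo hi).sigma (fun c => (PS_fin t r c).toFinset) → 
      ((a : Ideal (𝓞 K)) : FractionalIdeal (𝓞 K)⁰ K) = FractionalIdeal.spanSingleton (𝓞 K)⁰ x.2 * ((x.1 : Ideal (𝓞 K)) : FractionalIdeal (𝓞 K)⁰ K) ∧
      x.2⁻¹ ∈ PS K (1 / t) (r / (t * (t - r))) a ∧ (t - r) ^ finrank ℚ K * nm K x.1 ≤ nm K a ∧ nm K a ≤ (t + r) ^ finrank ℚ K * nm K x.1 := by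
    intro x
    by_cases hx : x ∈ (FF K lo hi).sigma (fun c => (PS_fin t r c).toFinset)
    · rw [Finset.mem_sigma, Set.Finite.mem_toFinset] at hx
      obtain ⟨a, ha⟩ := (trans1 hr hrt hx.2).2
      exact ⟨a, fun _ => ha⟩
    · exact ⟨1, fun h => absurd h hx⟩
  choose f hf using H
  have h1 : ∀ x ∈ (FF K lo hi).sigma (fun c => (PS_fin t r c).toFinset), 1 / nm K x.1 ≤ (t + r) ^ finrank ℚ K * (1 / nm K (f x)) := by
    intro x hx
    have h := (hf x hx).2.2.2
    have := nm_pos (f x)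
    have := nm_pos x.1
    rw [mul_one_div, div_le_div_iff₀ (by assumption) (by assumption)]
    linarith
  refine (Finset.sum_le_sum h1).trans ?_
  have inj : Set.InjOn (fun x : (Σ _ : (Ideal (𝓞 K))⁰, K) => (⟨f x, x.2⁻¹⟩ : (Σ _ : (Ideal (𝓞 K))⁰, K)))
      ((FF K lo hi).sigma (fun c => (PS_fin t r c).toFinset)) := by
    rintro ⟨c, ξ⟩ hx ⟨c', ξ'⟩ hx' h
    have hx2 := hx
    rw [Finset.mem_coe, Finset.mem_sigma, Set.Finite.mem_toFinset] at hx2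
    have h0 := (trans1 hr hrt hx2.2).1
    have h3 : f ⟨c, ξ⟩ = f ⟨c', ξ'⟩ := congrArg (fun y => y.1) h
    have h4 : ξ⁻¹ = ξ'⁻¹ := congrArg (fun y => y.2) h
    obtain rfl := inv_injective h4
    have h5 := (hf _ hx).1
    rw [h3, (hf _ hx').1] at h5
    have h6 := mul_left_cancel₀ (FractionalIdeal.spanSingleton_ne_zero_iff.2 h0) h5
    have h7 := FractionalIdeal.coeIdeal_injective h6
    obtain rfl := Subtype.ext h7
    rfl
  rw [← Finset.sum_image (f := fun y : (Σ _ : (Ideal (𝓞 K))⁰, K) => (t + r) ^ finrank ℚ K * (1 / nm K y.1)) inj]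
  refine Finset.sum_le_sum_of_subset_of_nonneg ?_ (fun y _ _ => ?_)
  · intro y hy
    obtain ⟨x, hx, rfl⟩ := Finset.mem_image.1 hy
    obtain ⟨-, h2, h3, h4⟩ := hf x hx
    rw [Finset.mem_sigma, mem_FF, Set.Finite.mem_toFinset] at hx ⊢
    refine ⟨⟨?_, ?_⟩, h2⟩
    · refine lt_of_lt_of_le ?_ h3
      rw [mul_comm]
      exact mul_lt_mul_of_pos_left hx.1.1 (by positivity)
    · refine h4.trans ?_
      rw [mul_comm]
      exact mul_le_mul_of_nonneg_right hx.1.2 (by positivity)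
  · have := nm_pos y.1
    positivity
end NF

namespace NF
open NumberField nonZeroDivisors Module MeasureTheory Lat Filter Topology

variable {K : Type*} [Field K] [NumberField K]

variable (K) in
noncomputable def NN (s : ℝ) : ℝ := (fin_le K s).toFinset.card

variable (K) in
noncomputable def kap : ℝ := (2 ^ InfinitePlace.nrRealPlaces K * (2 * Real.pi) ^ InfinitePlace.nrComplexPlaces K * Units.regulator K * classNumber K) /
            (Units.torsionOrder K * Real.sqrt |discr K|)

variable (K) in
lemma kap_pos : 0 < kap K := by
  unfold kap
  have h1 := Units.regulator_pos K
  have h2 : 0 < classNumber K := by unfold classNumber; exact Fintype.card_pos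
  have h3 : (0 : ℝ) < Real.sqrt |discr K| := Real.sqrt_pos.2 (by exact_mod_cast abs_pos.2 (discr_ne_zero K))
  have h4 : 0 < Units.torsionOrder K := Nat.pos_of_ne_zero (NeZero.ne _)
  positivity

variable (K) in
lemma NN_tendsto : Tendsto (fun s => NN K s / s) atTop (𝓝 (kap K)) := by
  have := NumberField.Ideal.tendsto_norm_le_div_atTop₀ K
  refine this.congr fun s => ?_
  unfold NN
  rw [← Nat.card_eq_card_finite_toFinset]
  rfl

lemma NN_tendsto2 {u : ℝ} (hu : 0 < u) {d : ℕ} (hd : d ≠ 0) :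
    Tendsto (fun m : ℕ => NN K (u * (m : ℝ) ^ d) / (m : ℝ) ^ d) atTop (𝓝 (kap K * u)) := by
  have h1 : Tendsto (fun m : ℕ => u * (m : ℝ) ^ d) atTop atTop :=
    ((tendsto_pow_atTop hd).comp tendsto_natCast_atTop_atTop).const_mul_atTop hu
  have h2 := ((NN_tendsto K).comp h1).mul_const u
  refine h2.congr' ?_
  filter_upwards [eventually_gt_atTop 0] with m hm
  have : (0 : ℝ) < m := by exact_mod_cast hm
  simp only [Function.comp]
  field_simp

lemma FF_card {lo hi : ℝ} (h : lo ≤ hi) : ((FF K lo hi).card : ℝ) = NN K hi - NN K lo := by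
  rw [eq_sub_iff_add_eq, NN, NN]
  have : (fin_le K hi).toFinset = FF K lo hi ∪ (fin_le K lo).toFinset := by
    ext c
    simp only [Finset.mem_union, mem_FF, Set.Finite.mem_toFinset, Set.mem_ofPred_eq]
    constructor
    · intro h
      by_cases h2 : nm K c ≤ lo
      · exact Or.inr h2
      · exact Or.inl ⟨not_le.1 h2, h⟩
    · rintro (h1 | h1)
      · exact h1.2
      · linarith
  rw [this, Finset.card_union_of_disjoint]
  · push_cast; ring
  · rw [Finset.disjoint_left]
    intro c hc hc2
    rw [mem_FF] at hc
    simp only [Set.Finite.mem_toFinset, Set.mem_ofPred_eq] at hc2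
    linarith

lemma FF_card_ge {lo hi : ℝ} : NN K hi - NN K lo ≤ ((FF K lo hi).card : ℝ) := by
  rcases le_total lo hi with h | h
  · rw [FF_card h]
  · have : NN K hi ≤ NN K lo := by
      unfold NN
      norm_cast
      refine Finset.card_le_card fun c hc => ?_
      simp only [Set.Finite.mem_toFinset, Set.mem_ofPred_eq] at hc ⊢
      linarith
    have h2 : (0 : ℝ) ≤ (FF K lo hi).card := by positivity
    linarith

lemma rp {A u : ℝ} (hA : 0 < A) (hu : 0 < u) {d : ℕ} (hd : d ≠ 0) :
    (A * u ^ d) ^ (-(1 / (d : ℝ))) = A ^ (-(1 / (d : ℝ))) / u := by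
  have hd' : (d : ℝ) ≠ 0 := by exact_mod_cast hd
  rw [Real.mul_rpow hA.le (by positivity), ← Real.rpow_natCast, ← Real.rpow_mul hu.le]
  have : (d : ℝ) * -(1 / (d : ℝ)) = -1 := by field_simp
  rw [this, Real.rpow_neg_one]
  rfl

lemma SS_upper {ρ : ℝ} (hρ : Cov K ρ) (t : ℚ) {r lo hi : ℝ} (hr : 0 ≤ r) (hlo : 0 < lo) :
    SS K lo hi t r ≤ (FF K lo hi).card * ((r + 3 * ρ ^ 2 * lo ^ (-(1 / (finrank ℚ K : ℝ)))) ^ finrank ℚ K * (V0 K / D0 K)) := by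
  unfold SS
  rw [← nsmul_eq_mul]
  exact Finset.sum_le_card_nsmul _ _ _ fun c hc => PS_upper hρ t hr hlo c (mem_FF.1 hc).1

lemma SS_lower {ρ : ℝ} (hρ : Cov K ρ) (t : ℚ) {r lo hi : ℝ} (hlo : 0 < lo)
    (hr : 3 * ρ ^ 2 * lo ^ (-(1 / (finrank ℚ K : ℝ))) ≤ r) :
    (FF K lo hi).card * ((r - 3 * ρ ^ 2 * lo ^ (-(1 / (finrank ℚ K : ℝ)))) ^ finrank ℚ K * (V0 K / D0 K)) ≤ SS K lo hi t r := by
  unfold SS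
  rw [← nsmul_eq_mul]
  exact Finset.card_nsmul_le_sum _ _ _ fun c hc => PS_lower hρ t hlo hr c (mem_FF.1 hc).1

lemma n_upper {ρ : ℝ} (hρ : Cov K ρ) {A B r : ℝ} (hA : 0 < A) (hAB : A ≤ B) (hr : 0 < r) (hr1 : r < 1) :
    (FF K A B).card * r ^ finrank ℚ K ≤ kap K * (B * (1 + r) ^ finrank ℚ K - A * (1 - r) ^ finrank ℚ K) *
      ((1 + r) * ((r + 3 * ρ ^ 2 * A ^ (-(1 / (finrank ℚ K : ℝ)))) / (1 - r))) ^ finrank ℚ K := by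
  have hd : finrank ℚ K ≠ 0 := d_pos.ne'
  set d := finrank ℚ K with hdd
  have hv : 0 < V0 K / D0 K := div_pos (V0_pos K) (D0_pos K)
  set v := V0 K / D0 K with hvv
  set Q := 3 * ρ ^ 2 * A ^ (-(1 / (d : ℝ))) with hQ
  have hQ0 : 0 ≤ Q := by positivity
  have h1r : 0 < 1 - r := by linarith
  have hB : 0 < B := by linarith
  have key : ∀ᶠ m : ℕ in atTop, (FF K A B).card * (r - Q / m) ^ d ≤
      (NN K (B * (1 + r) ^ d * (m : ℝ) ^ d) / (m : ℝ) ^ d - NN K (A * (1 - r) ^ d * (m : ℝ) ^ d) / (m : ℝ) ^ d) * ((1 + r) * ((r + Q) / (1 - r))) ^ d := by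
    obtain ⟨m0, hm0⟩ := exists_nat_gt (Q / r)
    filter_upwards [eventually_ge_atTop (m0 + 1)] with m hm
    have hm1 : (0 : ℝ) < m := by exact_mod_cast (by omega : 0 < m)
    have hmQ : Q ≤ r * m := by
      have : (m0 : ℝ) ≤ m := by exact_mod_cast (by omega : m0 ≤ m)
      rw [div_lt_iff₀ hr] at hm0
      nlinarith
    have a1 := SS_lower (hi := B) hρ (m : ℚ) hA hmQ
    have a2 := transfer (K := K) (lo := A) (hi := B) (t := (m : ℚ)) (r := r * m) (by positivity) (by push_cast; nlinarith)
    have a3 := SS_upper (K := K) (hi := B * (m + r * m) ^ d) hρ (1 / (m : ℚ)) (r := r * m / (m * (m - r * m))) (lo := A * (m - r * m) ^ d) 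
      (by have : 0 < (m : ℝ) - r * m := by nlinarith
          positivity) (by have : 0 < (m : ℝ) - r * m := by nlinarith
                          positivity)
    push_cast at a1 a2 a3
    rw [← hdd] at a1 a2 a3
    rw [rp hA (by nlinarith) hd, FF_card] at a3
    swap
    · refine mul_le_mul hAB (pow_le_pow_left₀ (by nlinarith) (by nlinarith) _) (pow_nonneg (by nlinarith) _) hB.le
    have a4 := a1.trans (a2.trans (mul_le_mul_of_nonneg_left a3 (by positivity)))
    have e1 : r * m / (m * (m - r * m)) + 3 * ρ ^ 2 * (A ^ (-(1 / (d : ℝ))) / (m - r * m)) = ((r + Q) / (1 - r)) / m := by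
      rw [hQ]
      have : (m : ℝ) - r * m = m * (1 - r) := by ring
      rw [this]
      field_simp
    have e2 : (m : ℝ) + r * m = (1 + r) * m := by ring
    have e3 : (m : ℝ) - r * m = (1 - r) * m := by ring
    have e4 : r * m - Q = (r - Q / m) * m := by field_simp
    rw [e1, e2, e3, ← hQ, e4, ← hvv] at a4
    simp only [mul_pow, div_pow, ← mul_assoc] at a4 ⊢
    have hmd : 0 < (m : ℝ) ^ d * v := by positivity
    refine le_of_mul_le_mul_right (a := (m : ℝ) ^ d * v) ?_ hmd
    refine le_trans (le_of_eq ?_) (a4.trans (le_of_eq ?_))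
    · ring
    · field_simp
  have t1 : Tendsto (fun m : ℕ => ((FF K A B).card : ℝ) * (r - Q / m) ^ d) atTop (𝓝 ((FF K A B).card * r ^ d)) := by
    have : Tendsto (fun m : ℕ => Q / m) atTop (𝓝 0) := tendsto_const_div_atTop_nhds_zero_nat Q
    simpa using ((this.const_sub r).pow d).const_mul ((FF K A B).card : ℝ)
  have t2 := ((NN_tendsto2 (K := K) (u := B * (1 + r) ^ d) (by positivity) hd).sub
    (NN_tendsto2 (K := K) (u := A * (1 - r) ^ d) (by positivity) hd)).mul_const (((1 + r) * ((r + Q) / (1 - r))) ^ d)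
  have := le_of_tendsto_of_tendsto t1 t2 key
  rwa [← mul_sub] at this

lemma n_lower {ρ : ℝ} (hρ : Cov K ρ) {A B r : ℝ} (hA : 0 < A) (hB : 0 < B) (hr1 : r < 1) (hr : 0 < r)
    (hQr : 3 * ρ ^ 2 * A ^ (-(1 / (finrank ℚ K : ℝ))) ≤ r) :
    kap K * (B / (1 + r) ^ finrank ℚ K - A / (1 - r) ^ finrank ℚ K) * (r - 3 * ρ ^ 2 * A ^ (-(1 / (finrank ℚ K : ℝ)))) ^ finrank ℚ K
     ≤ (FF K A B).card * (r * (1 + r) / (1 - r)) ^ finrank ℚ K := by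
  have hd : finrank ℚ K ≠ 0 := d_pos.ne'
  set d := finrank ℚ K with hdd
  have hv : 0 < V0 K / D0 K := div_pos (V0_pos K) (D0_pos K)
  set v := V0 K / D0 K with hvv
  set Q := 3 * ρ ^ 2 * A ^ (-(1 / (d : ℝ))) with hQ
  have hQ0 : 0 ≤ Q := by positivity
  have h1r : 0 < 1 - r := by linarith
  have key : ∀ᶠ m : ℕ in atTop, 
      (NN K (B / (1 + r) ^ d * (m : ℝ) ^ d) / (m : ℝ) ^ d - NN K (A / (1 - r) ^ d * (m : ℝ) ^ d) / (m : ℝ) ^ d) * (r - Q) ^ d ≤ 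
      (FF K A B).card * ((1 + r) * (r / (1 - r) + Q / m)) ^ d := by
    filter_upwards [eventually_gt_atTop 0] with m hm
    have hm1 : (0 : ℝ) < m := by exact_mod_cast hm
    set A' := A / (1 - r) ^ d * (m : ℝ) ^ d with hA'
    set B' := B / (1 + r) ^ d * (m : ℝ) ^ d with hB'
    have eA : A' = A * (m / (1 - r)) ^ d := by rw [hA', div_pow]; ring
    have eQ : 3 * ρ ^ 2 * A' ^ (-(1 / (d : ℝ))) = Q * (1 - r) / m := by
      rw [eA, rp hA (by positivity) hd, hQ]
      field_simp
    have hQm : Q * (1 - r) / m ≤ Q / m := by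
      gcongr
      nlinarith
    have hQm2 : Q / m ≤ r / m := by gcongr
    have a1 := SS_lower (K := K) (lo := A') (hi := B') hρ (1 / (m : ℚ)) (by positivity) (r := r / m) (by
      rw [← hdd, eQ]
      linarith)
    have a2 := transfer (K := K) (lo := A') (hi := B') (t := 1 / (m : ℚ)) (r := r / m) (by positivity) (by push_cast; gcongr)
    push_cast at a2
    rw [← hdd] at a1 a2
    have e1 : A' * (1 / m - r / m) ^ d = A := by
      rw [eA, ← sub_div, div_pow, div_pow]; field_simp
    have e2 : B' * (1 / m + r / m) ^ d = B := by
      rw [hB', ← add_div, div_pow]; field_simp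
    have e3 : r / m / (1 / m * (1 / m - r / m)) = r * m / (1 - r) := by
      rw [← sub_div]; field_simp
    rw [e1, e2, e3] at a2
    have a3 := SS_upper (K := K) (lo := A) (hi := B) hρ (1 / (1 / (m : ℚ))) (r := r * m / (1 - r)) (by positivity) hA
    rw [eQ] at a1
    have a4 := a1.trans (a2.trans (mul_le_mul_of_nonneg_left a3 (by positivity)))
    rw [← hdd, ← hQ, ← hvv] at a4
    have a5 : (NN K B' - NN K A') * (((r - Q) / m) ^ d * v) ≤ (FF K A' B').card * ((r / m - Q * (1 - r) / m) ^ d * v) := by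
      have : 0 ≤ (r - Q) / m := div_nonneg (by linarith) hm1.le
      have h3 : ((r - Q) / m) ≤ (r / m - Q * (1 - r) / m) := by rw [sub_div]; linarith
      refine (mul_le_mul_of_nonneg_right FF_card_ge (by positivity)).trans ?_
      gcongr
    have a6 := a5.trans a4
    have e5 : r * m / (1 - r) + Q = (r / (1 - r) + Q / m) * m := by field_simp
    rw [e5, ← add_div] at a6
    simp only [mul_pow, div_pow] at a6 ⊢
    refine le_of_mul_le_mul_right (a := v) ?_ hv
    refine le_trans (le_of_eq ?_) (a6.trans (le_of_eq ?_))
    · ring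
    · field_simp
  have t1 : Tendsto (fun m : ℕ => ((FF K A B).card : ℝ) * ((1 + r) * (r / (1 - r) + Q / m)) ^ d) atTop (𝓝 ((FF K A B).card * (r * (1 + r) / (1 - r)) ^ d)) := by
    have : Tendsto (fun m : ℕ => Q / m) atTop (𝓝 0) := tendsto_const_div_atTop_nhds_zero_nat Q
    have h := (((this.const_add (r / (1 - r))).const_mul (1 + r)).pow d).const_mul ((FF K A B).card : ℝ)
    convert h using 4
    ring
  have t2 := ((NN_tendsto2 (K := K) (u := B / (1 + r) ^ d) (by positivity) hd).sub
    (NN_tendsto2 (K := K) (u := A / (1 - r) ^ d) (by positivity) hd)).mul_const ((r - Q) ^ d)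
  have := le_of_tendsto_of_tendsto t2 t1 key
  rwa [← mul_sub] at this
end NF

namespace NF
open NumberField nonZeroDivisors Module MeasureTheory Lat Filter Topology

variable {K : Type*} [Field K] [NumberField K]

lemma bern {b θ : ℝ} (hb : 0 ≤ b) (h0 : 0 ≤ θ) (h1 : θ ≤ 1) (d : ℕ) : (1 + b * θ) ^ d ≤ 1 + θ * ((1 + b) ^ d - 1) := by
  induction d with
  | zero => simp
  | succ d ih =>
    have hG : 1 ≤ (1 + b) ^ d := one_le_pow₀ (by linarith)
    rw [pow_succ, pow_succ]
    set G := (1 + b) ^ d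
    have h2 : 0 ≤ θ * (1 - θ) * (b * (G - 1)) := mul_nonneg (mul_nonneg h0 (by linarith)) (mul_nonneg hb (by linarith))
    have : (1 + b * θ) ^ d * (1 + b * θ) ≤ (1 + θ * (G - 1)) * (1 + b * θ) := mul_le_mul_of_nonneg_right ih (by positivity)
    nlinarith

lemma bern' {y : ℝ} (hy : y ≤ 1) (d : ℕ) : 1 - d * y ≤ (1 - y) ^ d := by
  have := one_add_mul_le_pow (a := -y) (by linarith) d
  have e : (1 : ℝ) + -y = 1 - y := by ring
  rw [e] at this
  linarith

lemma d_le_two_pow (d : ℕ) : (d : ℝ) ≤ 2 ^ d := by exact_mod_cast Nat.lt_two_pow_self.le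

lemma real_up {R θ : ℝ} {d : ℕ} (hR1 : 1 ≤ R) (hθ0 : 0 < θ) (hθ1 : θ ≤ 1) :
    (2 * (1 + θ / 2) ^ d - (1 - θ / 2) ^ d) * ((1 + θ / 2) / (1 - θ / 2) * (1 + 6 * R * θ)) ^ d ≤ 1 + 5 * (42 * R) ^ d * θ := by
  have hnn : 0 ≤ (1 + θ / 2) / (1 - θ / 2) * (1 + 6 * R * θ) :=
    mul_nonneg (div_nonneg (by linarith) (by linarith)) (by positivity)
  have e4 : ((1 + θ / 2) / (1 - θ / 2) * (1 + 6 * R * θ)) ^ d ≤ 1 + θ * (21 * R) ^ d := by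
    have e2 : (1 + θ / 2) / (1 - θ / 2) ≤ 1 + 2 * θ := by
      rw [div_le_iff₀ (by linarith)]
      nlinarith
    have e3 : (1 + θ / 2) / (1 - θ / 2) * (1 + 6 * R * θ) ≤ 1 + (20 * R) * θ := by
      refine (mul_le_mul_of_nonneg_right e2 (by positivity)).trans ?_
      have p1 := mul_nonneg (mul_nonneg hθ0.le (by linarith : 0 ≤ 1 - θ)) (by linarith : 0 ≤ R)
      have p2 := mul_nonneg hθ0.le (by linarith : 0 ≤ R - 1)
      linarith
    refine (pow_le_pow_left₀ hnn e3 d).trans ?_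
    refine (bern (by positivity) hθ0.le hθ1 d).trans ?_
    have : (1 + 20 * R) ^ d ≤ (21 * R) ^ d := pow_le_pow_left₀ (by linarith) (by linarith) _
    have := mul_le_mul_of_nonneg_left this hθ0.le
    linarith
  have h2p : (1 : ℝ) ≤ 2 ^ d := one_le_pow₀ (by norm_num)
  have e5 : 2 * (1 + θ / 2) ^ d - (1 - θ / 2) ^ d ≤ 1 + 2 * 2 ^ d * θ := by
    have h1 := bern' (y := θ / 2) (by linarith) d
    have hbh := bern (b := 1) (θ := θ / 2) (by norm_num) (by linarith) (by linarith) d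
    rw [one_mul] at hbh
    norm_num at hbh
    have h3 := mul_le_mul_of_nonneg_right (d_le_two_pow d) hθ0.le
    linarith [mul_pos hθ0 (by linarith : (0 : ℝ) < 2 ^ d)]
  refine (mul_le_mul e5 e4 (pow_nonneg hnn _) (by positivity)).trans ?_
  have h42 : (42 * R) ^ d = 2 ^ d * (21 * R) ^ d := by rw [← mul_pow]; congr 1; ring
  have h21 : 1 ≤ (21 * R) ^ d := one_le_pow₀ (by linarith)
  rw [h42]
  clear e4 e5 hnn h42
  generalize (21 * R) ^ d = G at *
  generalize (2 : ℝ) ^ d = T at *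
  have p1 : T * 1 ≤ T * G := mul_le_mul_of_nonneg_left h21 (by linarith)
  have p2 : 1 * G ≤ T * G := mul_le_mul_of_nonneg_right h2p (by linarith)
  have p0 : 0 ≤ T * G := by positivity
  have p3 : θ * (θ * (T * G)) ≤ θ * (1 * (T * G)) := by gcongr
  have p4 := mul_le_mul_of_nonneg_left p1 hθ0.le
  have p5 := mul_le_mul_of_nonneg_left p2 hθ0.le
  linarith

lemma real_lo {R θ : ℝ} {d : ℕ} (hd : d ≠ 0) (hR1 : 1 ≤ R) (hθ0 : 0 < θ) (hθ1 : θ ≤ 1) (hC : 5 * (42 * R) ^ d * θ < 1) :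
    3 * R * θ ^ 2 ≤ θ / 2 ∧ 1 - 5 * (42 * R) ^ d * θ ≤ (2 * (1 / (1 + θ / 2)) ^ d - (1 / (1 - θ / 2)) ^ d) * ((1 - θ / 2) / (1 + θ / 2) * (1 - 6 * R * θ)) ^ d := by
  have h2d := d_le_two_pow d
  have hm : 0 < 1 - θ / 2 := by linarith
  obtain ⟨hq, hq2, hq3⟩ : 7 * d * R ≤ (42 * R) ^ d ∧ 7 * R ≤ (42 * R) ^ d ∧ (2 : ℝ) ^ d ≤ (42 * R) ^ d := by
    have hRd : R ≤ R ^ d := le_self_pow₀ hR1 hd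
    have hq : 7 * d * R ≤ (42 * R) ^ d := by
      have h7 : (7 : ℝ) ≤ 21 ^ d := le_trans (by norm_num) (le_self_pow₀ (by norm_num : (1 : ℝ) ≤ 21) hd)
      have : (42 * R) ^ d = 2 ^ d * 21 ^ d * R ^ d := by rw [← mul_pow, ← mul_pow]; norm_num
      rw [this]
      calc 7 * d * R = d * 7 * R := by ring
        _ ≤ _ := by gcongr
    refine ⟨hq, le_trans ?_ hq, by gcongr; linarith⟩
    have : (1 : ℝ) ≤ d := by exact_mod_cast Nat.pos_of_ne_zero hd
    have := mul_le_mul_of_nonneg_right this (by linarith : 0 ≤ R)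
    linarith
  have hb1 := bern (b := 1) (by norm_num) hθ0.le hθ1 d
  rw [one_mul] at hb1
  norm_num at hb1
  set W := (42 * R) ^ d
  clear_value W
  have w1 := mul_le_mul_of_nonneg_right hq hθ0.le
  have w2 := mul_le_mul_of_nonneg_right hq2 hθ0.le
  have w3 := mul_le_mul_of_nonneg_right hq3 hθ0.le
  have w4 := mul_le_mul_of_nonneg_right h2d hθ0.le
  have w5 := mul_pos hθ0 (by linarith : 0 < R)
  have hy : 7 * R * θ ≤ 1 := by linarith
  refine ⟨by nlinarith, ?_⟩
  have e4 : 1 - W * θ ≤ ((1 - θ / 2) / (1 + θ / 2) * (1 - 6 * R * θ)) ^ d := by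
    have e2 : 1 - θ ≤ (1 - θ / 2) / (1 + θ / 2) := by
      rw [le_div_iff₀ (by linarith)]
      nlinarith
    have e3 : 1 - 7 * R * θ ≤ (1 - θ / 2) / (1 + θ / 2) * (1 - 6 * R * θ) := by
      refine le_trans ?_ (mul_le_mul_of_nonneg_right e2 (by linarith))
      have p1 := mul_nonneg hθ0.le (by linarith : 0 ≤ R - 1)
      have p2 := mul_nonneg (mul_nonneg hθ0.le hθ0.le) (by linarith : 0 ≤ R)
      linarith
    refine le_trans ?_ ((bern' hy d).trans (pow_le_pow_left₀ (by linarith) e3 d))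
    linarith
  have e5 : 1 - 2 * W * θ ≤ 2 * (1 / (1 + θ / 2)) ^ d - (1 / (1 - θ / 2)) ^ d := by
    have f1 : 1 - θ / 2 ≤ 1 / (1 + θ / 2) := by
      rw [le_div_iff₀ (by linarith)]; nlinarith
    have f2 : 1 / (1 - θ / 2) ≤ 1 + θ := by
      rw [div_le_iff₀ hm]; nlinarith
    have f3 := (bern' (y := θ / 2) (by linarith) d).trans (pow_le_pow_left₀ hm.le f1 d)
    have f4 := (pow_le_pow_left₀ (by positivity) f2 d).trans hb1
    linarith
  have hw0 : 0 ≤ W * θ := by linarith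
  refine le_trans ?_ (mul_le_mul e5 e4 (by linarith) (by linarith))
  have := mul_nonneg hw0 hw0
  linarith

lemma n_bound {ρ : ℝ} (hρ : Cov K ρ) {X : ℝ} (hX : 1 ≤ X) :
    |((FF K X (2 * X)).card : ℝ) - kap K * X| ≤ kap K * (5 * (42 * ρ ^ 2) ^ finrank ℚ K) * (X * X ^ (-(1 / (2 * finrank ℚ K : ℝ)))) := by
  have hd : finrank ℚ K ≠ 0 := d_pos.ne'
  have hκ := kap_pos K
  have up := fun {r : ℝ} => n_upper hρ (A := X) (B := 2 * X) (r := r) (by linarith) (by linarith)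
  have lw := fun {r : ℝ} => n_lower hρ (A := X) (B := 2 * X) (r := r) (by linarith) (by linarith)
  have hR1 : 1 ≤ ρ ^ 2 := one_le_pow₀ hρ.1
  set d := finrank ℚ K
  set κ := kap K
  set θ : ℝ := X ^ (-(1 / (2 * d : ℝ))) with hθ
  have hX0 : 0 < X := by linarith
  have hd0 : (0 : ℝ) < d := by exact_mod_cast Nat.pos_of_ne_zero hd
  have hθ0 : 0 < θ := by positivity
  have hθ1 : θ ≤ 1 := Real.rpow_le_one_of_one_le_of_nonpos hX (by rw [neg_nonpos]; positivity)
  have hQ : X ^ (-(1 / (d : ℝ))) = θ ^ 2 := by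
    rw [hθ, ← Real.rpow_natCast, ← Real.rpow_mul hX0.le]
    congr 1
    push_cast
    field_simp
  rw [hQ] at up lw
  set n := ((FF K X (2 * X)).card : ℝ)
  have hn0 : 0 ≤ n := by positivity
  set R := ρ ^ 2 with hR
  clear_value θ n κ R
  have hm : 0 < 1 - θ / 2 := by linarith
  have hm' : 2 - θ ≠ 0 := by linarith
  rw [abs_sub_le_iff]
  constructor
  · have h1 := up (r := θ / 2) (by linarith) (by linarith)
    have e1 : (1 + θ / 2) * ((θ / 2 + 3 * R * θ ^ 2) / (1 - θ / 2)) = (θ / 2) * ((1 + θ / 2) / (1 - θ / 2) * (1 + 6 * R * θ)) := by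
      field_simp
      ring
    rw [e1, mul_pow, ← mul_assoc, mul_right_comm] at h1
    have h2 := le_of_mul_le_mul_right h1 (by positivity)
    have h3 : n ≤ κ * X * (1 + 5 * (42 * R) ^ d * θ) := by
      refine h2.trans ?_
      calc _ = κ * X * ((2 * (1 + θ / 2) ^ d - (1 - θ / 2) ^ d) * ((1 + θ / 2) / (1 - θ / 2) * (1 + 6 * R * θ)) ^ d) := by ring
        _ ≤ _ := mul_le_mul_of_nonneg_left (real_up hR1 hθ0 hθ1) (by positivity)
    linarith
  · by_cases hC : 1 ≤ 5 * (42 * R) ^ d * θ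
    · have := mul_le_mul_of_nonneg_left hC (by positivity : 0 ≤ κ * X)
      linarith
    push Not at hC
    obtain ⟨h0, hlo⟩ := real_lo hd hR1 hθ0 hθ1 hC
    have h1 := lw (r := θ / 2) (by linarith) (by linarith) h0
    have e1 : θ / 2 - 3 * R * θ ^ 2 = (θ / 2 * (1 + θ / 2) / (1 - θ / 2)) * ((1 - θ / 2) / (1 + θ / 2) * (1 - 6 * R * θ)) := by
      field_simp
      ring
    rw [e1, mul_pow, ← mul_assoc, mul_right_comm] at h1
    have h2 := le_of_mul_le_mul_right h1 (by positivity)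
    have h3 : κ * X * (1 - 5 * (42 * R) ^ d * θ) ≤ n := by
      refine le_trans ?_ h2
      refine (mul_le_mul_of_nonneg_left hlo (by positivity)).trans (le_of_eq ?_)
      rw [one_div_pow, one_div_pow]
      ring
    linarith

lemma one_le_nm (c : (Ideal (𝓞 K))⁰) : 1 ≤ nm K c := by
  have := nm_pos c
  unfold nm at this ⊢
  exact_mod_cast this

lemma nm_one : nm K 1 = 1 := by simp [nm]

lemma kap_lower {ρ : ℝ} (hρ : Cov K ρ) : 1 ≤ kap K * (60 * ρ ^ 2) ^ finrank ℚ K := by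
  have hd : finrank ℚ K ≠ 0 := d_pos.ne'
  have h := n_upper hρ (A := 1 / 2) (B := 1) (r := 1 / 2) (by norm_num) (by norm_num) (by norm_num) (by norm_num)
  have hκ := kap_pos K
  have h1 : (1 : ℝ) ≤ (FF K (1 / 2) 1).card := by
    have : (1 : (Ideal (𝓞 K))⁰) ∈ FF K (1 / 2) 1 := by rw [mem_FF, nm_one]; norm_num
    exact_mod_cast Finset.card_pos.2 ⟨_, this⟩
  set d := finrank ℚ K
  have hR : 1 ≤ ρ ^ 2 := one_le_pow₀ hρ.1
  have hq : (1 / 2 : ℝ) ^ (-(1 / (d : ℝ))) ≤ 2 := by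
    rw [Real.rpow_neg (by norm_num), ← Real.inv_rpow (by norm_num)]
    norm_num
    refine (Real.rpow_le_rpow_of_exponent_le (by norm_num : (1 : ℝ) ≤ 2) (?_ : _ ≤ (1 : ℝ))).trans (by norm_num)
    exact inv_le_one_of_one_le₀ (by exact_mod_cast Nat.pos_of_ne_zero hd)
  have h2 : ((1 + 1 / 2) * ((1 / 2 + 3 * ρ ^ 2 * (1 / 2 : ℝ) ^ (-(1 / (d : ℝ)))) / (1 - 1 / 2))) ^ d ≤ (20 * ρ ^ 2) ^ d := by
    refine pow_le_pow_left₀ (by positivity) ?_ _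
    have := mul_le_mul_of_nonneg_left hq (by positivity : 0 ≤ 3 * ρ ^ 2)
    norm_num at this ⊢
    linarith
  have h3 : (1 * (1 + 1 / 2) ^ d - 1 / 2 * (1 - 1 / 2) ^ d : ℝ) ≤ (3 / 2) ^ d := by
    have : (0 : ℝ) < (1 - 1 / 2) ^ d := by positivity
    norm_num at this ⊢
  have h4 : (1 / 2 : ℝ) ^ d ≤ kap K * (3 / 2) ^ d * (20 * ρ ^ 2) ^ d := by
    calc (1 / 2 : ℝ) ^ d ≤ (FF K (1 / 2) 1).card * (1 / 2) ^ d := le_mul_of_one_le_left (by positivity) h1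
      _ ≤ _ := h
      _ ≤ _ := by gcongr
  have h5 := mul_le_mul_of_nonneg_right h4 (by positivity : (0 : ℝ) ≤ 2 ^ d)
  have e1 : (1 / 2 : ℝ) ^ d * 2 ^ d = 1 := by rw [← mul_pow]; norm_num
  rw [e1] at h5
  refine h5.trans (le_of_eq ?_)
  rw [mul_assoc, mul_assoc, ← mul_pow, ← mul_pow]
  congr 2
  ring

lemma NN_one {X : ℝ} (h1 : 1 ≤ X) (h2 : X < 2) : NN K X = 1 := by
  unfold NN
  have : (fin_le K X).toFinset = {1} := by
    ext c
    simp only [Set.Finite.mem_toFinset, Set.mem_ofPred_eq, Finset.mem_singleton]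
    constructor
    · intro h
      have h3 : nm K c < 2 := by linarith
      have h4 := one_le_nm c
      unfold nm at h3 h4
      have h5 : Ideal.absNorm (c : Ideal (𝓞 K)) = 1 := by
        have a1 : Ideal.absNorm (c : Ideal (𝓞 K)) < 2 := by exact_mod_cast h3
        have a2 : 1 ≤ Ideal.absNorm (c : Ideal (𝓞 K)) := by exact_mod_cast h4
        omega
      exact Subtype.ext ((Ideal.absNorm_eq_one_iff.1 h5).trans Ideal.one_eq_top.symm)
    · rintro rfl
      rw [nm_one]; exact h1
  rw [this]; simp

theorem NN_count {ρ : ℝ} (hρ : Cov K ρ) {X : ℝ} (hX : 1 ≤ X) :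
    |NN K X - kap K * X| ≤ kap K * (15 * (60 * ρ ^ 2) ^ finrank ℚ K) * X ^ (1 - 1 / (2 * finrank ℚ K : ℝ)) := by
  have hd : finrank ℚ K ≠ 0 := d_pos.ne'
  have hκ := kap_pos K
  have hR : 1 ≤ ρ ^ 2 := one_le_pow₀ hρ.1
  have hkl := kap_lower hρ
  have nb := fun {X : ℝ} => n_bound hρ (X := X)
  set d := finrank ℚ K
  set κ := kap K
  have hd0 : (1 : ℝ) ≤ d := by exact_mod_cast Nat.pos_of_ne_zero hd
  have hδ : 1 / (2 * d : ℝ) ≤ 1 / 2 := by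
    rw [div_le_div_iff₀ (by positivity) (by norm_num)]; linarith
  have hG : 1 ≤ (60 * ρ ^ 2) ^ d := one_le_pow₀ (by linarith)
  have hG2 : (42 * ρ ^ 2) ^ d ≤ (60 * ρ ^ 2) ^ d := by gcongr; norm_num
  set G := (60 * ρ ^ 2) ^ d
  set G2 := (42 * ρ ^ 2) ^ d
  set e := 1 - 1 / (2 * d : ℝ) with he
  have main : ∀ k : ℕ, ∀ X : ℝ, 1 ≤ X → X < 2 ^ (k + 1) → |NN K X - κ * X| ≤ κ * (15 * G) * X ^ e := by
    intro k
    induction k with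
    | zero =>
      intro X h1 h2
      rw [NN_one h1 (by simpa using h2)]
      have hXe : 1 ≤ X ^ e := Real.one_le_rpow h1 (by rw [he]; linarith)
      have : κ * (15 * G) * 1 ≤ κ * (15 * G) * X ^ e := by gcongr
      rw [zero_add, pow_one] at h2
      rw [abs_sub_le_iff]
      constructor
      · nlinarith
      · nlinarith
    | succ k ih =>
      intro X h1 h2
      by_cases hX2 : X < 2
      · exact ih X h1 (hX2.trans_le (by rw [pow_succ]; nlinarith [one_le_pow₀ (n := k) (by norm_num : (1 : ℝ) ≤ 2)]))
      push Not at hX2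
      have hh : 1 ≤ X / 2 := by linarith
      have i1 := ih (X / 2) hh (by rw [pow_succ] at h2; linarith)
      have i2 := nb hh
      have e1 : 2 * (X / 2) = X := by ring
      rw [e1, FF_card (by linarith)] at i2
      have e2 : X / 2 * (X / 2) ^ (-(1 / (2 * d : ℝ))) = (X / 2) ^ e := by
        nth_rw 1 [← Real.rpow_one (X / 2)]
        rw [← Real.rpow_add (by linarith), he]; rfl
      rw [e2] at i2
      have e3 : X ^ e = 2 ^ e * (X / 2) ^ e := by
        rw [← Real.mul_rpow (by norm_num) (by linarith)]; congr 1; ring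
      have e4 : (7 / 5 : ℝ) ≤ 2 ^ e := by
        refine le_trans ?_ (Real.rpow_le_rpow_of_exponent_le (by norm_num) (by rw [he]; linarith : 1 / 2 ≤ e))
        rw [← Real.sqrt_eq_rpow]
        exact Real.le_sqrt_of_sq_le (by norm_num)
      have e5 : 0 < (X / 2) ^ e := by positivity
      rw [e3]
      set Y := (X / 2) ^ e
      have h3 : |NN K X - κ * X| ≤ κ * (15 * G) * Y + κ * (5 * G2) * Y := by
        have : NN K X - κ * X = (NN K (X / 2) - κ * (X / 2)) + (NN K X - NN K (X / 2) - κ * (X / 2)) := by ring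
        rw [this]
        exact (abs_add_le _ _).trans (add_le_add i1 i2)
      refine h3.trans ?_
      have h4 : κ * (5 * G2) * Y ≤ κ * (5 * G) * Y := by gcongr
      have h5 : κ * (15 * G) * (7 / 5 * Y) ≤ κ * (15 * G) * (2 ^ e * Y) := by gcongr
      have h6 : 0 < κ * G * Y := by positivity
      nlinarith
  obtain ⟨k, hk⟩ := pow_unbounded_of_one_lt X (by norm_num : (1 : ℝ) < 2)
  exact main k X hX (hk.trans (by rw [pow_succ]; nlinarith [one_le_pow₀ (n := k) (by norm_num : (1 : ℝ) ≤ 2)]))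
end NF

namespace NF
open NumberField nonZeroDivisors Module Filter Topology UniqueFactorizationMonoid

variable {K : Type*} [Field K] [NumberField K]

variable (K) in
noncomputable def IdN (n : ℕ) : Finset (Ideal (𝓞 K)) := (Ideal.finite_setOfPred_absNorm_eq (S := 𝓞 K) n).toFinset
variable (K) in
noncomputable def PrN (n : ℕ) : Finset (Ideal (𝓞 K)) := (Ideal.finite_setOfPred_absNorm_le (S := 𝓞 K) n).toFinset.filter Prime
variable (K) in
noncomputable def cK (n : ℕ) : ℝ := if n = 0 then 0 else (IdN K n).card
variable (K) in
noncomputable def LK (n : ℕ) : ℝ := ∑ P ∈ PrN K n, ∑ k ∈ Finset.Icc 1 n, if Ideal.absNorm P ^ k = n then Real.log (Ideal.absNorm P) else 0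

lemma mem_IdN {n : ℕ} {I : Ideal (𝓞 K)} : I ∈ IdN K n ↔ Ideal.absNorm I = n := by simp [IdN]
lemma mem_PrN {n : ℕ} {I : Ideal (𝓞 K)} : I ∈ PrN K n ↔ Ideal.absNorm I ≤ n ∧ Prime I := by simp [PrN]

lemma nP {P : Ideal (𝓞 K)} (hP : Prime P) : 2 ≤ Ideal.absNorm P := by
  have h0 : Ideal.absNorm P ≠ 0 := fun h => hP.ne_zero (Ideal.absNorm_eq_zero_iff.1 h)
  have h1 : Ideal.absNorm P ≠ 1 := fun h => hP.not_unit (Ideal.isUnit_iff.2 (Ideal.absNorm_eq_one_iff.1 h))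
  omega

lemma nP_log {P : Ideal (𝓞 K)} : 0 ≤ Real.log (Ideal.absNorm P) := Real.log_natCast_nonneg _

lemma LK_ext {n m : ℕ} (h : n ≤ m) : LK K n = ∑ P ∈ PrN K m, ∑ k ∈ Finset.Icc 1 m, if Ideal.absNorm P ^ k = n then Real.log (Ideal.absNorm P) else 0 := by
  unfold LK
  have hb : ∀ P : Ideal (𝓞 K), Prime P → ∀ k, 1 ≤ k → Ideal.absNorm P ^ k = n → Ideal.absNorm P ≤ n ∧ k ≤ n := by
    intro P hP k hk h
    have h2 := nP hP
    constructor
    · rw [← h]; exact Nat.le_self_pow (by omega) _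
    · rw [← h]
      exact Nat.lt_two_pow_self.le.trans (Nat.pow_le_pow_left h2 k)
  have hsub : PrN K n ⊆ PrN K m := fun P hP => by
    rw [mem_PrN] at hP ⊢
    exact ⟨hP.1.trans h, hP.2⟩
  rw [← Finset.sum_subset hsub]
  · refine Finset.sum_congr rfl fun P hP => ?_
    refine Finset.sum_subset (Finset.Icc_subset_Icc_right h) fun k hk hk2 => ?_
    rw [if_neg]
    intro he
    rw [Finset.mem_Icc] at hk hk2
    exact hk2 ⟨hk.1, (hb P (mem_PrN.1 hP).2 k hk.1 he).2⟩
  · intro P hP hP2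
    refine Finset.sum_eq_zero fun k hk => ?_
    rw [if_neg]
    intro he
    rw [mem_PrN] at hP hP2
    exact hP2 ⟨(hb P hP.2 k (Finset.mem_Icc.1 hk).1 he).1, hP.2⟩

lemma pow_dvd {P I : Ideal (𝓞 K)} (hP : Prime P) (hI : I ≠ 0) (k : ℕ) : P ^ k ∣ I ↔ k ≤ (normalizedFactors I).count P := by
  rw [dvd_iff_normalizedFactors_le_normalizedFactors (pow_ne_zero _ hP.ne_zero) hI, normalizedFactors_pow,
    normalizedFactors_irreducible hP.irreducible, normalize_eq, Multiset.nsmul_singleton, Multiset.le_count_iff_replicate_le]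

lemma log_ms (s : Multiset (Ideal (𝓞 K))) (h : ∀ P ∈ s, Prime P) :
    Real.log ((Multiset.map Ideal.absNorm s).prod : ℕ) = (Multiset.map (fun P => Real.log (Ideal.absNorm P)) s).sum := by
  induction s using Multiset.induction_on with
  | empty => simp
  | cons P s ih =>
    have h1 := ih fun Q hQ => h Q (Multiset.mem_cons_of_mem hQ)
    have h2 := nP (h P (Multiset.mem_cons_self P s))
    have h3 : (Multiset.map Ideal.absNorm s).prod ≠ 0 := by
      refine Multiset.prod_ne_zero fun h0 => ?_
      obtain ⟨Q, hQ, hQ0⟩ := Multiset.mem_map.1 h0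
      have := nP (h Q (Multiset.mem_cons_of_mem hQ))
      omega
    rw [Multiset.map_cons, Multiset.map_cons, Multiset.prod_cons, Multiset.sum_cons, Nat.cast_mul,
      Real.log_mul (by positivity) (by exact_mod_cast h3), h1]

lemma logN {n : ℕ} (hn : n ≠ 0) {I : Ideal (𝓞 K)} (hI : Ideal.absNorm I = n) :
    Real.log n = ∑ P ∈ PrN K n, ∑ k ∈ Finset.Icc 1 n, if P ^ k ∣ I then Real.log (Ideal.absNorm P) else 0 := by
  have hI0 : I ≠ 0 := by
    rintro rfl
    apply hn
    rw [← hI, Ideal.zero_eq_bot, Ideal.absNorm_bot]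
  have h1 : ∀ P ∈ PrN K n, ∑ k ∈ Finset.Icc 1 n, (if P ^ k ∣ I then Real.log (Ideal.absNorm P) else 0) =
      (normalizedFactors I).count P • Real.log (Ideal.absNorm P) := by
    intro P hP
    have hP := (mem_PrN.1 hP).2
    rw [← Finset.sum_filter, Finset.sum_const]
    congr 1
    have hle : (normalizedFactors I).count P ≤ n := by
      have := (pow_dvd hP hI0 _).2 le_rfl
      have h3 := map_dvd Ideal.absNorm this
      rw [map_pow, hI] at h3
      exact Nat.lt_two_pow_self.le.trans ((Nat.pow_le_pow_left (nP hP) _).trans (Nat.le_of_dvd (Nat.pos_of_ne_zero hn) h3))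
    have : (Finset.Icc 1 n).filter (fun k => P ^ k ∣ I) = Finset.Icc 1 ((normalizedFactors I).count P) := by
      ext k
      simp only [Finset.mem_filter, Finset.mem_Icc, pow_dvd hP hI0]
      omega
    rw [this, Nat.card_Icc]; omega
  rw [Finset.sum_congr rfl h1]
  have h2 : (normalizedFactors I).toFinset ⊆ PrN K n := by
    intro P hP
    rw [Multiset.mem_toFinset] at hP
    rw [mem_PrN]
    refine ⟨?_, prime_of_normalized_factor P hP⟩
    rw [← hI]
    exact Nat.le_of_dvd (by omega) (map_dvd _ (dvd_of_mem_normalizedFactors hP))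
  rw [← Finset.sum_subset h2 fun P _ h => by
    rw [Multiset.mem_toFinset, ← Multiset.count_eq_zero] at h; rw [h, zero_smul]]
  rw [← Finset.sum_multiset_map_count]
  have h3 := congrArg Ideal.absNorm (Ideal.prod_normalizedFactors_eq_self hI0)
  rw [hI, map_multiset_prod] at h3
  rw [← h3]
  exact log_ms _ fun P hP => prime_of_normalized_factor P hP

lemma card_dvd {n : ℕ} (hn : n ≠ 0) {J : Ideal (𝓞 K)} (hJ : J ≠ 0) :
    (((IdN K n).filter (fun I => J ∣ I)).card : ℝ) = ∑ x ∈ n.divisorsAntidiagonal, if Ideal.absNorm J = x.2 then cK K x.1 else 0 := by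
  have hJn : Ideal.absNorm J ≠ 0 := fun h => hJ (Ideal.absNorm_eq_zero_iff.1 h)
  by_cases hd : Ideal.absNorm J ∣ n
  · obtain ⟨m, rfl⟩ := hd
    have hm : m ≠ 0 := right_ne_zero_of_mul hn
    rw [Finset.sum_eq_single (m, Ideal.absNorm J)]
    · rw [if_pos rfl, cK, if_neg hm]
      norm_cast
      rw [← Finset.card_image_of_injective (IdN K m) (mul_right_injective₀ hJ)]
      congr 1
      ext I
      simp only [Finset.mem_filter, mem_IdN, Finset.mem_image]
      constructor
      · rintro ⟨h1, ⟨I', rfl⟩⟩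
        refine ⟨I', ?_, rfl⟩
        rw [map_mul] at h1
        exact Nat.eq_of_mul_eq_mul_left (Nat.pos_of_ne_zero hJn) h1
      · rintro ⟨I', h1, rfl⟩
        exact ⟨by rw [map_mul, h1], dvd_mul_right _ _⟩
    · rintro ⟨u, v⟩ h1 h2
      rw [if_neg]
      rintro rfl
      apply h2
      rw [Nat.mem_divisorsAntidiagonal, mul_comm] at h1
      exact Prod.ext (Nat.eq_of_mul_eq_mul_left (Nat.pos_of_ne_zero hJn) h1.1) rfl
    · intro h
      exact absurd (Nat.mem_divisorsAntidiagonal.2 ⟨mul_comm _ _, hn⟩) h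
  · rw [Finset.sum_eq_zero, Finset.filter_eq_empty_iff.2]
    · simp
    · intro I hI h
      exact hd (by rw [← mem_IdN.1 hI]; exact map_dvd _ h)
    · rintro ⟨u, v⟩ h1
      rw [if_neg]
      rintro rfl
      exact hd ⟨u, by rw [mul_comm]; exact (Nat.mem_divisorsAntidiagonal.1 h1).1.symm⟩

lemma conv_K (n : ℕ) : cK K n * Real.log n = ∑ x ∈ n.divisorsAntidiagonal, cK K x.1 * LK K x.2 := by
  by_cases hn : n = 0
  · subst hn; simp
  have e1 : cK K n * Real.log n = ∑ P ∈ PrN K n, ∑ k ∈ Finset.Icc 1 n, Real.log (Ideal.absNorm P) * ((IdN K n).filter (fun I => P ^ k ∣ I)).card := by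
    rw [cK, if_neg hn, ← nsmul_eq_mul, ← Finset.sum_const, Finset.sum_congr rfl fun I hI => logN hn (mem_IdN.1 hI), Finset.sum_comm]
    refine Finset.sum_congr rfl fun P _ => ?_
    rw [Finset.sum_comm]
    refine Finset.sum_congr rfl fun k _ => ?_
    rw [← Finset.sum_filter, Finset.sum_const, nsmul_eq_mul, mul_comm]
  have e2 : ∀ x ∈ n.divisorsAntidiagonal, cK K x.1 * LK K x.2 = ∑ P ∈ PrN K n, ∑ k ∈ Finset.Icc 1 n, Real.log (Ideal.absNorm P) * (if Ideal.absNorm (P ^ k) = x.2 then cK K x.1 else 0) := by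
    intro x hx
    have : x.2 ≤ n := Nat.divisor_le (Nat.snd_mem_divisors_of_mem_antidiagonal hx)
    rw [LK_ext this, Finset.mul_sum]
    refine Finset.sum_congr rfl fun P _ => ?_
    rw [Finset.mul_sum]
    refine Finset.sum_congr rfl fun k _ => ?_
    rw [map_pow]
    split_ifs <;> ring
  rw [e1, Finset.sum_congr rfl e2, Finset.sum_comm (s := n.divisorsAntidiagonal)]
  refine Finset.sum_congr rfl fun P hP => ?_
  rw [Finset.sum_comm (s := n.divisorsAntidiagonal)]
  refine Finset.sum_congr rfl fun k _ => ?_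
  rw [← Finset.mul_sum, card_dvd hn (pow_ne_zero _ (mem_PrN.1 hP).2.ne_zero)]

lemma LK_nonneg (n : ℕ) : 0 ≤ LK K n := by
  refine Finset.sum_nonneg fun P _ => Finset.sum_nonneg fun k _ => ?_
  split_ifs
  · exact nP_log
  · exact le_rfl

lemma pr1 {P : Ideal (𝓞 K)} (hP : Prime P) : ∃ q : ℕ, q.Prime ∧ (q : 𝓞 K) ∈ P ∧ ∃ f, Ideal.absNorm P = q ^ f := by
  have := Ideal.isPrime_of_prime hP
  have : NeZero P := ⟨hP.ne_zero⟩
  have hq := Nat.absNorm_under_prime P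
  have hm := Int.absNorm_under_mem P
  refine ⟨_, hq, hm, ?_⟩
  have h1 : P ∣ Ideal.span {((Ideal.absNorm (Ideal.under ℤ P) : ℕ) : 𝓞 K)} := by
    rw [Ideal.dvd_span_singleton]; exact hm
  have h2 := map_dvd Ideal.absNorm h1
  rw [Ideal.absNorm_span_natCast] at h2
  obtain ⟨f, -, hf⟩ := (Nat.dvd_prime_pow hq).1 h2
  exact ⟨f, hf⟩

lemma LK_le (n : ℕ) : LK K n ≤ finrank ℚ K * ArithmeticFunction.vonMangoldt n := by
  set T := (PrN K n).filter (fun P => ∃ k, 1 ≤ k ∧ Ideal.absNorm P ^ k = n) with hT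
  have h1 : LK K n ≤ ∑ P ∈ T, Real.log (Ideal.absNorm P) := by
    rw [hT, Finset.sum_filter]
    refine Finset.sum_le_sum fun P hP => ?_
    have h2 := nP (mem_PrN.1 hP).2
    split_ifs with h
    · obtain ⟨k, hk, hk2⟩ := h
      rw [← Finset.sum_filter, Finset.sum_const]
      have : ((Finset.Icc 1 n).filter (fun k => Ideal.absNorm P ^ k = n)).card ≤ 1 := by
        rw [Finset.card_le_one]
        intro u hu v hv
        rw [Finset.mem_filter] at hu hv
        exact Nat.pow_right_injective h2 (hu.2.trans hv.2.symm)
      rw [nsmul_eq_mul]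
      have h3 : (((Finset.Icc 1 n).filter (fun k => Ideal.absNorm P ^ k = n)).card : ℝ) ≤ 1 := by exact_mod_cast this
      exact mul_le_of_le_one_left nP_log h3
    · refine (Finset.sum_eq_zero fun k hk => if_neg fun he => h ⟨k, (Finset.mem_Icc.1 hk).1, he⟩).le
  refine h1.trans ?_
  rcases T.eq_empty_or_nonempty with h | ⟨P0, h0⟩
  · rw [h, Finset.sum_empty]
    have := ArithmeticFunction.vonMangoldt_nonneg (n := n)
    positivity
  rw [hT, Finset.mem_filter, mem_PrN] at h0
  obtain ⟨⟨-, hP0⟩, k0, hk0, hn⟩ := h0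
  obtain ⟨p, hp, -, f0, hf0⟩ := pr1 hP0
  have hnp : n = p ^ (f0 * k0) := by rw [← hn, hf0, pow_mul]
  have hfk : f0 * k0 ≠ 0 := by
    intro h
    have h2 := nP hP0
    rcases Nat.mul_eq_zero.1 h with h | h
    · rw [hf0, h] at h2; simp at h2
    · omega
  have hv : ArithmeticFunction.vonMangoldt n = Real.log p := by
    rw [hnp, ArithmeticFunction.vonMangoldt_apply_pow hfk, ArithmeticFunction.vonMangoldt_apply_prime hp]
  rw [hv]
  have hdv : ∏ P ∈ T, P ∣ Ideal.span {(p : 𝓞 K)} := by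
    refine Finset.prod_primes_dvd _ (fun P hP => ?_) (fun P hP => ?_)
    · rw [hT, Finset.mem_filter, mem_PrN] at hP
      exact hP.1.2
    · rw [hT, Finset.mem_filter, mem_PrN] at hP
      obtain ⟨⟨-, hP⟩, k, hk, hkn⟩ := hP
      rw [Ideal.dvd_span_singleton]
      have := Ideal.isPrime_of_prime hP
      have h2 := Ideal.absNorm_mem P
      have h3 : ((n : ℕ) : 𝓞 K) ∈ P := by
        rw [← hkn]
        push_cast
        exact Ideal.pow_mem_of_mem P h2 k hk
      rw [hnp] at h3
      push_cast at h3
      exact this.mem_of_pow_mem _ h3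
  have h5 := map_dvd Ideal.absNorm hdv
  rw [Ideal.absNorm_span_natCast, map_prod, RingOfIntegers.rank] at h5
  have h6 : ((∏ P ∈ T, Ideal.absNorm P : ℕ) : ℝ) ≤ (p : ℝ) ^ finrank ℚ K := by
    exact_mod_cast Nat.le_of_dvd (pow_pos hp.pos _) h5
  rw [← Real.log_pow, ← Real.log_prod fun P hP => by
    rw [hT, Finset.mem_filter, mem_PrN] at hP
    have := nP hP.1.2
    positivity]
  push_cast at h6
  refine Real.log_le_log (Finset.prod_pos fun P hP => ?_) h6
  rw [hT, Finset.mem_filter, mem_PrN] at hP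
  have := nP hP.1.2
  positivity

lemma LK_prime {p : ℕ} (hp : p.Prime) : LK K p = ((IdN K p).card : ℝ) * Real.log p := by
  have h1 : IdN K p ⊆ PrN K p := fun P hP => by
    rw [mem_IdN] at hP
    have h2 : P ≠ ⊥ := by
      rintro rfl
      rw [Ideal.absNorm_bot] at hP
      exact hp.ne_zero hP.symm
    exact mem_PrN.2 ⟨hP.le, (Ideal.prime_iff_isPrime h2).2 (Ideal.isPrime_of_irreducible_absNorm (by rw [hP]; exact hp))⟩
  unfold LK
  rw [← Finset.sum_subset h1, ← nsmul_eq_mul, ← Finset.sum_const]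
  · refine Finset.sum_congr rfl fun P hP => ?_
    have hPn := mem_IdN.1 hP
    rw [Finset.sum_eq_single 1]
    · rw [pow_one, if_pos hPn, hPn]
    · intro k hk hk1
      rw [if_neg]
      rw [hPn]
      intro h
      exact hk1 (Nat.pow_right_injective hp.two_le (h.trans (pow_one p).symm))
    · intro h
      exact absurd (Finset.mem_Icc.2 ⟨le_rfl, hp.one_lt.le⟩) h
  · intro P hP hP2
    refine Finset.sum_eq_zero fun k hk => ?_
    rw [if_neg]
    intro h
    apply hP2
    rw [mem_IdN]
    have hk1 := (Finset.mem_Icc.1 hk).1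
    have h3 : Ideal.absNorm P ∣ p := ⟨_, by rw [← h]; exact (mul_pow_sub_one (by omega) _).symm⟩
    rcases (Nat.dvd_prime hp).1 h3 with h4 | h4
    · have := nP (mem_PrN.1 hP).2
      omega
    · exact h4

lemma NN_eq {X : ℝ} (hX : 0 ≤ X) : ∑ n ∈ Finset.Icc 1 ⌊X⌋₊, cK K n = NN K X := by
  have h1 : ∀ n ∈ Finset.Icc 1 ⌊X⌋₊, cK K n = (IdN K n).card := fun n hn => by
    rw [cK, if_neg]; have := (Finset.mem_Icc.1 hn).1; omega
  rw [Finset.sum_congr rfl h1, NN]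
  norm_cast
  rw [← Finset.card_biUnion]
  · symm
    refine Finset.card_nbij (fun c => (c : Ideal (𝓞 K))) (fun c hc => ?_) (fun a _ b _ h => Subtype.ext h) (fun I hI => ?_)
    · have hc2 : nm K c ≤ X := by simpa using hc
      simp only [Finset.mem_coe, Finset.mem_biUnion, mem_IdN, Finset.mem_Icc]
      refine ⟨_, ⟨?_, Nat.le_floor hc2⟩, rfl⟩
      have := one_le_nm c
      unfold nm at this
      exact_mod_cast this
    · simp only [Finset.mem_coe, Finset.mem_biUnion, mem_IdN, Finset.mem_Icc] at hI
      obtain ⟨n, ⟨h1, h2⟩, h3⟩ := hI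
      have hI0 : I ≠ ⊥ := by
        rintro rfl
        rw [Ideal.absNorm_bot] at h3
        omega
      refine ⟨⟨I, mem_nonZeroDivisors_of_ne_zero hI0⟩, ?_, rfl⟩
      simp only [Finset.mem_coe, Set.Finite.mem_toFinset, Set.mem_ofPred_eq, nm, h3]
      exact (Nat.le_floor_iff hX).1 h2
  · intro m _ n _ hmn
    change Disjoint _ _
    rw [Finset.disjoint_left]
    intro I h1 h2
    rw [mem_IdN] at h1 h2
    exact hmn (h1.symm.trans h2)

theorem zdata {ρ : ℝ} (hρ : Cov K ρ) : ZData (cK K) (LK K) (finrank ℚ K) (kap K) (15 * (60 * ρ ^ 2) ^ finrank ℚ K) (1 / (2 * finrank ℚ K : ℝ)) where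
  c_nonneg n := by unfold cK; split_ifs <;> positivity
  c_zero := by simp [cK]
  c_one := by
    have : IdN K 1 = {⊤} := by
      ext I
      rw [mem_IdN, Ideal.absNorm_eq_one_iff, Finset.mem_singleton]
    simp [cK, this]
  L_nonneg := LK_nonneg
  L_le := LK_le
  conv := conv_K
  κ_pos := kap_pos K
  one_le_C := by
    have hR : 1 ≤ ρ ^ 2 := one_le_pow₀ hρ.1
    have : 1 ≤ (60 * ρ ^ 2) ^ finrank ℚ K := one_le_pow₀ (by linarith)
    linarith
  δ_pos := by have := d_pos (K := K); positivity
  δ_le := by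
    have : (1 : ℝ) ≤ finrank ℚ K := by exact_mod_cast d_pos (K := K)
    rw [div_le_div_iff₀ (by positivity) (by norm_num)]; linarith
  d_pos := d_pos
  count X hX := by rw [NN_eq (by linarith)]; exact NN_count hρ hX
end NF

namespace NF
open NumberField nonZeroDivisors Module Filter Topology

variable {K : Type*} [Field K] [NumberField K]

lemma norm_le {x : K} {H : ℝ} (h : ∀ w : InfinitePlace K, w x ≤ H) : ‖mixedEmbedding K x‖ ≤ H := by
  rw [mixedEmbedding.norm_eq_sup'_normAtPlace, Finset.sup'_le_iff]
  simpa only [Finset.mem_univ, forall_const, mixedEmbedding.normAtPlace_apply] using h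

lemma cov_of {ι : Type*} [Fintype ι] (ω : ι → 𝓞 K) (hs : Submodule.span ℚ (Set.range fun i => (ω i : K)) = ⊤) {H : ℝ}
    (hH : ∀ i, ∀ w : InfinitePlace K, w (ω i : K) ≤ H) (h1 : 1 ≤ Fintype.card ι * H) : Cov K (Fintype.card ι * H) := by
  refine ⟨h1, fun z => ?_⟩
  have hspan : Submodule.span ℝ (Set.range fun i => mixedEmbedding K (ω i : K)) = ⊤ := by
    rw [eq_top_iff, ← (mixedEmbedding.latticeBasis K).span_eq, Submodule.span_le]
    rintro _ ⟨j, rfl⟩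
    rw [mixedEmbedding.latticeBasis_apply]
    have : integralBasis K j ∈ Submodule.span ℚ (Set.range fun i => (ω i : K)) := by rw [hs]; trivial
    obtain ⟨c, hc⟩ := (Submodule.mem_span_range_iff_exists_fun ℚ).1 this
    rw [← hc, map_sum]
    refine Submodule.sum_mem _ fun i _ => ?_
    have e : mixedEmbedding K (c i • (ω i : K)) = (c i : ℝ) • mixedEmbedding K (ω i : K) := by
      rw [map_rat_smul (mixedEmbedding K)]
      rw [← Rat.cast_smul_eq_qsmul ℝ]
    rw [e]
    exact Submodule.smul_mem _ _ (Submodule.subset_span ⟨i, rfl⟩)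
  have hz : z ∈ Submodule.span ℝ (Set.range fun i => mixedEmbedding K (ω i : K)) := by rw [hspan]; trivial
  obtain ⟨c, rfl⟩ := (Submodule.mem_span_range_iff_exists_fun ℝ).1 hz
  refine ⟨∑ i, ⌊c i⌋ • ω i, ?_⟩
  have e : ∑ i, c i • mixedEmbedding K (ω i : K) - mixedEmbedding K ((∑ i, ⌊c i⌋ • ω i : 𝓞 K) : K) = ∑ i, Int.fract (c i) • mixedEmbedding K (ω i : K) := by
    have e1 : ((∑ i, ⌊c i⌋ • ω i : 𝓞 K) : K) = ∑ i, ⌊c i⌋ • (ω i : K) := by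
      simp [zsmul_eq_mul]
    rw [e1, map_sum, ← Finset.sum_sub_distrib]
    refine Finset.sum_congr rfl fun i _ => ?_
    rw [map_zsmul, ← Int.cast_smul_eq_zsmul ℝ, ← sub_smul]
    rfl
  rw [e]
  refine (norm_sum_le _ _).trans ?_
  rw [← nsmul_eq_mul]
  refine Finset.sum_le_card_nsmul _ _ _ fun i _ => ?_
  rw [norm_smul, Real.norm_of_nonneg (Int.fract_nonneg _)]
  have := norm_le (hH i)
  calc _ ≤ 1 * H := mul_le_mul (Int.fract_lt_one _).le this (norm_nonneg _) zero_le_one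
    _ = H := one_mul H

variable (K) in
lemma exists_cov : ∃ ρ, Cov K ρ := by
  obtain ⟨H, hH⟩ : ∃ H : ℝ, ∀ x : (Free.ChooseBasisIndex ℤ (𝓞 K)) × (InfinitePlace K), x.2 (RingOfIntegers.basis K x.1 : K) ≤ H := by
    obtain ⟨H, hH⟩ := (Set.finite_range fun x : (Free.ChooseBasisIndex ℤ (𝓞 K)) × (InfinitePlace K) => x.2 (RingOfIntegers.basis K x.1 : K)).bddAbove
    exact ⟨H, fun x => hH ⟨x, rfl⟩⟩
  refine ⟨_, cov_of (RingOfIntegers.basis K) ?_ (H := max H 1) (fun i w => (hH (i, w)).trans (le_max_left _ _)) ?_⟩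
  · have : (fun i => ((RingOfIntegers.basis K i : 𝓞 K) : K)) = integralBasis K := by
      ext i; rw [integralBasis_apply]
    rw [this]
    exact (integralBasis K).span_eq
  · have h : 0 < Fintype.card (Free.ChooseBasisIndex ℤ (𝓞 K)) := by
      rw [← finrank_eq_card_chooseBasisIndex, RingOfIntegers.rank]; exact d_pos
    have h2 : (1 : ℝ) ≤ Fintype.card (Free.ChooseBasisIndex ℤ (𝓞 K)) := by exact_mod_cast h
    nlinarith [le_max_right H 1]
end NF

namespace NF
open NumberField Module Polynomial

lemma ext_hom {A B F : Type*} [CommRing A] [CommRing B] [Field F] (φ : A →+* B) (ψ : A →+* F)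
    (hker : ∀ x, φ x = 0 → ψ x = 0) {m : ℤ} (hm : (m : F) ≠ 0) (h : ∀ b, ∃ x, φ x = m * b) :
    ∃ f : B →+* F, ∀ x, f (φ x) = ψ x := by
  choose s hs using h
  have key : ∀ x y, φ x = φ y → ψ x = ψ y := fun x y e => by
    have := hker (x - y) (by rw [map_sub, e, sub_self])
    rwa [map_sub, sub_eq_zero] at this
  have hms : ∀ x, ψ (s (φ x)) = m * ψ x := fun x => by
    have : ψ (s (φ x)) = ψ (m * x) := key _ _ (by rw [hs, map_mul, map_intCast])
    rw [this, map_mul, map_intCast]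
  refine ⟨{ toFun := fun b => ψ (s b) / m, map_one' := ?_, map_mul' := ?_, map_zero' := ?_, map_add' := ?_ }, fun x => ?_⟩
  · have := hms 1
    rw [map_one, map_one, mul_one] at this
    rw [this, div_self hm]
  · intro x y
    have : ψ (m * s (x * y)) = ψ (s x * s y) := key _ _ (by rw [map_mul, map_mul, hs, hs, hs, map_intCast]; ring)
    rw [map_mul, map_mul, map_intCast] at this
    rw [div_mul_div_comm, ← this, mul_div_mul_left _ _ hm]
  · rw [hker _ (by rw [hs, mul_zero]), zero_div]
  · intro x y
    have : ψ (s (x + y)) = ψ (s x + s y) := key _ _ (by rw [map_add, hs, hs, hs]; ring)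
    rw [this, map_add, add_div]
  · change ψ (s (φ x)) / m = ψ x
    rw [hms, mul_div_cancel_left₀ _ hm]

section nu
variable (K : Type*) [Field K] [NumberField K]

lemma ker_norm {p : ℕ} (f : 𝓞 K →+* ZMod p) : Ideal.absNorm (RingHom.ker f) = p := by
  rw [Ideal.absNorm_apply, Submodule.cardQuot_apply]
  have := Nat.card_congr (RingHom.quotientKerEquivOfSurjective (ZMod.ringHom_surjective f)).toEquiv
  rw [Nat.card_zmod] at this
  exact this

lemma nu_card {p : ℕ} (hp : p.Prime) : (IdN K p).card = Nat.card (𝓞 K →+* ZMod p) := by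
  have h := Nat.card_eq_of_bijective (fun f : 𝓞 K →+* ZMod p => (⟨RingHom.ker f, mem_IdN.2 (ker_norm K f)⟩ : {I // I ∈ IdN K p})) ?_
  · rw [h, Nat.card_eq_fintype_card, Fintype.card_coe]
  constructor
  · intro f g e
    have e1 : RingHom.ker f = RingHom.ker g := congrArg Subtype.val e
    ext1 x
    obtain ⟨c, hc⟩ := ZMod.intCast_surjective (f x)
    have h1 : x - (c : 𝓞 K) ∈ RingHom.ker f := by rw [RingHom.mem_ker, map_sub, map_intCast, hc, sub_self]
    rw [e1, RingHom.mem_ker, map_sub, map_intCast, hc, sub_eq_zero] at h1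
    exact h1.symm
  · rintro ⟨I, hI⟩
    rw [mem_IdN] at hI
    have hc : Nat.card (𝓞 K ⧸ I) = p := by rw [← hI, Ideal.absNorm_apply, Submodule.cardQuot_apply]
    have : Finite (𝓞 K ⧸ I) := Nat.finite_of_card_ne_zero (by rw [hc]; exact hp.ne_zero)
    have : Fintype (𝓞 K ⧸ I) := Fintype.ofFinite _
    rw [Nat.card_eq_fintype_card] at hc
    refine ⟨(ZMod.ringEquivOfPrime (𝓞 K ⧸ I) hp hc).symm.toRingHom.comp (Ideal.Quotient.mk I), ?_⟩
    apply Subtype.ext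
    ext x
    simp [RingHom.mem_ker, Ideal.Quotient.eq_zero_iff_mem]

variable {K} {E : Type*} [Field E] [NumberField E] [Algebra E K]

lemma discr_pow (B : PowerBasis E K) {n : ℕ} {b : ℤ} (hn : 0 < n) (hB : minpoly E B.gen = X ^ n - C (b : E)) :
    ∃ ε : ℤ, Algebra.discr E B.basis = ((ε * ((n : ℤ) ^ n * b ^ (n - 1)) : ℤ) : E) ∧ ε ^ 2 = 1 := by
  have hd : finrank E K = n := by
    rw [B.finrank, ← B.natDegree_minpoly, hB, natDegree_X_pow_sub_C]
  rw [Algebra.discr_powerBasis_eq_norm, hB]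
  simp only [derivative_sub, derivative_X_pow, derivative_C, sub_zero, map_mul, map_pow, aeval_X]
  rw [Algebra.PowerBasis.norm_gen_eq_coeff_zero_minpoly, hB, hd]
  have h1 : (X ^ n - C (b : E)).coeff 0 = - (b : E) := by
    rw [coeff_sub, coeff_X_pow, if_neg hn.ne, coeff_C_zero, zero_sub]
  have h2 : Algebra.norm E (n : K) = (n : E) ^ n := by
    rw [← map_natCast (algebraMap E K), Algebra.norm_algebraMap, hd]
  have h3 : aeval B.gen (C (n : E)) = (n : K) := by simp
  rw [h1, h3, h2]
  refine ⟨(-1) ^ (n * (n - 1) / 2) * ((-1) ^ (B.dim * (n - 1)) * (-1) ^ (n - 1)), ?_, ?_⟩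
  · push_cast
    rw [mul_pow, neg_pow (b : E), ← pow_mul]
    ring
  · rw [mul_pow, mul_pow, ← pow_mul, ← pow_mul, ← pow_mul, mul_comm _ 2, mul_comm _ 2, mul_comm _ 2, pow_mul, pow_mul, pow_mul]
    simp

lemma nu_rel (B : PowerBasis E K) {n : ℕ} {b : ℤ} (hn : 0 < n) (hB : minpoly E B.gen = X ^ n - C (b : E))
    {p : ℕ} (hp : p.Prime) (hpn : ¬ p ∣ n) (hpb : ¬ (p : ℤ) ∣ b) :
    (IdN K p).card = (IdN E p).card * Nat.card {η : ZMod p // η ^ n = b} := by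
  have := Fact.mk hp
  rw [nu_card K hp, nu_card E hp, ← Nat.card_prod]
  have hy : B.gen ^ n = (b : K) := by
    have := minpoly.aeval E B.gen
    rw [hB, map_sub, map_pow, aeval_X, sub_eq_zero] at this
    rw [this]; simp
  have hint : IsIntegral ℤ B.gen := by
    refine IsIntegral.of_pow hn ?_
    rw [hy]
    exact isIntegral_algebraMap (R := ℤ) (x := b)
  set y : 𝓞 K := ⟨B.gen, hint⟩ with hydef
  have hyc : algebraMap (𝓞 K) K y = B.gen := rfl
  have hyn : y ^ n = (b : 𝓞 K) := by
    apply RingOfIntegers.coe_injective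
    rw [map_pow, map_intCast, hyc, hy]
  have hiE : IsIntegral (𝓞 E) y := Algebra.IsIntegral.isIntegral y
  have hmin : minpoly (𝓞 E) y = X ^ n - C (b : 𝓞 E) := by
    apply Polynomial.map_injective (algebraMap (𝓞 E) E) RingOfIntegers.coe_injective
    rw [← minpoly.isIntegrallyClosed_eq_field_fractions E K hiE, hyc, hB]
    simp
  obtain ⟨ε, hε, hε1⟩ := discr_pow B hn hB
  set m : ℤ := ε * ((n : ℤ) ^ n * b ^ (n - 1)) with hmdef
  have hm : (m : ZMod p) ≠ 0 := by
    rw [Ne, ZMod.intCast_zmod_eq_zero_iff_dvd, hmdef]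
    have hpp := Nat.prime_iff_prime_int.1 hp
    intro h
    rcases hpp.dvd_or_dvd h with h | h
    · have := (hpp.dvd_pow_iff_dvd two_ne_zero).2 h
      rw [hε1] at this
      exact hpp.not_dvd_one this
    rcases hpp.dvd_or_dvd h with h | h
    · exact hpn (by exact_mod_cast hpp.dvd_of_dvd_pow h)
    · exact hpb (hpp.dvd_of_dvd_pow h)
  have hex : ∀ z : 𝓞 K, ∃ P : (𝓞 E)[X], (aeval y).toRingHom P = (m : 𝓞 K) * z := fun z => by
    have hz : IsIntegral (𝓞 E) (z : K) := (Algebra.IsIntegral.isIntegral (R := 𝓞 E) z).map (IsScalarTower.toAlgHom (𝓞 E) (𝓞 K) K)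
    have hg : IsIntegral (𝓞 E) B.gen := hiE.map (IsScalarTower.toAlgHom (𝓞 E) (𝓞 K) K)
    have := Algebra.discr_mul_isIntegral_mem_adjoin E hg hz
    rw [Algebra.adjoin_singleton_eq_range_aeval, hε] at this
    obtain ⟨P, hP⟩ := this
    refine ⟨P, RingOfIntegers.coe_injective ?_⟩
    change algebraMap (𝓞 K) K (aeval y P) = _
    rw [← aeval_algebraMap_apply, hyc]
    refine Eq.trans hP ?_
    rw [map_mul, map_intCast, Algebra.smul_def, map_intCast]
  refine Nat.card_eq_of_bijective (fun f => (f.comp (algebraMap (𝓞 E) (𝓞 K)), ⟨f y, ?_⟩)) ⟨?_, ?_⟩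
  · rw [← map_pow, hyn, map_intCast]
  · intro f g e
    have e1 := (Prod.ext_iff.1 e).1
    have e2 : f y = g y := congrArg Subtype.val (Prod.ext_iff.1 e).2
    ext1 z
    obtain ⟨P, hP⟩ := hex z
    have e3 : f.comp (aeval y : (𝓞 E)[X] →ₐ[𝓞 E] 𝓞 K).toRingHom = g.comp (aeval y : (𝓞 E)[X] →ₐ[𝓞 E] 𝓞 K).toRingHom := by
      apply Polynomial.ringHom_ext
      · intro c
        simpa using RingHom.congr_fun e1 c
      · simpa using e2
    have e4 := RingHom.congr_fun e3 P
    rw [RingHom.comp_apply, RingHom.comp_apply, hP, map_mul, map_mul, map_intCast, map_intCast] at e4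
    exact mul_left_cancel₀ hm e4
  · rintro ⟨g, η, hη⟩
    obtain ⟨f, hf⟩ := ext_hom (aeval y : (𝓞 E)[X] →ₐ[𝓞 E] 𝓞 K).toRingHom (eval₂RingHom g η) (fun P hP => by
      have h1 : aeval y P = 0 := hP
      obtain ⟨Q, rfl⟩ := minpoly.isIntegrallyClosed_dvd hiE h1
      rw [hmin, map_mul]
      have : eval₂RingHom g η (X ^ n - C (b : 𝓞 E)) = 0 := by
        rw [map_sub, map_pow, coe_eval₂RingHom, eval₂_X, eval₂_C, map_intCast, hη, sub_self]
      rw [this, zero_mul]) hm hex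
    refine ⟨f, ?_⟩
    have h1 : f y = η := by simpa using hf X
    have h2 : f.comp (algebraMap (𝓞 E) (𝓞 K)) = g := by
      ext1 c
      simpa using hf (C c)
    simp [h1, h2]

lemma nu_rat {p : ℕ} (hp : p.Prime) : (IdN ℚ p).card = 1 := by
  rw [nu_card ℚ hp, Nat.card_eq_one_iff_unique]
  refine ⟨⟨fun f g => ?_⟩, ⟨(Int.castRingHom (ZMod p)).comp Rat.ringOfIntegersEquiv.toRingHom⟩⟩
  have : f.comp Rat.ringOfIntegersEquiv.symm.toRingHom = g.comp Rat.ringOfIntegersEquiv.symm.toRingHom := RingHom.ext_int _ _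
  ext1 x
  have h : f (Rat.ringOfIntegersEquiv.symm (Rat.ringOfIntegersEquiv x)) = g (Rat.ringOfIntegersEquiv.symm (Rat.ringOfIntegersEquiv x)) := RingHom.congr_fun this (Rat.ringOfIntegersEquiv x)
  rwa [RingEquiv.symm_apply_apply] at h
end nu
end NF

namespace NF
open NumberField Module Polynomial

lemma exists_rt (E : Type) [Field E] [NumberField E] {n : ℕ} {b : ℤ} (hn : 0 < n) (h : Irreducible (X ^ n - C (b : E))) :
    ∃ (K : Type) (_ : Field K) (_ : NumberField K) (_ : Algebra E K) (B : PowerBasis E K), minpoly E B.gen = X ^ n - C (b : E) := by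
  have := Fact.mk h
  have hne : (X ^ n - C (b : E)) ≠ 0 := h.ne_zero
  have hm : (X ^ n - C (b : E)).Monic := monic_X_pow_sub_C _ hn.ne'
  have : Module.Finite E (AdjoinRoot (X ^ n - C (b : E))) := (AdjoinRoot.powerBasis hne).finite
  refine ⟨AdjoinRoot (X ^ n - C (b : E)), inferInstance, NumberField.of_module_finite E _, inferInstance, AdjoinRoot.powerBasis hne, ?_⟩
  rw [AdjoinRoot.minpoly_powerBasis_gen_of_monic hm]

lemma irr_pow (i : ℕ) : ∀ {F : Type} [Field F] {a : F}, (i ≤ 1 ∨ ∃ s : F, s ^ 2 = -1) → (∀ s : F, s ^ 2 ≠ a) → Irreducible (X ^ (2 ^ i) - C a) := by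
  induction i with
  | zero => intro F _ a _ _; simpa using irreducible_X_sub_C a
  | succ i ih =>
    intro F _ a h ha
    have h2 : Irreducible (X ^ 2 - C a) := X_pow_sub_C_irreducible_of_prime Nat.prime_two ha
    rw [pow_succ]
    apply X_pow_mul_sub_C_irreducible h2
    intro E _ _ x hx
    have : IsIntegral F x := not_not.mp fun h ↦ by
      simpa only [degree_zero, degree_X_pow_sub_C two_pos,
        WithBot.natCast_ne_bot] using congr_arg degree (hx.symm.trans (dif_neg h))
    rcases Nat.eq_zero_or_pos i with rfl | hi
    · simpa using irreducible_X_sub_C _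
    obtain ⟨s, hs⟩ := h.resolve_left (by omega)
    refine ih (Or.inr ⟨algebraMap _ _ s, by rw [← map_pow, hs, map_neg, map_one]⟩) ?_
    intro b hb
    have h3 : Algebra.norm F b ^ 2 = - a := by
      rw [← map_pow, hb, ← IntermediateField.adjoin.powerBasis_gen this,
        Algebra.PowerBasis.norm_gen_eq_coeff_zero_minpoly]
      simp [hx, IntermediateField.minpoly_gen, IntermediateField.adjoin.powerBasis_dim]
    apply ha (s * Algebra.norm F b)
    rw [mul_pow, hs, h3]; ring

lemma not_sq {a : ℕ} (hsf : Squarefree a) (ha : 3 ≤ a) (j : ℕ) {K : Type} [Field K] [NumberField K]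
    [IsCyclotomicExtension {2 ^ j} ℚ K] (s : K) : s ^ 2 ≠ ((a : ℤ) : K) := by
  intro hs
  obtain ⟨q, hq, hqa, hq2⟩ : ∃ q, q.Prime ∧ q ∣ a ∧ q ≠ 2 := by
    by_contra! h
    have : ∀ q, q.Prime → q ∣ a → q = 2 := h
    have h2 := Nat.eq_prime_pow_of_unique_prime_dvd (by omega : a ≠ 0) (fun {d} hd hda => this d hd hda)
    set e := a.primeFactorsList.length
    rcases Nat.lt_or_ge e 2 with he | he
    · interval_cases e <;> omega
    · have := hsf 2 (by rw [h2, ← pow_two]; exact pow_dvd_pow 2 he)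
      simp at this
  obtain ⟨a', rfl⟩ := hqa
  have hcop : Nat.Coprime q a' := (Nat.squarefree_mul_iff.1 hsf).1
  have hqF := Fact.mk hq
  have hint : IsIntegral ℤ s := by
    refine IsIntegral.of_pow two_pos ?_
    rw [hs]
    exact isIntegral_algebraMap (R := ℤ)
  set t : 𝓞 K := ⟨s, hint⟩
  have ht : t ^ 2 = ((q * a' : ℕ) : 𝓞 K) := by
    apply RingOfIntegers.coe_injective
    rw [map_pow, map_natCast]
    exact hs.trans (by push_cast; rfl)
  obtain ⟨P, hP, hPq⟩ : ∃ P : Ideal (𝓞 K), P.IsMaximal ∧ P.LiesOver (Ideal.span {(q : ℤ)}) := by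
    have : (Ideal.span {(q : ℤ)}).IsMaximal :=
      Ideal.IsPrime.isMaximal ((Ideal.span_singleton_prime (by exact_mod_cast hq.ne_zero)).2 (Nat.prime_iff_prime_int.1 hq))
        (by simpa using hq.ne_zero)
    exact Ideal.exists_maximal_ideal_liesOver_of_isIntegral _
  have h1 := IsCyclotomicExtension.Rat.ramificationIdx_eq_of_not_dvd (m := 2 ^ j) q K P
    (fun h => hq2 ((Nat.prime_dvd_prime_iff_eq hq Nat.prime_two).1 (hq.dvd_of_dvd_pow h)))
  have hmap : Ideal.map (algebraMap ℤ (𝓞 K)) (Ideal.span {(q : ℤ)}) = Ideal.span {(q : 𝓞 K)} := by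
    rw [Ideal.map_span, Set.image_singleton, map_natCast]
  have hq0 : (q : 𝓞 K) ≠ 0 := by exact_mod_cast hq.ne_zero
  have hbot : Ideal.span {(q : 𝓞 K)} ≠ ⊥ := by simpa using hq.ne_zero
  rw [Ideal.IsDedekindDomain.ramificationIdx_eq_multiplicity (Ideal.span {(q : ℤ)}) _ (by rw [hmap]; exact hbot), hmap] at h1
  have hqP : (q : 𝓞 K) ∈ P := by
    have := Ideal.mem_of_liesOver P (Ideal.span {(q : ℤ)}) (q : ℤ)
    have := this.1 (Ideal.mem_span_singleton_self _)
    rwa [map_natCast] at this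
  have htP : t ∈ P := hP.isPrime.mem_of_pow_mem 2 (by rw [ht, Nat.cast_mul]; exact P.mul_mem_right _ hqP)
  have h2 : (q : 𝓞 K) ∈ P ^ 2 := by
    have e1 : (q : 𝓞 K) * q ∈ P ^ 2 := by rw [← pow_two]; exact Ideal.pow_mem_pow hqP 2
    have e2 : (q : 𝓞 K) * a' ∈ P ^ 2 := by rw [← Nat.cast_mul, ← ht]; exact Ideal.pow_mem_pow htP 2
    have e3 : (1 : 𝓞 K) = q * (q.gcdA a' : ℤ) + a' * (q.gcdB a' : ℤ) := by
      have := Nat.gcd_eq_gcd_ab q a'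
      rw [hcop.gcd_eq_one] at this
      exact_mod_cast congrArg (Int.cast : ℤ → 𝓞 K) this
    have e4 : (q : 𝓞 K) = (q.gcdA a' : ℤ) * (q * q) + (q.gcdB a' : ℤ) * (q * a') := by
      linear_combination (q : 𝓞 K) * e3
    rw [e4]
    exact (P ^ 2).add_mem ((P ^ 2).mul_mem_left _ e1) ((P ^ 2).mul_mem_left _ e2)
  have h3 : P ^ 2 ∣ Ideal.span {(q : 𝓞 K)} := by
    rw [Ideal.dvd_span_singleton]; exact h2
  have hfin : FiniteMultiplicity P (Ideal.span {(q : 𝓞 K)}) :=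
    FiniteMultiplicity.of_not_isUnit (by rw [Ideal.isUnit_iff]; exact hP.ne_top) hbot
  have := hfin.le_multiplicity_of_pow_dvd h3
  omega

lemma cyc_pb (k : ℕ) (K : Type) [Field K] [NumberField K]
    [IsCyclotomicExtension {2 ^ (k + 1)} ℚ K] : ∃ B : PowerBasis ℚ K, minpoly ℚ B.gen = X ^ (2 ^ k) - C ((-1 : ℤ) : ℚ) := by
  have hζ := IsCyclotomicExtension.zeta_spec (2 ^ (k + 1)) ℚ K
  refine ⟨hζ.powerBasis ℚ, ?_⟩
  rw [IsPrimitiveRoot.powerBasis_gen ℚ hζ, ← cyclotomic_eq_minpoly_rat hζ (by positivity), cyclotomic_prime_pow_eq_geom_sum Nat.prime_two]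
  simp [Finset.sum_range_succ, add_comm]

lemma cov_tower {E K : Type} [Field E] [NumberField E] [Field K] [NumberField K] [Algebra E K] (A : PowerBasis ℚ E) (B : PowerBasis E K)
    {k n : ℕ} {b : ℕ} (hb : 1 ≤ b) (hn : 0 < n) (hA : minpoly ℚ A.gen = X ^ (2 ^ k) - C ((-1 : ℤ) : ℚ)) (hB : minpoly E B.gen = X ^ n - C (((b : ℕ) : ℤ) : E)) :
    finrank ℚ K = 2 ^ k * n ∧ Cov K ((2 ^ k * n : ℕ) * b) := by
  have hA1 : A.dim = 2 ^ k := by rw [← A.natDegree_minpoly, hA, natDegree_X_pow_sub_C]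
  have hB1 : B.dim = n := by rw [← B.natDegree_minpoly, hB, natDegree_X_pow_sub_C]
  have hA2 : A.gen ^ (2 ^ k) = -1 := by
    have := minpoly.aeval ℚ A.gen
    rw [hA, map_sub, map_pow, aeval_X, sub_eq_zero] at this
    rw [this]; simp
  have hB2 : B.gen ^ n = (b : K) := by
    have := minpoly.aeval E B.gen
    rw [hB, map_sub, map_pow, aeval_X, sub_eq_zero] at this
    rw [this]; simp
  set ζ : K := algebraMap E K A.gen
  have hζ : ζ ^ (2 ^ k) = -1 := by rw [← map_pow, hA2, map_neg, map_one]
  have hζi : IsIntegral ℤ ζ := IsIntegral.of_pow (by positivity : 0 < 2 ^ k) (by rw [hζ]; exact IsIntegral.neg (isIntegral_one : IsIntegral ℤ (1 : K)))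
  have hyi : IsIntegral ℤ B.gen := IsIntegral.of_pow hn (by rw [hB2]; simpa using isIntegral_algebraMap (R := ℤ) (A := K) (x := (b : ℤ)))
  refine ⟨by rw [← finrank_mul_finrank ℚ E K, A.finrank, B.finrank, hA1, hB1], ?_⟩
  set W := A.basis.smulTower B.basis
  have hW : ∀ x, W x = ζ ^ (x.1 : ℕ) * B.gen ^ (x.2 : ℕ) := fun x => by
    rw [Module.Basis.smulTower_apply, A.basis_eq_pow, B.basis_eq_pow, Algebra.smul_def, map_pow]
  have := cov_of (K := K) (ι := Fin A.dim × Fin B.dim) (fun x => ⟨W x, by rw [hW]; exact (hζi.pow _).mul (hyi.pow _)⟩) W.span_eq (H := b) ?_ ?_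
  · simpa [hA1, hB1] using this
  · intro x w
    change w (W x) ≤ _
    rw [hW, map_mul, map_pow, map_pow]
    have h1 : w ζ = 1 := by
      have : w ζ ^ (2 ^ k * 2) = 1 := by rw [← map_pow, pow_mul, hζ, neg_one_sq, map_one]
      exact (pow_eq_one_iff_of_nonneg (apply_nonneg w ζ) (by positivity)).1 this
    have h2 : w B.gen ^ n = b := by rw [← map_pow, hB2, InfinitePlace.map_natCast]
    have hb' : (1 : ℝ) ≤ b := by exact_mod_cast hb
    have h3 : 1 ≤ w B.gen := by
      by_contra! h
      have := pow_lt_one₀ (apply_nonneg w B.gen) h hn.ne'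
      linarith
    rw [h1, one_pow, one_mul, ← h2]
    exact pow_le_pow_right₀ h3 (by have := x.2.2; omega)
  · have hb' : (1 : ℝ) ≤ b := by exact_mod_cast hb
    have h1 : 1 ≤ Fintype.card (Fin A.dim × Fin B.dim) := by
      rw [Fintype.card_prod, Fintype.card_fin, Fintype.card_fin, hA1, hB1]
      exact Nat.mul_pos (by positivity) hn
    have h1' : (1 : ℝ) ≤ Fintype.card (Fin A.dim × Fin B.dim) := by exact_mod_cast h1
    nlinarith
end NF

namespace NF
open NumberField Module Polynomial

lemma cm_pb (k : ℕ) (K : Type) [Field K] [NumberField K] [IsCyclotomicExtension {2 ^ (k + 2)} ℚ K] :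
    ∃ B : PowerBasis (maximalRealSubfield K) K, minpoly (maximalRealSubfield K) B.gen = X ^ 2 - C ((-1 : ℤ) : maximalRealSubfield K) := by
  have hζ := IsCyclotomicExtension.zeta_spec (2 ^ (k + 2)) ℚ K
  set ζ := IsCyclotomicExtension.zeta (2 ^ (k + 2)) ℚ K
  have := IsCyclotomicExtension.Rat.isCMField K (S := {2 ^ (k + 2)}) ⟨_, rfl, by
    have : 2 ^ 2 ≤ 2 ^ (k + 2) := Nat.pow_le_pow_right (by norm_num) (by omega)
    omega⟩
  have hs : (ζ ^ 2 ^ k) ^ 2 = -1 := by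
    have h1 : (ζ ^ 2 ^ (k + 1)) ^ 2 = 1 := by rw [← pow_mul, ← pow_succ]; exact hζ.pow_eq_one
    have h2 : ζ ^ 2 ^ (k + 1) ≠ 1 := hζ.pow_ne_one_of_pos_of_lt (by positivity) (Nat.pow_lt_pow_right (by norm_num) (by omega))
    rw [← pow_mul, ← pow_succ]
    exact (sq_eq_one_iff.1 h1).resolve_left h2
  set F := maximalRealSubfield K
  have hirr : Irreducible (X ^ 2 - C ((-1 : ℤ) : F)) := by
    apply X_pow_sub_C_irreducible_of_prime Nat.prime_two
    intro b hb
    obtain ⟨w⟩ : Nonempty (InfinitePlace F) := inferInstance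
    have hw : w.IsReal := IsTotallyReal.isReal w
    have := congrArg (InfinitePlace.embedding_of_isReal hw) hb
    rw [map_pow, map_intCast] at this
    push_cast at this
    nlinarith [sq_nonneg (InfinitePlace.embedding_of_isReal hw b)]
  have hmin : minpoly F (ζ ^ 2 ^ k) = X ^ 2 - C ((-1 : ℤ) : F) := by
    refine (minpoly.eq_of_irreducible_of_monic hirr ?_ (monic_X_pow_sub_C _ two_ne_zero)).symm
    rw [map_sub, map_pow, aeval_X, hs]; simp
  have hfin : finrank F K = 2 := Algebra.IsQuadraticExtension.finrank_eq_two F K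
  have hint : IsIntegral F (ζ ^ 2 ^ k) := Algebra.IsIntegral.isIntegral _
  have htop : IntermediateField.adjoin F {ζ ^ 2 ^ k} = ⊤ := by
    rw [Field.primitive_element_iff_minpoly_natDegree_eq, hmin, natDegree_X_pow_sub_C, hfin]
  refine ⟨(IntermediateField.adjoin.powerBasis hint).map ((IntermediateField.equivOfEq htop).trans IntermediateField.topEquiv), ?_⟩
  rw [PowerBasis.map_gen, ← hmin, IntermediateField.adjoin.powerBasis_gen]
  congr 1

lemma nu_M {E K : Type} [Field E] [NumberField E] [Field K] [NumberField K] [Algebra E K] (B : PowerBasis E K) {a i : ℕ}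
    (hB : minpoly E B.gen = X ^ (2 ^ i) - C ((a : ℤ) : E)) {p : ℕ} (hp : p.Prime) (hpa : ¬ p ∣ 2 * a) :
    LK K p = ((IdN E p).card * Nat.card {η : ZMod p // η ^ (2 ^ i) = a}) * Real.log p := by
  rw [LK_prime hp, nu_rel B (by positivity) hB hp (fun h => hpa ((hp.dvd_of_dvd_pow h).mul_right _)) (fun h => hpa (by
    rw [Int.natCast_dvd_natCast] at h; exact h.mul_left _))]
  push_cast
  rfl

/-- the number of `2^i`-th roots of `a` mod `p` for `p ≡ 3 mod 4` -/
lemma rt_three {p : ℕ} (hp : p.Prime) {a : ℕ} (hs : ∀ η : ZMod p, η ^ 2 ≠ -1) (hpa : ¬ p ∣ 2 * a) (i : ℕ) :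
    Nat.card {η : ZMod p // η ^ (2 ^ (i + 1)) = a} = Nat.card {η : ZMod p // η ^ 2 = a} := by
  have := Fact.mk hp
  have h2 : (2 : ZMod p) ≠ 0 := fun h => hpa (((ZMod.natCast_eq_zero_iff 2 p).1 (by exact_mod_cast h)).mul_right _)
  have key : ∀ x y : ZMod p, (x ^ 2) ^ 2 = (y ^ 2) ^ 2 → x ^ 2 = y ^ 2 := fun x y h => by
    rcases sq_eq_sq_iff_eq_or_eq_neg.1 h with h | h
    · exact h
    by_cases hy : y = 0
    · rw [hy] at h ⊢; simpa using h
    exfalso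
    refine hs (x / y) ?_
    rw [div_pow, h, neg_div, div_self (pow_ne_zero 2 hy)]
  have hle : ∀ i, ∀ z w : ZMod p, (z ^ 2) ^ 2 ^ i = (w ^ 2) ^ 2 ^ i → z ^ 2 = w ^ 2 := by
    intro i
    induction i with
    | zero => intro z w h; simpa using h
    | succ i ih => 
      intro z w h
      apply ih
      have : ∀ z : ZMod p, (z ^ 2) ^ 2 ^ (i + 1) = ((z ^ 2 ^ i) ^ 2) ^ 2 := fun z => by ring
      rw [this, this] at h
      have := key _ _ h
      rw [← pow_mul, ← pow_mul, mul_comm, pow_mul, pow_mul] at this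
      simpa [pow_mul] using this
  have hsurj : ∀ i, ∀ z : ZMod p, ∃ w : ZMod p, (w ^ 2) ^ 2 ^ i = z ^ 2 := by
    intro i z
    let f : {z : ZMod p // ∃ u, u ^ 2 = z} → {z : ZMod p // ∃ u, u ^ 2 = z} := fun z => ⟨z.1 ^ 2 ^ i, by
      obtain ⟨u, hu⟩ := z.2
      exact ⟨u ^ 2 ^ i, by rw [← hu, ← pow_mul, ← pow_mul, mul_comm]⟩⟩
    have hf : Function.Injective f := by
      rintro ⟨_, u, rfl⟩ ⟨_, v, rfl⟩ h
      exact Subtype.ext (hle i u v (congrArg Subtype.val h))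
    obtain ⟨⟨_, w, rfl⟩, hw⟩ := Finite.surjective_of_injective hf ⟨z ^ 2, z, rfl⟩
    exact ⟨w, congrArg Subtype.val hw⟩
  have hpow : ∀ η : ZMod p, η ^ 2 ^ (i + 1) = (η ^ 2) ^ 2 ^ i := fun η => by ring
  have ha : (a : ZMod p) ≠ 0 := fun h => hpa (((ZMod.natCast_eq_zero_iff a p).1 h).mul_left _)
  by_cases hc : ∃ c : ZMod p, c ^ 2 = a
  · obtain ⟨c, hc⟩ := hc
    obtain ⟨w, hw⟩ := hsurj i c
    have hc0 : c ≠ 0 := by rintro rfl; exact ha (by rw [← hc]; simp)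
    have hw0 : w ≠ 0 := by rintro rfl; exact ha (by rw [← hc, ← hw]; simp)
    refine Nat.card_congr ((Equiv.mulRight₀ (c / w) (div_ne_zero hc0 hw0)).subtypeEquiv fun η => ?_)
    rw [hpow, ← hc, ← hw]
    change _ ↔ (η * (c / w)) ^ 2 = _
    rw [hw, mul_pow, div_pow, mul_div_assoc', div_eq_iff (pow_ne_zero 2 hw0), mul_comm (c ^ 2), mul_left_inj' (pow_ne_zero 2 hc0), ← hw]
    exact ⟨hle i _ _, fun h => by rw [h]⟩
  · push Not at hc
    have e1 : IsEmpty {η : ZMod p // η ^ 2 = a} := ⟨fun η => hc _ η.2⟩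
    have e2 : IsEmpty {η : ZMod p // η ^ 2 ^ (i + 1) = a} := ⟨fun η => hc (η.1 ^ 2 ^ i) (by refine Eq.trans ?_ η.2; rw [hpow, ← pow_mul, ← pow_mul, mul_comm])⟩
    rw [Nat.card_of_isEmpty, Nat.card_of_isEmpty]

lemma card_sq_neg_one {p : ℕ} (hp : p.Prime) (hp2 : p ≠ 2) {s : ZMod p} (hs : s ^ 2 = -1) : Nat.card {η : ZMod p // η ^ 2 = ((-1 : ℤ) : ZMod p)} = 2 := by
  have := Fact.mk hp
  have h2 : (2 : ZMod p) ≠ 0 := fun h => hp2 ((Nat.prime_dvd_prime_iff_eq hp Nat.prime_two).1 ((ZMod.natCast_eq_zero_iff 2 p).1 (by exact_mod_cast h)))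
  have hne : s ≠ -s := fun h => by
    have h3 : (2 : ZMod p) * s = 0 := by linear_combination h
    rcases mul_eq_zero.1 h3 with h3 | h3
    · exact h2 h3
    · rw [h3] at hs; simp at hs
  rw [Nat.subtype_card ({s, -s} : Finset (ZMod p)) fun x => ?_, Finset.card_pair hne]
  rw [Finset.mem_insert, Finset.mem_singleton, Int.cast_neg, Int.cast_one, ← hs, sq_eq_sq_iff_eq_or_eq_neg]

/-- constant -/
noncomputable def Cst (a D : ℕ) : ℝ := 15 * (60 * ((D : ℝ) * a) ^ 2) ^ D

lemma Cst_mono {a D D' : ℕ} (ha : 1 ≤ a) (hD : 1 ≤ D) (h : D ≤ D') : Cst a D ≤ Cst a D' := by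
  have ha' : (1 : ℝ) ≤ a := by exact_mod_cast ha
  have hD' : (1 : ℝ) ≤ D := by exact_mod_cast hD
  have h' : (D : ℝ) ≤ D' := by exact_mod_cast h
  have h1 : (1 : ℝ) ≤ D * a := one_le_mul_of_one_le_of_one_le hD' ha'
  have h2 : (D : ℝ) * a ≤ D' * a := by gcongr
  have h3 : (1 : ℝ) ≤ (D * a) ^ 2 := one_le_pow₀ h1
  unfold Cst
  gcongr ?_ * ?_
  calc (60 * ((D : ℝ) * a) ^ 2) ^ D ≤ (60 * ((D' : ℝ) * a) ^ 2) ^ D := by gcongr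
    _ ≤ _ := pow_le_pow_right₀ (by nlinarith [pow_le_pow_left₀ (by positivity) h2 2]) h

/-- the relevant data for the field `ℚ(ζ_{2^{k+1}}, a^{1/2^i})` -/
theorem fieldM {a : ℕ} (hsf : Squarefree a) (ha : 3 ≤ a) (k i : ℕ) (h : i ≤ 1 ∨ 1 ≤ k) : ∃ (c Λ : ℕ → ℝ) (κ : ℝ),
    ZData c Λ (2 ^ k * 2 ^ i) κ (Cst a (2 ^ k * 2 ^ i)) (1 / (2 * (2 ^ k * 2 ^ i : ℕ) : ℝ)) ∧
    (∀ p, p.Prime → ¬ p ∣ 2 * a → Λ p = (Nat.card {η : ZMod p // η ^ (2 ^ k) = -1} * Nat.card {η : ZMod p // η ^ (2 ^ i) = a}) * Real.log p) ∧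
    ∀ (P β : ℝ), 1 ≤ P → (2 * (2 ^ k * 2 ^ i : ℕ) : ℝ) ≤ P → Real.log (Cst a (2 ^ k * 2 ^ i)) ≤ P → 1 - 1 / (40000000 * P ^ 4) < β →
      1 - 1 / (4 * (2 ^ (k + 1) : ℕ) * Cst a (2 ^ (k + 1))) < β → β ≤ 1 → zH c κ β ≠ 0 := by
  have : NeZero ((2 ^ (k + 1) : ℕ) : ℚ) := ⟨by positivity⟩
  set E := CyclotomicField (2 ^ (k + 1)) ℚ with hE
  have : IsCyclotomicExtension {2 ^ (k + 1)} ℚ E := CyclotomicField.isCyclotomicExtension _ _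
  obtain ⟨A, hA⟩ := cyc_pb k E
  have hnu : ∀ p, p.Prime → ¬ p ∣ 2 * a → (IdN E p).card = Nat.card {η : ZMod p // η ^ (2 ^ k) = -1} := fun p hp hpa => by
    have hp2 : ¬ p ∣ 2 := fun h => hpa (h.mul_right _)
    rw [nu_rel A (by positivity) hA hp (fun h => hp2 (hp.dvd_of_dvd_pow h)) (fun h => hp.one_lt.ne' (by
      rw [Int.dvd_neg] at h; exact Nat.dvd_one.1 (Int.natCast_dvd_natCast.1 h))), nu_rat hp, one_mul]
    push_cast
    rfl
  have hirrE : ∀ i, (i ≤ 1 ∨ 1 ≤ k) → Irreducible (X ^ (2 ^ i) - C ((a : ℤ) : E)) := fun i hi => by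
    refine irr_pow i (hi.imp_right fun hk => ?_) (not_sq hsf ha (k + 1))
    refine ⟨A.gen ^ 2 ^ (k - 1), ?_⟩
    have hA2 := minpoly.aeval ℚ A.gen
    rw [hA, map_sub, map_pow, aeval_X, sub_eq_zero] at hA2
    rw [← pow_mul, ← pow_succ, Nat.sub_add_cancel hk, hA2]; simp
  have hM : ∀ i, (i ≤ 1 ∨ 1 ≤ k) → ∃ (c Λ : ℕ → ℝ) (κ : ℝ),
    ZData c Λ (2 ^ k * 2 ^ i) κ (Cst a (2 ^ k * 2 ^ i)) (1 / (2 * (2 ^ k * 2 ^ i : ℕ) : ℝ)) ∧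
    (∀ p, p.Prime → ¬ p ∣ 2 * a → Λ p = ((IdN E p).card * Nat.card {η : ZMod p // η ^ (2 ^ i) = a}) * Real.log p) := by
    intro i hi
    obtain ⟨K, _, _, _, B, hB⟩ := exists_rt E (by positivity) (hirrE i hi)
    obtain ⟨hd, hcov⟩ := cov_tower A B (by omega : 1 ≤ a) (by positivity) hA hB
    have hZ := zdata hcov
    rw [hd] at hZ
    exact ⟨_, _, _, hZ, fun p hp hpa => nu_M B hB hp hpa⟩
  obtain ⟨c, Λ, κ, hZ, hΛ⟩ := hM i h
  refine ⟨c, Λ, κ, hZ, fun p hp hpa => by rw [hΛ p hp hpa, hnu p hp hpa], ?_⟩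
  intro P β hP hDP hCP hβ1 hβ2 hβ
  have hpos : ∀ D, 1 ≤ D → 1 ≤ Cst a D := fun D hD => by
    have ha' : (1 : ℝ) ≤ a := by exact_mod_cast (by omega : 1 ≤ a)
    have hD' : (1 : ℝ) ≤ D := by exact_mod_cast hD
    have h1 : (1 : ℝ) ≤ D * a := one_le_mul_of_one_le_of_one_le hD' ha'
    have h3 : (1 : ℝ) ≤ (D * a) ^ 2 := one_le_pow₀ h1
    have h4 : (1 : ℝ) ≤ (60 * ((D : ℝ) * a) ^ 2) ^ D := one_le_pow₀ (by linarith)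
    unfold Cst; linarith
  -- trivial zero bound for i ≤ 1
  have htriv : ∀ i ≤ 1, 1 - (1 / (2 * (2 ^ k * 2 ^ i : ℕ) : ℝ)) / (2 * Cst a (2 ^ k * 2 ^ i)) < β := fun i hi => by
    refine lt_of_le_of_lt ?_ hβ2
    have h1 : 2 ^ k * 2 ^ i ≤ 2 ^ (k + 1) := by rw [← pow_add]; exact Nat.pow_le_pow_right (by norm_num) (by omega)
    have h0 : 1 ≤ 2 ^ k * 2 ^ i := Nat.one_le_iff_ne_zero.2 (by positivity)
    have h2 := Cst_mono (by omega : 1 ≤ a) h0 h1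
    have h3 := hpos _ h0
    have h1' : ((2 ^ k * 2 ^ i : ℕ) : ℝ) ≤ (2 ^ (k + 1) : ℕ) := by exact_mod_cast h1
    have h0' : (1 : ℝ) ≤ ((2 ^ k * 2 ^ i : ℕ) : ℝ) := by exact_mod_cast h0
    rw [div_div]
    gcongr 1 - 1 / ?_
    generalize ((2 ^ k * 2 ^ i : ℕ) : ℝ) = u at *
    generalize ((2 ^ (k + 1) : ℕ) : ℝ) = v at *
    generalize Cst a (2 ^ k * 2 ^ i) = w at *
    have := mul_le_mul h1' h2 (by linarith) (by linarith)
    linarith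
  by_cases hi : i ≤ 1
  · exact hZ.H_real _ (htriv i hi) hβ
  have hk : 1 ≤ k := h.resolve_left hi
  obtain ⟨c1, Λ1, κ1, hZ1, hΛ1⟩ := hM 1 (Or.inl le_rfl)
  have hn1 := hZ1.H_real _ (htriv 1 le_rfl) hβ
  intro h0
  apply hn1
  have hdegE : finrank ℚ E = 2 ^ k := by rw [A.finrank, ← A.natDegree_minpoly, hA, natDegree_X_pow_sub_C]
  have hcyc2 : IsCyclotomicExtension {2 ^ (k - 1 + 2)} ℚ E := by rwa [show k - 1 + 2 = k + 1 by omega]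
  obtain ⟨F, B0, hB0⟩ : ∃ (F : Subfield E) (B0 : PowerBasis F E), minpoly F B0.gen = X ^ 2 - C ((-1 : ℤ) : F) :=
    ⟨_, cm_pb (k - 1) E⟩
  have hNF : ∀ i, ∃ (c Λ : ℕ → ℝ) (d : ℕ) (κ C : ℝ), ZData c Λ d κ C (1 / (2 * (d : ℝ))) ∧ d ≤ 2 ^ k * 2 ^ i ∧
      (∀ p, p.Prime → ¬ p ∣ 2 * a → Λ p = ((IdN F p).card * Nat.card {η : ZMod p // η ^ (2 ^ i) = a}) * Real.log p) := by
    intro i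
    have hirr : Irreducible (X ^ (2 ^ i) - C ((a : ℤ) : F)) := by
      refine (monic_X_pow_sub_C _ (by positivity)).irreducible_of_irreducible_map (algebraMap F E) _ ?_
      have := hirrE i (Or.inr hk)
      rw [Polynomial.map_sub, Polynomial.map_pow, map_X, map_C, map_intCast]
      exact this
    obtain ⟨K, _, _, _, B, hB⟩ := exists_rt F (by positivity) hirr
    obtain ⟨ρ, hρ⟩ := exists_cov K
    refine ⟨_, _, _, _, _, zdata hρ, ?_, fun p hp hpa => nu_M B hB hp hpa⟩
    rw [← finrank_mul_finrank ℚ F K, B.finrank, ← B.natDegree_minpoly, hB, natDegree_X_pow_sub_C]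
    refine Nat.mul_le_mul_right _ ?_
    rw [← hdegE, ← finrank_mul_finrank ℚ F E]
    exact Nat.le_mul_of_pos_right _ finrank_pos
  obtain ⟨c2, Λ2, d2, κ2, C2, hZ2, hd2, hΛ2⟩ := hNF 1
  obtain ⟨c3, Λ3, d3, κ3, C3, hZ3, hd3, hΛ3⟩ := hNF i
  have hδ : ∀ d : ℕ, 1 ≤ d → d ≤ 2 ^ k * 2 ^ i → 1 - 1 / (2 * (d : ℝ)) < β := fun d hd hd' => by
    refine lt_of_le_of_lt ?_ hβ1
    have h1 : (d : ℝ) ≤ (2 ^ k * 2 ^ i : ℕ) := by exact_mod_cast hd'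
    have h2 : (1 : ℝ) ≤ d := by exact_mod_cast hd
    have h3 : P ≤ P ^ 4 := le_self_pow₀ hP (by norm_num)
    gcongr 1 - 1 / ?_
    linarith
  have hd1 : 2 ^ k * 2 ^ 1 ≤ 2 ^ k * 2 ^ i := Nat.mul_le_mul_left _ (Nat.pow_le_pow_right (by norm_num) (by omega))
  have hloc := hZ.zero_loc hP (by linarith [(Nat.cast_nonneg (2 ^ k * 2 ^ i) : (0 : ℝ) ≤ _)]) (by rwa [one_div_one_div]) hCP h0 (by simpa using hβ1)
  refine ZData.parity hZ hZ2 hZ1 hZ3 (2 * a) (by omega) (fun p hp hpa => ?_) (hδ _ hZ.d_pos le_rfl) (hδ _ hZ2.d_pos (hd2.trans hd1)) (hδ _ hZ1.d_pos hd1) (hδ _ hZ3.d_pos hd3) h0 hloc.2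
  rw [hΛ p hp hpa, hΛ1 p hp hpa, hΛ2 p hp hpa, hΛ3 p hp hpa, pow_one]
  have hp2 : ¬ p ∣ 2 := fun h => hpa (h.mul_right _)
  have hEF := nu_rel B0 two_pos hB0 hp hp2 (fun h => hp.one_lt.ne' (by
      rw [Int.dvd_neg] at h; exact Nat.dvd_one.1 (Int.natCast_dvd_natCast.1 h)))
  by_cases hs : ∃ s : ZMod p, s ^ 2 = -1
  · obtain ⟨s, hs⟩ := hs
    rw [card_sq_neg_one hp (fun h => hp2 (by rw [h])) hs] at hEF
    rw [hEF]; push_cast; ring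
  · push Not at hs
    have : IsEmpty {η : ZMod p // η ^ 2 = ((-1 : ℤ) : ZMod p)} := ⟨fun η => hs η.1 (by rw [η.2]; simp)⟩
    rw [Nat.card_of_isEmpty, mul_zero] at hEF
    have := rt_three hp hs hpa (i - 1)
    rw [Nat.sub_add_cancel (by omega)] at this
    rw [this]
end NF

namespace NF

lemma card_roots_of {p : ℕ} [Fact p.Prime] {n : ℕ} (hn : 0 < n) {ζ : ZMod p} (hζ : IsPrimitiveRoot ζ n)
    {c y : ZMod p} (hc : c ≠ 0) (hy : y ^ n = c) : Nat.card {η : ZMod p // η ^ n = c} = n := by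
  have h1 := hζ.card_nthRoots c
  rw [if_pos ⟨y, hy⟩] at h1
  have h2 := hζ.nthRoots_nodup hc
  have e : {η : ZMod p // η ^ n = c} ≃ (Polynomial.nthRoots n c).toFinset :=
    Equiv.subtypeEquivRight fun η => by rw [Multiset.mem_toFinset, Polynomial.mem_nthRoots hn]
  rw [Nat.card_congr e, Nat.card_eq_fintype_card, Fintype.card_coe, Multiset.toFinset_card_of_nodup h2, h1]

lemma exists_prim {p : ℕ} [Fact p.Prime] {n : ℕ} (hn : n ∣ p - 1) : ∃ ζ : ZMod p, IsPrimitiveRoot ζ n := by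
  have hp := (Fact.out : p.Prime)
  obtain ⟨g, hg⟩ := IsCyclic.exists_ofOrder_eq_natCard (α := (ZMod p)ˣ)
  rw [Nat.card_eq_fintype_card, ZMod.card_units] at hg
  obtain ⟨m, hm⟩ := hn
  have hg' : IsPrimitiveRoot (g : ZMod p) (p - 1) := by
    rw [← hg, ← orderOf_units]; exact IsPrimitiveRoot.orderOf _
  exact ⟨_, hg'.pow (by have := hp.two_le; omega) (by rw [hm, mul_comm])⟩

lemma pow_iff {p : ℕ} [Fact p.Prime] {n : ℕ} (hn : n ∣ p - 1) {c : ZMod p} (hc : c ≠ 0) :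
    (∃ y : ZMod p, y ^ n = c) ↔ c ^ ((p - 1) / n) = 1 := by
  have hp := (Fact.out : p.Prime)
  have hp1 : 0 < p - 1 := by have := hp.two_le; omega
  obtain ⟨m, hm⟩ := hn
  have hn0 : 0 < n := Nat.pos_of_ne_zero (by rintro rfl; omega)
  have hm0 : 0 < m := Nat.pos_of_ne_zero (by rintro rfl; omega)
  rw [hm, Nat.mul_div_cancel_left _ hn0]
  constructor
  · rintro ⟨y, rfl⟩
    rw [← pow_mul, ← hm]
    exact ZMod.pow_card_sub_one_eq_one (fun h => hc (by rw [h, zero_pow hn0.ne']))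
  · intro h
    obtain ⟨ζ, hζ⟩ := exists_prim (p := p) (dvd_refl (p - 1))
    have hex : NeZero (p - 1) := ⟨hp1.ne'⟩
    obtain ⟨t, -, ht⟩ := hζ.eq_pow_of_pow_eq_one (ZMod.pow_card_sub_one_eq_one hc)
    rw [← ht, ← pow_mul] at h
    have h2 := hζ.dvd_of_pow_eq_one _ h
    rw [hm] at h2
    obtain ⟨s, rfl⟩ := Nat.dvd_of_mul_dvd_mul_right hm0 h2
    exact ⟨ζ ^ s, by rw [← ht, ← pow_mul, mul_comm]⟩

def Sp (a k i p : ℕ) : Prop := p.Prime ∧ ¬ p ∣ 2 * a ∧ 2 ^ (k + 1) ∣ p - 1 ∧ ∃ y : ZMod p, y ^ (2 ^ i) = (a : ZMod p)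

noncomputable def ind (q : Prop) : ℝ := if q then 1 else 0

lemma sp_count {a p k i : ℕ} (hp : p.Prime) (hpa : ¬ p ∣ 2 * a) (hi : i ≤ k + 1) :
    (Nat.card {η : ZMod p // η ^ (2 ^ k) = -1} : ℝ) * Nat.card {η : ZMod p // η ^ (2 ^ i) = (a : ZMod p)} =
    (2 ^ k * 2 ^ i : ℕ) * ind (Sp a k i p) := by
  have : Fact p.Prime := ⟨hp⟩
  have hp2 : p ≠ 2 := fun h => hpa (h ▸ dvd_mul_right _ _)
  have : Fact (2 < p) := ⟨by have := hp.two_le; omega⟩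
  have ha0 : (a : ZMod p) ≠ 0 := fun h => hpa (((ZMod.natCast_eq_zero_iff _ _).1 h).mul_left _)
  by_cases h : Sp a k i p
  · rw [ind, if_pos h, mul_one]
    obtain ⟨-, -, hd, y, hy⟩ := h
    obtain ⟨ζ, hζ⟩ := exists_prim hd
    have e1 : ζ ^ (2 ^ k) = -1 := by
      have h1 : (ζ ^ (2 ^ k)) ^ 2 = 1 := by rw [← pow_mul, ← pow_succ, hζ.pow_eq_one]
      rcases sq_eq_sq_iff_eq_or_eq_neg.1 (h1.trans (one_pow 2).symm) with h | h
      · exact absurd h (hζ.pow_ne_one_of_pos_of_lt (by positivity) (Nat.pow_lt_pow_right (by norm_num) (by omega)))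
      · exact h
    have h1 := card_roots_of (by positivity) (hζ.pow (by positivity) (pow_succ' 2 k)) (neg_ne_zero.2 one_ne_zero) e1
    have h2 : 2 ^ (k + 1) = 2 ^ (k + 1 - i) * 2 ^ i := by rw [← pow_add]; congr 1; omega
    rw [h1, card_roots_of (by positivity) (hζ.pow (by positivity) h2) ha0 hy]
    push_cast; rfl
  · rw [ind, if_neg h, mul_zero]
    by_contra hne
    apply h
    have n1 := Nat.cast_ne_zero.1 (left_ne_zero_of_mul hne)
    have n2 := Nat.cast_ne_zero.1 (right_ne_zero_of_mul hne)
    obtain ⟨⟨ζ, hζ⟩⟩ := (Nat.card_ne_zero.1 n1).1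
    obtain ⟨⟨y, hy⟩⟩ := (Nat.card_ne_zero.1 n2).1
    refine ⟨hp, hpa, ?_, y, hy⟩
    have ho : orderOf ζ = 2 ^ (k + 1) := orderOf_eq_prime_pow (by rw [hζ]; exact ZMod.neg_one_ne_one)
      (by rw [pow_succ, pow_mul, hζ]; simp)
    rw [← ho]
    exact ZMod.orderOf_dvd_card_sub_one (by rintro rfl; rw [zero_pow (by positivity)] at hζ; exact neg_ne_zero.2 one_ne_zero hζ.symm)

/-- `Cd a t p`: order is odd (`t = 1`) or not divisible by four (`t = 0`). -/
def Cd (a t p : ℕ) : Prop := p.Prime ∧ ¬ p ∣ 2 * a ∧ ¬ 2 ^ (2 - t) ∣ orderOf (a : ZMod p)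

lemma cd_iff {a p t v : ℕ} (hp : p.Prime) (hpa : ¬ p ∣ 2 * a) (ht : t ≤ 1) (h1 : 2 ^ (v + 1) ∣ p - 1)
    (h2 : ¬ 2 ^ (v + 2) ∣ p - 1) : Cd a t p ↔ ∃ y : ZMod p, y ^ (2 ^ (v + t)) = (a : ZMod p) := by
  have : Fact p.Prime := ⟨hp⟩
  have ha0 : (a : ZMod p) ≠ 0 := fun h => hpa (((ZMod.natCast_eq_zero_iff _ _).1 h).mul_left _)
  have ho := ZMod.orderOf_dvd_card_sub_one ha0
  have hvt : 2 ^ (v + t) ∣ p - 1 := (pow_dvd_pow 2 (by omega)).trans h1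
  rw [pow_iff hvt ha0, ← orderOf_dvd_iff_pow_eq_one]
  simp only [Cd, hp, hpa, not_false_eq_true, true_and]
  set o := orderOf (a : ZMod p)
  obtain ⟨m, hm⟩ := h1
  have hmo : ¬ 2 ∣ m := fun ⟨w, hw⟩ => h2 ⟨w, by rw [hm, hw]; ring⟩
  have e : (p - 1) / 2 ^ (v + t) = 2 ^ (1 - t) * m := by
    rw [hm, show v + 1 = v + t + (1 - t) by omega, pow_add, mul_assoc, Nat.mul_div_cancel_left _ (by positivity)]
  rw [e]
  have hm0 : 0 < p - 1 := by have := hp.two_le; omega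
  have ho0 : o ≠ 0 := fun h => by rw [h] at ho; rw [zero_dvd_iff] at ho; omega
  constructor
  · intro hc
    obtain ⟨b, w, hw, hb⟩ := Nat.exists_eq_two_pow_mul_odd ho0
    have hb1 : b ≤ 1 - t := by
      by_contra hcon
      exact hc (by rw [hb]; exact (pow_dvd_pow 2 (by omega)).mul_right _)
    rw [hb]
    refine mul_dvd_mul (pow_dvd_pow 2 hb1) ?_
    have : w ∣ 2 ^ (v + 1) * m := by rw [← hm]; exact (Dvd.intro_left _ hb.symm).trans ho
    exact (Nat.Coprime.pow_right _ (Nat.coprime_two_right.2 hw)).dvd_of_dvd_mul_left this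
  · intro hd hc
    have := hc.trans hd
    rw [show 2 - t = 1 - t + 1 by omega, pow_succ] at this
    exact hmo (Nat.dvd_of_mul_dvd_mul_left (by positivity) this)

lemma sp_mono {a p k k' i i' : ℕ} (hk : k' ≤ k) (hi : i' ≤ i) (h : Sp a k i p) : Sp a k' i' p := by
  obtain ⟨h1, h2, h3, y, hy⟩ := h
  refine ⟨h1, h2, (pow_dvd_pow 2 (by omega)).trans h3, y ^ (2 ^ (i - i')), ?_⟩
  rw [← pow_mul, ← pow_add, Nat.sub_add_cancel hi, hy]

lemma ind_tele {a p t : ℕ} (ht : t ≤ 1) (N : ℕ) :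
    (∑ k ∈ Finset.range N, (ind (Sp a k (k + t) p) - ind (Sp a (k + 1) (k + t) p)) ≤ ind (Cd a t p)) ∧
    ind (Cd a t p) ≤ ∑ k ∈ Finset.range N, (ind (Sp a k (k + t) p) - ind (Sp a (k + 1) (k + t) p)) +
      ind (Sp a N (N + t) p) := by
  by_cases h0 : p.Prime ∧ ¬ p ∣ 2 * a
  swap
  · have h1 : ∀ k i, ind (Sp a k i p) = 0 := fun k i => if_neg (fun h => h0 ⟨h.1, h.2.1⟩)
    have h2 : ind (Cd a t p) = 0 := if_neg (fun h => h0 ⟨h.1, h.2.1⟩)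
    simp [h1, h2]
  obtain ⟨hp, hpa⟩ := h0
  have hp2 : p ≠ 2 := fun h => hpa (h ▸ dvd_mul_right _ _)
  have hodd := hp.eq_two_or_odd'.resolve_left hp2
  have hm0 : p - 1 ≠ 0 := by have := hp.two_le; omega
  obtain ⟨b, w, hw, hb⟩ := Nat.exists_eq_two_pow_mul_odd hm0
  have hb0 : b ≠ 0 := by
    rintro rfl
    obtain ⟨c, hc⟩ := hodd; obtain ⟨d, hd⟩ := hw
    omega
  obtain ⟨v, rfl⟩ := Nat.exists_eq_succ_of_ne_zero hb0
  have h1 : 2 ^ (v + 1) ∣ p - 1 := ⟨w, hb⟩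
  have h2 : ¬ 2 ^ (v + 2) ∣ p - 1 := fun h => by
    rw [hb, show v + 2 = v + 1 + 1 by ring, pow_succ] at h
    exact (Nat.not_even_iff_odd.2 hw) (even_iff_two_dvd.2 (Nat.dvd_of_mul_dvd_mul_left (by positivity) h))
  have hcd := cd_iff hp hpa ht h1 h2
  have hle : ∀ k, 2 ^ (k + 1) ∣ p - 1 ↔ k ≤ v := fun k =>
    ⟨fun h => by by_contra hc; exact h2 ((pow_dvd_pow 2 (by omega)).trans h), fun h => (pow_dvd_pow 2 (by omega)).trans h1⟩
  have hterm : ∀ k, ind (Sp a k (k + t) p) - ind (Sp a (k + 1) (k + t) p) = if k = v then ind (Cd a t p) else 0 := by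
    intro k
    simp only [ind, Sp, hp, hpa, hle, hcd]
    rcases lt_trichotomy k v with h | h | h
    · simp [h.ne, h.le, Nat.succ_le_of_lt h]
    · subst h; simp
    · simp [h.ne', not_le.2 h, show ¬ k + 1 ≤ v by omega]
  simp only [hterm]
  rw [Finset.sum_ite_eq' (Finset.range N) v]
  have hc0 : 0 ≤ ind (Cd a t p) := by unfold ind; split_ifs <;> norm_num
  have hs0 : 0 ≤ ind (Sp a N (N + t) p) := by unfold ind; split_ifs <;> norm_num
  split_ifs with h
  · constructor <;> linarith
  · refine ⟨hc0, ?_⟩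
    rw [zero_add]
    by_cases hC : Cd a t p
    · have : Sp a N (N + t) p := by
        have hv : Sp a v (v + t) p := ⟨hp, hpa, h1, hcd.1 hC⟩
        exact sp_mono (by simpa using h) (by simp at h; omega) hv
      simp [ind, hC, this]
    · rw [show ind (Cd a t p) = 0 from if_neg hC]; exact hs0
end NF

namespace NF

noncomputable def S (a k i : ℕ) (x : ℝ) : ℝ := ∑ p ∈ Finset.Icc 1 ⌊x⌋₊, ind (Sp a k i p) * Real.log p

lemma ind_nonneg (q : Prop) : 0 ≤ ind q := by unfold ind; split_ifs <;> norm_num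

lemma S_bound {a k i : ℕ} {c Λ : ℕ → ℝ} {κ C δ η x : ℝ} (ha : 1 ≤ a) (hi : i ≤ k + 1)
    (hZ : ZData c Λ (2 ^ k * 2 ^ i) κ C δ)
    (hΛ : ∀ p, p.Prime → ¬ p ∣ 2 * a → Λ p = (Nat.card {η : ZMod p // η ^ (2 ^ k) = -1} *
      Nat.card {η : ZMod p // η ^ (2 ^ i) = (a : ZMod p)}) * Real.log p)
    (hx : 1 ≤ x) (h : |∑ n ∈ Finset.Icc 1 ⌊x⌋₊, Λ n - x| ≤ 25 * η * x) :
    |S a k i x - x / 2 ^ (k + i)| ≤ 25 * η * x / 2 ^ (k + i) + (2 * √x * Real.log x + Real.log (2 * a)) := by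
  have hd : ((2 ^ k * 2 ^ i : ℕ) : ℝ) = 2 ^ (k + i) := by push_cast; rw [pow_add]
  set d : ℝ := 2 ^ (k + i)
  have hd0 : 0 < d := by positivity
  have key : ∀ n ∈ Finset.Icc 1 ⌊x⌋₊, 0 ≤ Λ n - d * (ind (Sp a k i n) * Real.log n) ∧
      Λ n - d * (ind (Sp a k i n) * Real.log n) ≤
        d * ((if ¬ n.Prime then ArithmeticFunction.vonMangoldt n else 0) + if n ∈ (2 * a).divisors then ArithmeticFunction.vonMangoldt n else 0) := by
    intro n hn
    have v0 : 0 ≤ ArithmeticFunction.vonMangoldt n := ArithmeticFunction.vonMangoldt_nonneg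
    have b1 : (0 : ℝ) ≤ (if ¬ n.Prime then ArithmeticFunction.vonMangoldt n else 0) := by split_ifs <;> simp [v0]
    have b2 : (0 : ℝ) ≤ (if n ∈ (2 * a).divisors then ArithmeticFunction.vonMangoldt n else 0) := by split_ifs <;> simp [v0]
    by_cases hp : n.Prime ∧ ¬ n ∣ 2 * a
    · rw [hΛ n hp.1 hp.2, sp_count hp.1 hp.2 hi, hd, mul_assoc, sub_self]
      exact ⟨le_rfl, by positivity⟩
    · have : ind (Sp a k i n) = 0 := if_neg (fun h => hp ⟨h.1, h.2.1⟩)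
      rw [this, zero_mul, mul_zero, sub_zero]
      refine ⟨hZ.L_nonneg n, ?_⟩
      have hL := hZ.L_le n
      rw [hd] at hL
      refine hL.trans (mul_le_mul_of_nonneg_left ?_ hd0.le)
      by_cases hq : n.Prime
      · have : n ∈ (2 * a).divisors := Nat.mem_divisors.2 ⟨by_contra fun h => hp ⟨hq, h⟩, by omega⟩
        rw [if_pos this]; linarith
      · rw [if_pos hq]; linarith
  have s1 := Finset.sum_nonneg fun n hn => (key n hn).1
  have s2 := Finset.sum_le_sum fun n hn => (key n hn).2
  rw [Finset.sum_sub_distrib, ← Finset.mul_sum] at s1 s2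
  rw [← Finset.mul_sum, Finset.sum_add_distrib, ← Finset.sum_filter] at s2
  have e1 := Chebyshev.psi_sub_theta_eq_sum_not_prime x
  have e2 := Chebyshev.psi_sub_theta_le hx
  rw [e1] at e2
  have e3 : ∑ n ∈ Finset.Icc 1 ⌊x⌋₊, (if n ∈ (2 * a).divisors then ArithmeticFunction.vonMangoldt n else 0) ≤ Real.log (2 * a) := by
    have := ArithmeticFunction.vonMangoldt_sum (n := 2 * a)
    push_cast at this
    rw [← this, ← Finset.sum_filter]
    exact Finset.sum_le_sum_of_subset_of_nonneg (fun n hn => (Finset.mem_filter.1 hn).2) fun _ _ _ => ArithmeticFunction.vonMangoldt_nonneg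
  have e4 : (Finset.Icc 1 ⌊x⌋₊) = Finset.Ioc 0 ⌊x⌋₊ := rfl
  rw [← e4] at e2
  have s3 := s2.trans (mul_le_mul_of_nonneg_left (add_le_add e2 e3) hd0.le)
  change 0 ≤ _ - d * S a k i x at s1
  change _ - d * S a k i x ≤ _ at s3
  generalize S a k i x = s at *
  generalize 2 * √x * Real.log x + Real.log (2 * a) = w at *
  rw [abs_le] at h ⊢
  have f1 : d * (x / d) = x := by field_simp
  have f2 : d * (25 * η * x / d) = 25 * η * x := by field_simp
  constructor
  · refine le_of_mul_le_mul_left ?_ hd0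
    linarith
  · refine le_of_mul_le_mul_left ?_ hd0
    have : 0 ≤ d * w := s1.trans s3
    linarith
end NF

namespace NF
open Filter

lemma logCst {a D : ℕ} (ha : 1 ≤ a) (hD : 1 ≤ D) : Real.log (Cst a D) ≤ 14 + D * Real.log (60 * ((D : ℝ) * a) ^ 2) := by
  have ha' : (1 : ℝ) ≤ a := by exact_mod_cast ha
  have hD' : (1 : ℝ) ≤ D := by exact_mod_cast hD
  unfold Cst
  rw [Real.log_mul (by norm_num) (by positivity), Real.log_pow]
  have := Real.log_le_sub_one_of_pos (by norm_num : (0 : ℝ) < 15)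
  linarith

lemma par1 {a D : ℕ} {L : ℝ} (ha : 1 ≤ a) (hD : 1 ≤ D) (hL : 1 ≤ L) (hDL : (D : ℝ) ≤ 2 * L) :
    Real.log (Cst a D) ≤ 1000 * (a : ℝ) ^ 2 * L ^ 2 ∧ 2 * (D : ℝ) ≤ 1000 * (a : ℝ) ^ 2 * L ^ 2 := by
  have ha' : (1 : ℝ) ≤ a := by exact_mod_cast ha
  have hD' : (1 : ℝ) ≤ D := by exact_mod_cast hD
  have h1 := logCst ha hD
  have ha2 : (1 : ℝ) ≤ (a : ℝ) ^ 2 := one_le_pow₀ ha'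
  have h2 : Real.log (60 * ((D : ℝ) * a) ^ 2) ≤ 240 * (a : ℝ) ^ 2 + 2 * L := by
    have e : 60 * ((D : ℝ) * a) ^ 2 ≤ (240 * (a : ℝ) ^ 2) * L ^ 2 := by
      have : (D : ℝ) ^ 2 ≤ (2 * L) ^ 2 := by gcongr
      rw [mul_pow]; nlinarith
    refine (Real.log_le_log (by positivity) e).trans ?_
    rw [Real.log_mul (by positivity) (by positivity), Real.log_pow]
    have b1 := Real.log_le_self (by positivity : (0 : ℝ) ≤ 240 * (a : ℝ) ^ 2)
    have b2 := Real.log_le_self (by linarith : 0 ≤ L)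
    push_cast; linarith
  have h3 : (D : ℝ) * Real.log (60 * ((D : ℝ) * a) ^ 2) ≤ 2 * L * (240 * (a : ℝ) ^ 2 + 2 * L) :=
    mul_le_mul hDL h2 (Real.log_nonneg (by nlinarith [one_le_mul_of_one_le_of_one_le hD' ha'])) (by linarith)
  have hLL : L ≤ L ^ 2 := le_self_pow₀ hL (by norm_num)
  have c1 : (a : ℝ) ^ 2 * L ≤ (a : ℝ) ^ 2 * L ^ 2 := by gcongr
  have c2 : L ^ 2 ≤ (a : ℝ) ^ 2 * L ^ 2 := le_mul_of_one_le_left (by positivity) ha2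
  constructor <;> nlinarith

lemma par2 {a : ℕ} (ha : 1 ≤ a) : ∀ᶠ L : ℝ in atTop, ∀ D : ℕ, 1 ≤ D → (D : ℝ) ^ 2 ≤ 4 * L →
    Cst a D ≤ Real.exp (L / 100) := by
  have ha' : (1 : ℝ) ≤ a := by exact_mod_cast ha
  have hlog : ∀ᶠ u : ℝ in atTop, Real.log u ≤ 1 / 1000 * u := by
    filter_upwards [Real.isLittleO_log_id_atTop.bound (by norm_num : (0 : ℝ) < 1 / 1000), eventually_ge_atTop 1] with u hu h1
    rw [Real.norm_eq_abs, Real.norm_eq_abs, id, abs_of_nonneg (by linarith : 0 ≤ u)] at hu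
    exact (le_abs_self _).trans hu
  set c := Real.log (240 * (a : ℝ) ^ 2)
  have hs := Real.tendsto_sqrt_atTop.eventually (hlog.and ((eventually_ge_atTop 1000).and (eventually_ge_atTop (1000 * c))))
  filter_upwards [hs, eventually_ge_atTop 1] with L ⟨h1, h2, h3⟩ hL D hD hDL
  have hD' : (1 : ℝ) ≤ D := by exact_mod_cast hD
  set u := √L
  have huL : u ^ 2 = L := Real.sq_sqrt (by linarith)
  rw [← huL] at hDL ⊢
  have hDu : (D : ℝ) ≤ 2 * u := abs_le_of_sq_le_sq' (by nlinarith) (by linarith) |>.2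
  have hC : 0 < Cst a D := by unfold Cst; positivity
  rw [← Real.log_le_iff_le_exp hC]
  refine (logCst ha hD).trans ?_
  have h4 : Real.log (60 * ((D : ℝ) * a) ^ 2) ≤ c + 2 * Real.log u := by
    have e : 60 * ((D : ℝ) * a) ^ 2 ≤ (240 * (a : ℝ) ^ 2) * u ^ 2 := by
      rw [mul_pow]; nlinarith [sq_nonneg (a : ℝ)]
    refine (Real.log_le_log (by positivity) e).trans ?_
    rw [Real.log_mul (by positivity) (by positivity), Real.log_pow]
    push_cast; rfl
  have h5 : (D : ℝ) * Real.log (60 * ((D : ℝ) * a) ^ 2) ≤ 2 * u * (c + 2 * Real.log u) :=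
    mul_le_mul hDu h4 (Real.log_nonneg (by nlinarith [one_le_mul_of_one_le_of_one_le hD' ha'])) (by linarith)
  nlinarith

lemma par3 (M : ℝ) : ∀ᶠ L : ℝ in atTop, M * L ^ 67 * Real.exp (3 * L / 100) ≤ Real.exp L := by
  have h := (isLittleO_pow_exp_pos_mul_atTop (k := 67) (by norm_num : (0 : ℝ) < 97 / 100)).bound
    (by positivity : 0 < 1 / (|M| + 1))
  filter_upwards [h, eventually_ge_atTop 0] with L h1 h0
  rw [Real.norm_of_nonneg (by positivity), Real.norm_of_nonneg (Real.exp_pos _).le, one_div, inv_mul_eq_div,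
    le_div_iff₀ (by positivity)] at h1
  have h2 : M * L ^ 67 ≤ Real.exp (97 / 100 * L) := by
    have : M * L ^ 67 ≤ (|M| + 1) * L ^ 67 := by gcongr; linarith [le_abs_self M]
    linarith
  calc _ ≤ Real.exp (97 / 100 * L) * Real.exp (3 * L / 100) := by gcongr
    _ = _ := by rw [← Real.exp_add]; congr 1; ring

lemma S_est {a : ℕ} (hsf : Squarefree a) (ha : 3 ≤ a) : ∀ᶠ L : ℝ in atTop, ∀ x : ℝ, Real.log x = Real.exp L →
    ∀ N : ℕ, (4 : ℝ) ^ N ≤ L → ∀ k ≤ N, ∀ i ≤ k + 1, 0 < x → 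
    |S a k i x - x / 2 ^ (k + i)| ≤ 25 * (1 / L) * x / 2 ^ (k + i) + (2 * √x * Real.log x + Real.log (2 * a)) := by
  have ha' : (1 : ℝ) ≤ a := by exact_mod_cast (by omega : 1 ≤ a)
  filter_upwards [par2 (by omega : 1 ≤ a), par3 (14000 * 128 * (40000000 ^ 2 * 8 * (1000 * (a : ℝ) ^ 2) ^ 8) ^ 3),
    eventually_ge_atTop 100] with L p2 p3 hL x hx N hN k hk i hi hx0
  have hL0 : 0 < L := by linarith
  have hik : i ≤ 1 ∨ 1 ≤ k := by omega
  have hx10 : Real.exp 10 ≤ x := by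
    rw [← Real.le_log_iff_exp_le hx0, hx]
    linarith [Real.add_one_le_exp L]
  have hx1 : 1 ≤ x := (Real.one_le_exp (by norm_num)).trans hx10
  obtain ⟨c, Λ, κ, hZ, hΛ, hno⟩ := fieldM hsf ha k i hik
  have hkL : (4 : ℝ) ^ k ≤ L := (pow_le_pow_right₀ (by norm_num) hk).trans hN
  have hk4 : ((2 : ℝ) ^ k) ^ 2 = 4 ^ k := by rw [← pow_mul, mul_comm, pow_mul]; norm_num
  have hdL : ((2 ^ k * 2 ^ i : ℕ) : ℝ) ≤ 2 * L := by
    have : (2 : ℝ) ^ i ≤ 2 ^ (k + 1) := pow_le_pow_right₀ (by norm_num) hi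
    push_cast
    calc (2 : ℝ) ^ k * 2 ^ i ≤ 2 ^ k * 2 ^ (k + 1) := by gcongr
      _ = 2 * 4 ^ k := by rw [← hk4]; ring
      _ ≤ _ := by linarith
  have hDsq : ((2 ^ (k + 1) : ℕ) : ℝ) ^ 2 ≤ 4 * L := by
    push_cast; rw [pow_succ 2 k, mul_pow, hk4]; linarith
  have hC2 := p2 _ (Nat.one_le_two_pow) hDsq
  have hD2 : ((2 ^ (k + 1) : ℕ) : ℝ) ≤ 2 * L := by nlinarith [(Nat.cast_nonneg (2 ^ (k + 1)) : (0 : ℝ) ≤ _)]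
  obtain ⟨q1, q2⟩ := par1 (by omega : 1 ≤ a) hZ.d_pos (by linarith) hdL
  set P : ℝ := 1000 * (a : ℝ) ^ 2 * L ^ 2 with hPdef
  have hd1 : (1 : ℝ) ≤ ((2 ^ k * 2 ^ i : ℕ) : ℝ) := by exact_mod_cast hZ.d_pos
  have hP : 1 ≤ P := by linarith
  have hP4 : 1 ≤ P ^ 4 := one_le_pow₀ hP
  set G : ℝ := 8 * L * Real.exp (L / 100) with hG
  have hG1 : 1 ≤ G := by
    have : 1 ≤ Real.exp (L / 100) := Real.one_le_exp (by positivity)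
    nlinarith
  set T : ℝ := 40000000 * P ^ 4 * G with hT
  have hT1 : 40000000 * P ^ 4 ≤ T := le_mul_of_one_le_right (by positivity) hG1
  have hT2 : G ≤ T := le_mul_of_one_le_left (by linarith) (by linarith)
  have hT0 : 0 < T := by linarith
  have hCpos : 0 < Cst a (2 ^ (k + 1)) := by unfold Cst; positivity
  have hG2 : 4 * ((2 ^ (k + 1) : ℕ) : ℝ) * Cst a (2 ^ (k + 1)) ≤ G := by
    rw [hG]
    have := mul_le_mul hD2 hC2 hCpos.le (by linarith)
    linarith
  refine S_bound (by omega) hi hZ hΛ hx1 ?_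
  refine hZ.psi_bound (τ := 1 / T) hP (by linarith) (by rw [one_div_one_div]; exact q2) q1 (by positivity)
    (by rw [div_le_one hT0]; linarith) ?_ hx10 (by positivity) ?_ ?_
  · intro β h1 h2
    refine hno P β hP q2 q1 (lt_of_le_of_lt ?_ h1) (lt_of_le_of_lt ?_ h1) h2
    · gcongr 1 - 1 / ?_
    · gcongr 1 - 1 / ?_
      exact hG2.trans hT2
  · rw [div_le_div_iff₀ hL0 (by norm_num)]; linarith
  · rw [hx, one_div_pow L, one_div (L ^ 16), inv_mul_eq_div, le_div_iff₀ (by positivity)]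
    refine le_trans (le_of_eq ?_) p3
    have : Real.exp (3 * L / 100) = Real.exp (L / 100) ^ 3 := by rw [← Real.exp_nat_mul]; congr 1; push_cast; ring
    rw [this, hT, hG, hPdef]
    generalize Real.exp (L / 100) = e
    rw [div_div_eq_mul_div, div_one]
    ring
end NF

namespace NF
open Filter

noncomputable def Th (a t : ℕ) (x : ℝ) : ℝ := ∑ p ∈ Finset.Icc 1 ⌊x⌋₊, ind (Cd a t p) * Real.log p

lemma err_small (a : ℕ) : ∀ᶠ x : ℝ in atTop, ∀ N : ℕ, (4 : ℝ) ^ N ≤ Real.log (Real.log x) →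
    (2 * N + 1) * (2 * √x * Real.log x + Real.log (2 * a)) ≤ x / Real.log (Real.log x) := by
  have h := (Real.isLittleO_pow_log_id_atTop (n := 6)).bound (by norm_num : (0 : ℝ) < 1 / 81)
  filter_upwards [h, eventually_ge_atTop 1, Real.tendsto_log_atTop.eventually_ge_atTop 1,
    Real.tendsto_sqrt_atTop.eventually_ge_atTop (Real.log (2 * a))] with x h1 hx hy hc N hN
  rw [Real.norm_of_nonneg (by positivity), id, Real.norm_of_nonneg (by linarith)] at h1
  have hL0 : 0 < Real.log (Real.log x) := lt_of_lt_of_le (by positivity) hN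
  have hLy : Real.log (Real.log x) ≤ Real.log x := Real.log_le_self (by linarith)
  have hNL : (N : ℝ) ≤ Real.log (Real.log x) := by
    refine le_trans ?_ hN
    exact_mod_cast (Nat.lt_pow_self (by norm_num : 1 < 4)).le
  generalize Real.log (Real.log x) = L at *
  generalize Real.log x = y at *
  have hs1 : 0 ≤ √x := Real.sqrt_nonneg x
  have hs2 : √x ^ 2 = x := Real.sq_sqrt (by linarith)
  have hs3 : 9 * y ^ 3 ≤ √x := Real.le_sqrt_of_sq_le (by nlinarith)
  rw [le_div_iff₀ hL0]
  have hw : 2 * √x * y + Real.log (2 * a) ≤ 3 * √x * y := by nlinarith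
  calc (2 * (N : ℝ) + 1) * (2 * √x * y + Real.log (2 * a)) * L ≤ (3 * y) * (3 * √x * y) * y := by
        have hl : 0 ≤ Real.log (2 * a) := by
          have := Real.log_natCast_nonneg (2 * a)
          push_cast at this; exact this
        have : 0 ≤ √x * y := by positivity
        gcongr
        · linarith
    _ = (9 * y ^ 3) * √x := by ring
    _ ≤ √x * √x := by gcongr
    _ = x := by rw [← sq, hs2]

lemma Th_est {a : ℕ} (hsf : Squarefree a) (ha : 3 ≤ a) : ∀ᶠ x : ℝ in atTop, 
    |S a 0 0 x - x| ≤ 200 * (x / Real.log (Real.log x)) ∧ ∀ t ≤ 1,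
    |Th a t x - 2 / 3 / 2 ^ t * x| ≤ 200 * (x / Real.log (Real.log x)) := by
  have hll : Tendsto (fun x : ℝ => Real.log (Real.log x)) atTop atTop :=
    Real.tendsto_log_atTop.comp Real.tendsto_log_atTop
  filter_upwards [hll.eventually (S_est hsf ha), err_small a, hll.eventually_ge_atTop 4,
    Real.tendsto_log_atTop.eventually_gt_atTop 1, eventually_ge_atTop 1] with x hS hW hL hy hx
  obtain ⟨N, hN1, hN2⟩ : ∃ N : ℕ, (4 : ℝ) ^ N ≤ Real.log (Real.log x) ∧ Real.log (Real.log x) < 4 ^ (N + 1) := 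
    exists_nat_pow_near (by linarith) (by norm_num)
  have hS' := hS x (by rw [Real.exp_log (by linarith)]) N hN1
  have hW' := hW N hN1
  have hw0 : 0 ≤ 2 * √x * Real.log x + Real.log (2 * a) := by
    have : 0 ≤ Real.log (2 * a) := Real.log_nonneg (by
      have : (3 : ℝ) ≤ a := by exact_mod_cast ha
      linarith)
    have : 0 ≤ √x * Real.log x := mul_nonneg (Real.sqrt_nonneg x) (by linarith)
    linarith
  clear hS hW hll
  generalize 2 * √x * Real.log x + Real.log (2 * a) = W at *
  generalize Real.log (Real.log x) = L at *
  have hL0 : 0 < L := by linarith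
  have hxL : 0 < x / L := by positivity
  have hNN : (0 : ℝ) ≤ N := Nat.cast_nonneg N
  have hW1 : W ≤ x / L := le_trans (by nlinarith) hW'
  have hx0 : 0 < x := by linarith
  refine ⟨?_, ?_⟩
  · have := hS' 0 (Nat.zero_le _) 0 (by omega) hx0
    simp only [add_zero, pow_zero, div_one] at this
    refine this.trans ?_
    have e : 25 * (1 / L) * x = 25 * (x / L) := by ring
    rw [e]; linarith
  · intro t ht
    have hterm : ∀ k ≤ N, ∀ i, i ≤ k + 1 → 
        |S a k i x - x / 2 ^ (k + i)| ≤ 25 * (x / L) / 2 ^ (k + i) + W := fun k hk i hi => by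
      have := hS' k hk i hi hx0
      rwa [show 25 * (1 / L) * x = 25 * (x / L) by ring] at this
    -- sandwich
    have hlo : ∑ k ∈ Finset.range N, (S a k (k + t) x - S a (k + 1) (k + t) x) ≤ Th a t x := by
      simp only [S, Th, ← Finset.sum_sub_distrib, ← sub_mul]
      rw [Finset.sum_comm]
      refine Finset.sum_le_sum fun p hp => ?_
      rw [← Finset.sum_mul]
      exact mul_le_mul_of_nonneg_right (ind_tele ht N).1 (Real.log_natCast_nonneg p)
    have hhi : Th a t x ≤ ∑ k ∈ Finset.range N, (S a k (k + t) x - S a (k + 1) (k + t) x) + S a N (N + t) x := by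
      simp only [S, Th, ← Finset.sum_sub_distrib, ← sub_mul]
      rw [Finset.sum_comm, ← Finset.sum_add_distrib]
      refine Finset.sum_le_sum fun p hp => ?_
      rw [← Finset.sum_mul, ← add_mul]
      exact mul_le_mul_of_nonneg_right (ind_tele ht N).2 (Real.log_natCast_nonneg p)
    have h2t : (1 : ℝ) ≤ 2 ^ t := one_le_pow₀ (by norm_num)
    have hpw : ∀ k : ℕ, (2 : ℝ) ^ (k + (k + t)) = 4 ^ k * 2 ^ t := fun k => by
      rw [← add_assoc, pow_add, ← two_mul, pow_mul]; norm_num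
    have hsum : |∑ k ∈ Finset.range N, (S a k (k + t) x - S a (k + 1) (k + t) x) -
        ∑ k ∈ Finset.range N, x / 2 ^ t / 2 * (1 / 4) ^ k| ≤ ∑ k ∈ Finset.range N, (50 * (x / L) * (1 / 4) ^ k + 2 * W) := by
      rw [← Finset.sum_sub_distrib]
      refine (Finset.abs_sum_le_sum_abs _ _).trans (Finset.sum_le_sum fun k hk => ?_)
      have hkN := Finset.mem_range.1 hk
      have h1 := hterm k hkN.le (k + t) (by omega)
      have h2 := hterm (k + 1) hkN (k + t) (by omega)
      have e2 : (2 : ℝ) ^ (k + 1 + (k + t)) = 4 ^ k * 2 ^ t * 2 := by rw [← hpw]; ring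
      rw [hpw] at h1
      rw [e2] at h2
      have e3 : x / 2 ^ t / 2 * (1 / 4) ^ k = x / (4 ^ k * 2 ^ t) - x / (4 ^ k * 2 ^ t * 2) := by
        rw [one_div_pow]; field_simp; ring
      have b1 : 25 * (x / L) / (4 ^ k * 2 ^ t) ≤ 25 * (x / L) * (1 / 4) ^ k := by
        rw [one_div_pow, mul_one_div]
        gcongr
        exact le_mul_of_one_le_right (by positivity) h2t
      have b2 : 25 * (x / L) / (4 ^ k * 2 ^ t * 2) ≤ 25 * (x / L) * (1 / 4) ^ k := by
        rw [← div_div]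
        exact (half_le_self (by positivity)).trans b1
      rw [e3]
      rw [abs_le] at *
      constructor <;> linarith [h1.1, h1.2, h2.1, h2.2]
    have hg : ∑ k ∈ Finset.range N, ((1 : ℝ) / 4) ^ k = 4 / 3 * (1 - (1 / 4) ^ N) := by
      rw [geom_sum_eq (by norm_num)]; ring
    rw [Finset.sum_add_distrib, ← Finset.mul_sum, ← Finset.mul_sum, hg, Finset.sum_const, Finset.card_range, nsmul_eq_mul] at hsum
    have htail := hterm N le_rfl (N + t) (by omega)
    rw [hpw] at htail
    have hq : ((1 : ℝ) / 4) ^ N ≤ 4 / L := by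
      rw [one_div_pow, div_le_div_iff₀ (by positivity) hL0]
      rw [pow_succ] at hN2; linarith
    have hq0 : (0 : ℝ) ≤ (1 / 4) ^ N := by positivity
    have hqx : x * (1 / 4) ^ N ≤ 4 * (x / L) := by
      calc x * (1 / 4) ^ N ≤ x * (4 / L) := by gcongr
        _ = _ := by ring
    have hu : x / 2 ^ t ≤ x := div_le_self hx0.le h2t
    have hu0 : 0 ≤ x / 2 ^ t := by positivity
    have ht1 : x / (4 ^ N * 2 ^ t) = x / 2 ^ t * (1 / 4) ^ N := by rw [one_div_pow]; field_simp
    have ht2 : 25 * (x / L) / (4 ^ N * 2 ^ t) ≤ 25 * (x / L) :=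
      div_le_self (by positivity) (one_le_mul_of_one_le_of_one_le (one_le_pow₀ (by norm_num)) h2t)
    have hv : x / 2 ^ t * (1 / 4) ^ N ≤ 4 * (x / L) := le_trans (by gcongr) hqx
    have hv0 : 0 ≤ x / 2 ^ t * (1 / 4) ^ N := by positivity
    rw [ht1] at htail
    have hm : 2 / 3 / 2 ^ t * x = 2 / 3 * (x / 2 ^ t) := by ring
    rw [hm]
    have hr : 50 * (x / L) * (4 / 3 * (1 - (1 / 4) ^ N)) ≤ 67 * (x / L) := by nlinarith
    generalize S a N (N + t) x = s at *
    generalize ∑ k ∈ Finset.range N, (S a k (k + t) x - S a (k + 1) (k + t) x) = G at *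
    have hm2 : x / 2 ^ t / 2 * (4 / 3 * (1 - (1 / 4) ^ N)) = 2 / 3 * (x / 2 ^ t) - 2 / 3 * (x / 2 ^ t * (1 / 4) ^ N) := by ring
    rw [hm2] at hsum
    rw [abs_le] at *
    constructor <;> linarith [hsum.1, hsum.2, htail.1, htail.2]
end NF

namespace NF
open Filter MeasureTheory

lemma li_eq {x : ℝ} (hx : 2 ≤ x) : li x = x / Real.log x - 2 / Real.log 2 + ∫ t in (2:ℝ)..x, 1 / Real.log t ^ 2 := by
  have hne : ∀ t ∈ Set.uIcc 2 x, Real.log t ≠ 0 ∧ t ≠ 0 := fun t ht => by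
    rw [Set.uIcc_of_le hx] at ht
    exact ⟨(Real.log_pos (by linarith [ht.1])).ne', by linarith [ht.1]⟩
  have i2 := Chebyshev.intervalIntegrable_one_div_log_sq (by norm_num : (1:ℝ) < 2) (by linarith : 1 < x)
  have i1 : IntervalIntegrable (fun t => 1 / Real.log t) volume 2 x := by
    refine ContinuousOn.intervalIntegrable fun t ht => ?_
    obtain ⟨h1, h2⟩ := hne t ht
    exact ContinuousAt.continuousWithinAt (by fun_prop (disch := assumption))
  have h := intervalIntegral.integral_eq_sub_of_hasDerivAt (f := fun t => t / Real.log t)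
    (f' := fun t => 1 / Real.log t - 1 / Real.log t ^ 2) (a := 2) (b := x) (fun t ht => by
      obtain ⟨h1, h2⟩ := hne t ht
      refine ((hasDerivAt_id' t).div (Real.hasDerivAt_log h2) h1).congr_deriv ?_
      field_simp) (i1.sub i2)
  rw [intervalIntegral.integral_sub i1 i2] at h
  unfold li
  linarith

lemma count_eq (Q : ℕ → Prop) (hQ : ∀ n, Q n → n.Prime) {x : ℝ} (hx : 2 ≤ x) :
    |∑ n ∈ Finset.Icc 1 ⌊x⌋₊, ind (Q n) - (∑ n ∈ Finset.Icc 1 ⌊x⌋₊, ind (Q n) * Real.log n) / Real.log x| ≤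
      Real.log 4 * ∫ t in (2:ℝ)..x, 1 / Real.log t ^ 2 := by
  set c : ℕ → ℝ := fun n => ind (Q n) * Real.log n with hc
  have h0 : ind (Q 0) = 0 := if_neg fun h => Nat.not_prime_zero (hQ 0 h)
  have hcc : ∀ m, ∑ n ∈ Finset.Icc 0 m, c n = ∑ n ∈ Finset.Icc 1 m, c n := fun m => by
    rw [← Finset.add_sum_Ioc_eq_sum_Icc (Nat.zero_le m)]; simp [hc]; rfl
  have hci : ∑ n ∈ Finset.Icc 1 ⌊x⌋₊, ind (Q n) = ∑ n ∈ Finset.Icc 0 ⌊x⌋₊, (Real.log n)⁻¹ * c n := by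
    rw [← Finset.add_sum_Ioc_eq_sum_Icc (Nat.zero_le _)]
    simp only [hc, Nat.cast_zero, Real.log_zero, mul_zero, zero_add]
    refine Finset.sum_congr rfl fun n hn => ?_
    by_cases h : Q n
    · have := (Real.log_pos (by exact_mod_cast (hQ n h).one_lt : (1 : ℝ) < n)).ne'
      simp [ind, h, this]
    · simp [ind, h]
  have habel := sum_mul_eq_sub_integral_mul₁ c (f := fun n ↦ (Real.log n)⁻¹) (by simp [hc]) (by simp [hc]) x ?_ ?_
  · rw [hci, habel, hcc, div_eq_inv_mul, sub_sub_cancel_left, abs_neg, ← intervalIntegral.integral_of_le hx,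
      ← intervalIntegral.integral_const_mul, ← Real.norm_eq_abs]
    refine intervalIntegral.norm_integral_le_of_norm_le hx ?_ ?_
    · refine Eventually.of_forall fun t ht => ?_
      have ht0 : 0 < t := by linarith [ht.1]
      have hl : 0 < Real.log t := Real.log_pos (by linarith [ht.1])
      rw [hcc, Real.deriv_inv_log_apply, Real.norm_eq_abs, abs_mul]
      have b0 : 0 ≤ ∑ n ∈ Finset.Icc 1 ⌊t⌋₊, c n :=
        Finset.sum_nonneg fun n _ => mul_nonneg (ind_nonneg _) (Real.log_natCast_nonneg n)
      have b1 : ∑ n ∈ Finset.Icc 1 ⌊t⌋₊, c n ≤ Real.log 4 * t := by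
        refine le_trans ?_ (Chebyshev.theta_le_log4_mul_x ht0.le)
        rw [Chebyshev.theta, Finset.sum_filter]
        refine Finset.sum_le_sum fun n _ => ?_
        by_cases h : Q n
        · simp [hc, ind, h, hQ n h]
        · simp only [hc, ind, h, if_false, zero_mul]
          split_ifs
          · exact Real.log_natCast_nonneg n
          · exact le_rfl
      rw [abs_of_nonneg b0]
      have e : |-t⁻¹ / Real.log t ^ 2| = t⁻¹ / Real.log t ^ 2 := by
        rw [neg_div, abs_neg, abs_of_pos (by positivity)]
      rw [e]
      calc t⁻¹ / Real.log t ^ 2 * ∑ n ∈ Finset.Icc 1 ⌊t⌋₊, c n ≤ t⁻¹ / Real.log t ^ 2 * (Real.log 4 * t) := by gcongr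
        _ = _ := by field_simp
    · exact (Chebyshev.intervalIntegrable_one_div_log_sq (by norm_num) (by linarith)).const_mul _
  · intro z ⟨_, _⟩
    have : z ≠ 0 := by linarith
    have : Real.log z ≠ 0 := by apply Real.log_ne_zero_of_pos_of_ne_one <;> linarith
    fun_prop
  · refine ContinuousOn.integrableOn_Icc fun z ⟨_, _⟩ ↦ ContinuousWithinAt.congr ?_
      (fun _ _ ↦ Real.deriv_inv_log_apply) Real.deriv_inv_log_apply
    have : z ≠ 0 := by linarith
    have : Real.log z ^ 2 ≠ 0 := by
      refine pow_ne_zero 2 <| Real.log_ne_zero_of_pos_of_ne_one ?_ ?_ <;> linarith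
    exact ContinuousAt.continuousWithinAt <| by fun_prop

lemma final_of (Q : ℕ → Prop) (hQ : ∀ n, Q n → n.Prime) (K : ℝ)
    (h : ∀ᶠ x : ℝ in atTop, |∑ n ∈ Finset.Icc 1 ⌊x⌋₊, ind (Q n) * Real.log n - 1 / 3 * x| ≤ K * (x / Real.log (Real.log x))) :
    ∃ K' > (0 : ℝ), ∃ x₀ : ℝ, ∀ x ≥ x₀, |∑ n ∈ Finset.Icc 1 ⌊x⌋₊, ind (Q n) - (1 / 3) * li x| ≤
      K' * (x / (Real.log x * Real.log (Real.log x))) := by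
  obtain ⟨C, hC0, hC⟩ := Chebyshev.integral_one_div_log_sq_isBigO.exists_pos
  have hC := hC.bound
  have hll : Tendsto (fun x : ℝ => Real.log (Real.log x)) atTop atTop :=
    Real.tendsto_log_atTop.comp Real.tendsto_log_atTop
  have hsq : ∀ᶠ x : ℝ in atTop, Real.log x ^ 2 ≤ x := by
    filter_upwards [(Real.isLittleO_pow_log_id_atTop (n := 2)).bound (by norm_num : (0 : ℝ) < 1), eventually_ge_atTop 0] with x h1 h0
    rw [Real.norm_of_nonneg (by positivity), id, Real.norm_of_nonneg h0, one_mul] at h1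
    exact h1
  have hl2 : 0 < Real.log 2 := Real.log_pos (by norm_num)
  have hl4 : 0 < Real.log 4 := Real.log_pos (by norm_num)
  set K' : ℝ := |K| + (Real.log 4 + 1) * C + 2 / Real.log 2 with hK'
  refine ⟨K', by positivity, ?_⟩
  rw [← eventually_atTop]
  filter_upwards [h, hC, hsq, hll.eventually_ge_atTop 1, Real.tendsto_log_atTop.eventually_ge_atTop 1,
    eventually_ge_atTop 2] with x h1 h2 h3 hL hy hx
  have c1 := count_eq Q hQ hx
  have c2 := li_eq hx
  have hx0 : 0 < x := by linarith
  have hLy : Real.log (Real.log x) ≤ Real.log x := Real.log_le_self (by linarith)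
  generalize Real.log (Real.log x) = L at *
  generalize ∑ n ∈ Finset.Icc 1 ⌊x⌋₊, ind (Q n) * Real.log n = Θ at *
  generalize ∑ n ∈ Finset.Icc 1 ⌊x⌋₊, ind (Q n) = π at *
  rw [Real.norm_eq_abs] at h2
  generalize ∫ t in (2:ℝ)..x, 1 / Real.log t ^ 2 = I at *
  generalize Real.log x = y at *
  rw [Real.norm_of_nonneg (by positivity)] at h2
  rw [c2]
  set z := x / (y * L) with hz
  have hz1 : 1 ≤ z := by
    rw [hz, le_div_iff₀ (by positivity)]
    nlinarith
  have hz2 : x / y ^ 2 ≤ z := by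
    rw [hz, sq]; gcongr
  have hI : |I| ≤ C * z := h2.trans (by gcongr)
  have d1 : |Θ / y - 1 / 3 * (x / y)| ≤ |K| * z := by
    have : Θ / y - 1 / 3 * (x / y) = (Θ - 1 / 3 * x) / y := by ring
    rw [this, abs_div, abs_of_pos (by linarith : 0 < y), div_le_iff₀ (by linarith)]
    refine h1.trans ?_
    have : |K| * z * y = |K| * (x / L) := by rw [hz]; field_simp
    rw [this]
    gcongr
    exact le_abs_self K
  have d2 : Real.log 4 * I ≤ Real.log 4 * (C * z) := by
    gcongr; exact (le_abs_self I).trans hI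
  have d3 : 2 / Real.log 2 ≤ 2 / Real.log 2 * z := le_mul_of_one_le_right (by positivity) hz1
  have d4 : 0 < 2 / Real.log 2 := by positivity
  have d5 : K' * z = |K| * z + (Real.log 4 * (C * z) + C * z) + 2 / Real.log 2 * z := by rw [hK']; ring
  have d6 : 0 ≤ C * z := by positivity
  rw [d5]
  rw [abs_le] at *
  constructor <;> linarith [c1.1, c1.2, hI.1, hI.2, d1.1, d1.2]

lemma Q_card (a l : ℕ) (x : ℝ) (hx : 0 ≤ x) (Q : ℕ → Prop)
    (hQ : ∀ p : ℕ, Q p ↔ p.Prime ∧ ¬ p ∣ 2 * a ∧ orderOf (a : ZMod p) % 4 = l) :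
    (Qcount a x l : ℝ) = ∑ n ∈ Finset.Icc 1 ⌊x⌋₊, ind (Q n) := by
  unfold Qcount
  have : {p : ℕ | p.Prime ∧ p ≠ 2 ∧ ¬(p ∣ a) ∧ (p : ℝ) ≤ x ∧ orderOf (a : ZMod p) % 4 = l} =
      ((Finset.Icc 1 ⌊x⌋₊).filter Q : Finset ℕ) := by
    ext p
    simp only [Set.mem_ofPred_eq, Finset.coe_filter, Finset.mem_Icc, hQ, Nat.le_floor_iff hx]
    constructor
    · rintro ⟨h1, h2, h3, h4, h5⟩
      refine ⟨⟨h1.one_le, h4⟩, h1, ?_, h5⟩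
      rw [h1.dvd_mul]
      rintro (h | h)
      · exact h2 ((Nat.prime_dvd_prime_iff_eq h1 Nat.prime_two).1 h)
      · exact h3 h
    · rintro ⟨⟨-, h4⟩, h1, h2, h5⟩
      exact ⟨h1, fun h => h2 (h ▸ dvd_mul_right _ _), fun h => h2 (h.mul_left _), h4, h5⟩
  rw [this, Set.ncard_coe_finset, Finset.card_filter]
  push_cast
  rfl

lemma sp00 (a p : ℕ) : Sp a 0 0 p ↔ p.Prime ∧ ¬ p ∣ 2 * a := by
  constructor
  · exact fun h => ⟨h.1, h.2.1⟩
  · rintro ⟨hp, hpa⟩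
    refine ⟨hp, hpa, ?_, a, by simp⟩
    have hp2 : p ≠ 2 := fun h => hpa (h ▸ dvd_mul_right _ _)
    obtain ⟨c, hc⟩ := hp.eq_two_or_odd'.resolve_left hp2
    exact ⟨c, by omega⟩

end NF

theorem Qcount_asymptotic_zero_two (a : ℕ) (hsf : Squarefree a) (ha : 3 ≤ a) :
    ∀ l ∈ ({0, 2} : Set ℕ),
      ∃ K > (0 : ℝ), ∃ x₀ : ℝ, ∀ x ≥ x₀,
        |(Qcount a x l : ℝ) - (1 / 3) * li x|
          ≤ K * (x / (Real.log x * Real.log (Real.log x))) := by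
  intro l hl
  set Q : ℕ → Prop := fun p => p.Prime ∧ ¬ p ∣ 2 * a ∧ orderOf (a : ZMod p) % 4 = l with hQ
  have key : ∀ᶠ x : ℝ in Filter.atTop, |∑ n ∈ Finset.Icc 1 ⌊x⌋₊, NF.ind (Q n) * Real.log n - 1 / 3 * x| ≤
      400 * (x / Real.log (Real.log x)) := by
    filter_upwards [NF.Th_est hsf ha] with x ⟨h0, h1⟩
    have t0 := h1 0 (by norm_num)
    have t1 := h1 1 le_rfl
    rcases hl with rfl | hl
    · have : ∑ n ∈ Finset.Icc 1 ⌊x⌋₊, NF.ind (Q n) * Real.log n = NF.S a 0 0 x - NF.Th a 0 x := by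
        rw [NF.S, NF.Th, ← Finset.sum_sub_distrib]
        refine Finset.sum_congr rfl fun p _ => ?_
        rw [← sub_mul]
        congr 1
        simp only [NF.ind, NF.sp00, NF.Cd, hQ, Nat.dvd_iff_mod_eq_zero (m := 2 ^ (2 - 0))]
        by_cases h1 : p.Prime <;> by_cases h2 : p ∣ 2 * a <;> by_cases h3 : orderOf (a : ZMod p) % 4 = 0 <;> simp [h1, h2, h3]
      rw [this]
      rw [abs_le] at *
      norm_num at t0
      constructor <;> linarith [h0.1, h0.2, t0.1, t0.2]
    · rw [Set.mem_singleton_iff] at hl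
      subst hl
      have : ∑ n ∈ Finset.Icc 1 ⌊x⌋₊, NF.ind (Q n) * Real.log n = NF.Th a 0 x - NF.Th a 1 x := by
        rw [NF.Th, NF.Th, ← Finset.sum_sub_distrib]
        refine Finset.sum_congr rfl fun p _ => ?_
        rw [← sub_mul]
        congr 1
        simp only [NF.ind, NF.Cd, hQ]
        by_cases h1 : p.Prime <;> by_cases h2 : p ∣ 2 * a <;> simp only [h1, h2, true_and, false_and, not_true, not_false_eq_true, if_false, sub_self]
        generalize orderOf (a : ZMod p) = o
        norm_num
        split_ifs <;> first | omega | norm_num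
      rw [this]
      rw [abs_le] at *
      norm_num at t0 t1
      constructor <;> linarith [t1.1, t1.2, t0.1, t0.2]
  obtain ⟨K, hK, x₀, h⟩ := NF.final_of Q (fun n h => h.1) 400 key
  refine ⟨K, hK, max x₀ 0, fun x hx => ?_⟩
  rw [NF.Q_card a l x ((le_max_right _ _).trans hx) Q (fun p => Iff.rfl)]
  exact h x ((le_max_left _ _).trans hx)
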